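/- arXiv:1202.5812 — 4 statements merged into one kernel-verified Lean document; each statement's English description precedes it below -/
import Mathlib

section
/- Let G be a finite group containing an abelian normal subgroup A and a bicyclic subgroup G_0 such that G is the internal semidirect product of A by G_0 (i.e., A ∩ G_0 = 1 and A·G_0 = G). Then B_0(G) = 0. -/
/-- The coefficient group `ℚ/ℤ`. -/
abbrev QZ : Type := ℚ ⧸ AddSubgroup.zmultiples (1 : ℚ)

/-- A (inhomogeneous) 2-cocycle on `G` with values in `ℚ/ℤ` (trivial action). -/
def IsGrpCocycle {G : Type*} [Group G] (f : G → G → QZ) : Prop :=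
  ∀ g h k : G, f g h + f (g * h) k = f h k + f g (h * k)

/-- A 2-coboundary on `G` with values in `ℚ/ℤ` (trivial action). -/
def IsGrpCoboundary {G : Type*} [Group G] (f : G → G → QZ) : Prop :=
  ∃ c : G → QZ, ∀ g h : G, f g h = c g + c h - c (g * h)

/-- The additive group of 2-cocycles. -/
def cocycles2 (G : Type*) [Group G] : AddSubgroup (G → G → QZ) where
  carrier := {f | IsGrpCocycle f}
  zero_mem' := by intro g h k; simp
  add_mem' := by
    intro a b ha hb g h k
    simp only [Pi.add_apply]
    rw [add_add_add_comm, ha g h k, hb g h k, add_add_add_comm]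
  neg_mem' := by
    intro a ha g h k
    simp only [Pi.neg_apply, ← neg_add]
    rw [ha g h k]

/-- The subgroup of 2-coboundaries inside the group of 2-cocycles. -/
def coboundaries2 (G : Type*) [Group G] : AddSubgroup (cocycles2 G) where
  carrier := {f | IsGrpCoboundary (f : G → G → QZ)}
  zero_mem' := ⟨0, by intro g h; simp⟩
  add_mem' := by
    rintro a b ⟨c, hc⟩ ⟨d, hd⟩
    refine ⟨c + d, fun g h => ?_⟩
    have : ((a + b : cocycles2 G) : G → G → QZ) g h
        = (a : G → G → QZ) g h + (b : G → G → QZ) g h := rfl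
    rw [this, hc g h, hd g h]
    simp only [Pi.add_apply]
    abel
  neg_mem' := by
    rintro a ⟨c, hc⟩
    refine ⟨-c, fun g h => ?_⟩
    have : ((-a : cocycles2 G) : G → G → QZ) g h = -((a : G → G → QZ) g h) := rfl
    rw [this, hc g h]
    simp only [Pi.neg_apply]
    abel

/-- The second cohomology group `H²(G, ℚ/ℤ)` (trivial action), as cocycles mod coboundaries. -/
abbrev H2 (G : Type*) [Group G] : Type _ := cocycles2 G ⧸ coboundaries2 G

/-- A group is bicyclic if it is cyclic or the direct product of two cyclic groups. -/
def IsBicyclic (A : Type*) [Group A] : Prop :=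
  IsCyclic A ∨ ∃ B C : Subgroup A, IsCyclic B ∧ IsCyclic C ∧ Nonempty (A ≃* B × C)

/-- The restriction of `f` to every bicyclic subgroup is a coboundary. -/
def RestrictsToCoboundaries {G : Type*} [Group G] (f : G → G → QZ) : Prop :=
  ∀ A : Subgroup G, IsBicyclic A → IsGrpCoboundary (fun a b : A => f a b)

/-- The Bogomolov multiplier `B₀(G)`: the subgroup of `H²(G, ℚ/ℤ)` consisting of the classes
whose restriction to every bicyclic subgroup of `G` vanishes. -/
def B0 (G : Type*) [Group G] : AddSubgroup (H2 G) where
  carrier := {x | ∃ f : cocycles2 G,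
    (QuotientAddGroup.mk f : H2 G) = x ∧ RestrictsToCoboundaries (f : G → G → QZ)}
  zero_mem' := by
    refine ⟨0, rfl, fun A _ => ⟨0, fun a b => ?_⟩⟩
    simp
  add_mem' := by
    rintro x y ⟨f, rfl, hf⟩ ⟨g, rfl, hg⟩
    refine ⟨f + g, rfl, fun A hA => ?_⟩
    obtain ⟨c, hc⟩ := hf A hA
    obtain ⟨d, hd⟩ := hg A hA
    refine ⟨c + d, fun a b => ?_⟩
    have hc' : (f : G → G → QZ) (a : G) (b : G) = c a + c b - c (a * b) := hc a b
    have hd' : (g : G → G → QZ) (a : G) (b : G) = d a + d b - d (a * b) := hd a b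
    show ((f + g : cocycles2 G) : G → G → QZ) (a : G) (b : G)
        = (c + d) a + (c + d) b - (c + d) (a * b)
    have : ((f + g : cocycles2 G) : G → G → QZ) (a : G) (b : G)
        = (f : G → G → QZ) (a : G) (b : G) + (g : G → G → QZ) (a : G) (b : G) := rfl
    rw [this, hc', hd']
    simp only [Pi.add_apply]
    abel
  neg_mem' := by
    rintro x ⟨f, rfl, hf⟩
    refine ⟨-f, rfl, fun A hA => ?_⟩
    obtain ⟨c, hc⟩ := hf A hA
    refine ⟨-c, fun a b => ?_⟩
    have hc' : (f : G → G → QZ) (a : G) (b : G) = c a + c b - c (a * b) := hc a b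
    show ((-f : cocycles2 G) : G → G → QZ) (a : G) (b : G)
        = (-c) a + (-c) b - (-c) (a * b)
    have : ((-f : cocycles2 G) : G → G → QZ) (a : G) (b : G)
        = -((f : G → G → QZ) (a : G) (b : G)) := rfl
    rw [this, hc']
    simp only [Pi.neg_apply]
    abel


namespace BogAux

open scoped commutatorElement

/-- Commuting reformulation. -/
lemma commute_iff {E : Type*} [Group E] (N : Subgroup E) [hN : N.Normal]
    (hc : ∀ x ∈ N, ∀ y ∈ N, x * y = y * x) {X Y a b : E} (hXY : X * Y = Y * X)
    (ha : a ∈ N) (hb : b ∈ N) :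
    (b⁻¹ * X) * (a * Y) = (a * Y) * (b⁻¹ * X) ↔
      (X * a * X⁻¹ * a⁻¹) * (Y * b * Y⁻¹ * b⁻¹) = 1 := by
  have h1 : X * a * X⁻¹ ∈ N := hN.conj_mem a ha X
  have h2 : Y * b * Y⁻¹ ∈ N := hN.conj_mem b hb Y
  have e1 : (b⁻¹ * X) * (a * Y) = b⁻¹ * (X * a * X⁻¹) * (X * Y) := by group
  have e2 : (a * Y) * (b⁻¹ * X) = a * (Y * b * Y⁻¹)⁻¹ * (X * Y) := by rw [hXY]; group
  rw [e1, e2, mul_left_inj]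
  generalize X * a * X⁻¹ = p at *
  generalize Y * b * Y⁻¹ = q at *
  letI : CommGroup N := { (inferInstance : Group N) with
    mul_comm := fun x y => Subtype.ext (hc x x.2 y y.2) }
  have key : ∀ a b p q : N, b⁻¹ * p = a * q⁻¹ ↔ p * a⁻¹ * (q * b⁻¹) = 1 := by
    intro a b p q
    rw [← div_eq_one]
    have : b⁻¹ * p / (a * q⁻¹) = p * a⁻¹ * (q * b⁻¹) := by
      rw [div_eq_mul_inv, mul_inv, inv_inv]
      simp only [mul_comm, mul_left_comm, mul_assoc]
    rw [this]
  have := key ⟨a, ha⟩ ⟨b, hb⟩ ⟨p, h1⟩ ⟨q, h2⟩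
  simpa [Subtype.ext_iff] using this

/-- Conjugation minus identity on an abelian normal subgroup, as products. -/
lemma diff_mul {E : Type*} [Group E] (N : Subgroup E) [hN : N.Normal]
    (hc : ∀ x ∈ N, ∀ y ∈ N, x * y = y * x) (X Y : E) {a b c d : E}
    (ha : a ∈ N) (hb : b ∈ N) (hc' : c ∈ N) (hd : d ∈ N) :
    (X * a * X⁻¹ * a⁻¹) * (Y * b * Y⁻¹ * b⁻¹) * ((X * c * X⁻¹ * c⁻¹) * (Y * d * Y⁻¹ * d⁻¹)) =
    (X * (a * c) * X⁻¹ * (a * c)⁻¹) * (Y * (b * d) * Y⁻¹ * (b * d)⁻¹) := by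
  have h1 : X * a * X⁻¹ ∈ N := hN.conj_mem a ha X
  have h2 : Y * b * Y⁻¹ ∈ N := hN.conj_mem b hb Y
  have h3 : X * c * X⁻¹ ∈ N := hN.conj_mem c hc' X
  have h4 : Y * d * Y⁻¹ ∈ N := hN.conj_mem d hd Y
  have e1 : X * (a * c) * X⁻¹ = (X * a * X⁻¹) * (X * c * X⁻¹) := by group
  have e2 : Y * (b * d) * Y⁻¹ = (Y * b * Y⁻¹) * (Y * d * Y⁻¹) := by group
  rw [e1, e2]
  generalize X * a * X⁻¹ = p at *
  generalize Y * b * Y⁻¹ = q at *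
  generalize X * c * X⁻¹ = r at *
  generalize Y * d * Y⁻¹ = s at *
  letI : CommGroup N := { (inferInstance : Group N) with
    mul_comm := fun x y => Subtype.ext (hc x x.2 y y.2) }
  have key : ∀ a b c d p q r s : N,
      p * a⁻¹ * (q * b⁻¹) * (r * c⁻¹ * (s * d⁻¹)) = p * r * (a * c)⁻¹ * (q * s * (b * d)⁻¹) := by
    intro a b c d p q r s
    simp only [mul_inv]
    simp only [mul_comm, mul_left_comm, mul_assoc]
  have := key ⟨a, ha⟩ ⟨b, hb⟩ ⟨c, hc'⟩ ⟨d, hd⟩ ⟨p, h1⟩ ⟨q, h2⟩ ⟨r, h3⟩ ⟨s, h4⟩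
  simpa [Subtype.ext_iff] using this

/-- The subgroup `(X-1)N + (Y-1)N`. -/
def K {E : Type*} [Group E] (N : Subgroup E) [hN : N.Normal]
    (hc : ∀ x ∈ N, ∀ y ∈ N, x * y = y * x) (X Y : E) : Subgroup E where
  carrier := {k | ∃ a ∈ N, ∃ b ∈ N, k = (X * a * X⁻¹ * a⁻¹) * (Y * b * Y⁻¹ * b⁻¹)}
  one_mem' := ⟨1, N.one_mem, 1, N.one_mem, by group⟩
  mul_mem' := by
    rintro _ _ ⟨a, ha, b, hb, rfl⟩ ⟨c, hc', d, hd, rfl⟩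
    exact ⟨a * c, N.mul_mem ha hc', b * d, N.mul_mem hb hd, diff_mul N hc X Y ha hb hc' hd⟩
  inv_mem' := by
    rintro _ ⟨a, ha, b, hb, rfl⟩
    refine ⟨a⁻¹, N.inv_mem ha, b⁻¹, N.inv_mem hb, ?_⟩
    rw [inv_eq_iff_mul_eq_one, diff_mul N hc X Y ha hb (N.inv_mem ha) (N.inv_mem hb)]
    group

lemma K_le {E : Type*} [Group E] (N : Subgroup E) [hN : N.Normal]
    (hc : ∀ x ∈ N, ∀ y ∈ N, x * y = y * x) (X Y : E) : K N hc X Y ≤ N := by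
  rintro _ ⟨a, ha, b, hb, rfl⟩
  exact N.mul_mem (N.mul_mem (hN.conj_mem a ha X) (N.inv_mem ha))
    (N.mul_mem (hN.conj_mem b hb Y) (N.inv_mem hb))

lemma K_conj {E : Type*} [Group E] (N : Subgroup E) [hN : N.Normal]
    (hc : ∀ x ∈ N, ∀ y ∈ N, x * y = y * x) (X Y Z : E) (hX : Commute Z X) (hY : Commute Z Y)
    (k : E) (hk : k ∈ K N hc X Y) : Z * k * Z⁻¹ ∈ K N hc X Y := by
  obtain ⟨a, ha, b, hb, rfl⟩ := hk
  refine ⟨Z * a * Z⁻¹, hN.conj_mem a ha Z, Z * b * Z⁻¹, hN.conj_mem b hb Z, ?_⟩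
  have e1 : X * (Z * a * Z⁻¹) * X⁻¹ = Z * (X * a * X⁻¹) * Z⁻¹ := by
    have : X * (Z * a * Z⁻¹) * X⁻¹ = (X * Z) * a * (X * Z)⁻¹ := by group
    rw [this, ← hX.eq]; group
  have e2 : Y * (Z * b * Z⁻¹) * Y⁻¹ = Z * (Y * b * Y⁻¹) * Z⁻¹ := by
    have : Y * (Z * b * Z⁻¹) * Y⁻¹ = (Y * Z) * b * (Y * Z)⁻¹ := by group
    rw [this, ← hY.eq]; group
  rw [e1, e2]; group

lemma mem_normalizer_of {E : Type*} [Group E] (L : Subgroup E) (Z : E)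
    (h1 : ∀ k ∈ L, Z * k * Z⁻¹ ∈ L) (h2 : ∀ k ∈ L, Z⁻¹ * k * Z⁻¹⁻¹ ∈ L) :
    Z ∈ Subgroup.normalizer (L : Set E) := by
  rw [Subgroup.mem_normalizer_iff]
  intro k
  refine ⟨h1 k, fun h => ?_⟩
  have := h2 _ h
  simpa [mul_assoc] using this

lemma commutator_le_K {E : Type*} [Group E] (N : Subgroup E) [hN : N.Normal]
    (hc : ∀ x ∈ N, ∀ y ∈ N, x * y = y * x) (X Y : E) (hXY : Commute X Y)
    (hgen : Subgroup.closure ((N : Set E) ∪ {X, Y}) = ⊤) :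
    commutator E ≤ K N hc X Y := by
  have hn : (K N hc X Y).Normal := by
    rw [← Subgroup.normalizer_eq_top_iff, eq_top_iff, ← hgen, Subgroup.closure_le]
    have hNc : ∀ n ∈ N, ∀ k ∈ K N hc X Y, n * k * n⁻¹ ∈ K N hc X Y := by
      intro n hn k hk
      rw [hc n hn k (K_le N hc X Y hk)]
      simpa using hk
    rintro g (hg | rfl | hg)
    · exact mem_normalizer_of _ _ (hNc g hg) (hNc _ (N.inv_mem hg))
    · exact mem_normalizer_of _ _ (K_conj N hc _ _ _ (Commute.refl _) hXY)
        (K_conj N hc _ _ _ (Commute.refl _).inv_left hXY.inv_left)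
    · rw [Set.mem_singleton_iff] at hg
      subst hg
      exact mem_normalizer_of _ _ (K_conj N hc _ _ _ hXY.symm (Commute.refl _))
        (K_conj N hc _ _ _ hXY.symm.inv_left (Commute.refl _).inv_left)
  have hXN : ∀ n ∈ N, ⁅X, n⁆ ∈ K N hc X Y := fun n hn =>
    ⟨n, hn, 1, N.one_mem, by rw [commutatorElement_def]; group⟩
  have hYN : ∀ n ∈ N, ⁅Y, n⁆ ∈ K N hc X Y := fun n hn =>
    ⟨1, N.one_mem, n, hn, by rw [commutatorElement_def]; group⟩
  have comm_of : ∀ g h : E, ⁅g, h⁆ ∈ K N hc X Y →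
      Commute (QuotientGroup.mk' (K N hc X Y) g) (QuotientGroup.mk' (K N hc X Y) h) := by
    intro g h hgh
    rw [← commutatorElement_eq_one_iff_commute, ← map_commutatorElement]
    exact (QuotientGroup.eq_one_iff _).2 hgh
  have hgens : ∀ g ∈ ((N : Set E) ∪ {X, Y}), ∀ h ∈ ((N : Set E) ∪ {X, Y}),
      Commute (QuotientGroup.mk' (K N hc X Y) g) (QuotientGroup.mk' (K N hc X Y) h) := by
    rintro g (hg | rfl | hg) h (hh | rfl | hh)
    · exact Commute.map (hc g hg h hh) _
    · exact (comm_of _ _ (hXN g hg)).symm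
    · rw [Set.mem_singleton_iff] at hh; subst hh
      exact (comm_of _ _ (hYN g hg)).symm
    · exact comm_of _ _ (hXN h hh)
    · exact Commute.refl _
    · rw [Set.mem_singleton_iff] at hh; subst hh
      exact hXY.map _
    · rw [Set.mem_singleton_iff] at hg; subst hg
      exact comm_of _ _ (hYN h hh)
    · rw [Set.mem_singleton_iff] at hg; subst hg
      exact hXY.symm.map _
    · rw [Set.mem_singleton_iff] at hg hh; subst hg; subst hh
      exact Commute.refl _
  have hall : ∀ g h : E,
      Commute (QuotientGroup.mk' (K N hc X Y) g) (QuotientGroup.mk' (K N hc X Y) h) := by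
    intro g h
    have hg : g ∈ Subgroup.closure ((N : Set E) ∪ {X, Y}) := hgen ▸ Subgroup.mem_top g
    have hh : h ∈ Subgroup.closure ((N : Set E) ∪ {X, Y}) := hgen ▸ Subgroup.mem_top h
    induction hg, hh using Subgroup.closure_induction₂ with
    | mem x y hx hy => exact hgens x hx y hy
    | one_left x hx => rw [map_one]; exact Commute.one_left _
    | one_right x hx => rw [map_one]; exact Commute.one_right _
    | mul_left x y z _ _ _ h1 h2 => rw [map_mul]; exact h1.mul_left h2
    | mul_right x y z _ _ _ h1 h2 => rw [map_mul]; exact h1.mul_right h2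
    | inv_left x y _ _ h => rw [map_inv]; exact h.inv_left
    | inv_right x y _ _ h => rw [map_inv]; exact h.inv_right
  rw [commutator_def, Subgroup.commutator_le]
  intro g _ h _
  rw [← QuotientGroup.eq_one_iff]
  have := hall g h
  rw [← commutatorElement_eq_one_iff_commute, ← map_commutatorElement] at this
  exact this

/-- Finitely many: a commutative group generated by two elements is bicyclic. -/
lemma bicyclic_of_two_gen {H : Type*} [CommGroup H] (u v : H)
    (hgen : Subgroup.closure {u, v} = ⊤) : IsBicyclic H := by
  let φ : (Fin 2 → ℤ) →ₗ[ℤ] Additive H :=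
    Fintype.linearCombination ℤ ![Additive.ofMul u, Additive.ofMul v]
  have hφ : ∀ c : Fin 2 → ℤ, φ c = Additive.ofMul (u ^ c 0 * v ^ c 1) := by
    intro c
    simp [φ, Fintype.linearCombination_apply, Fin.sum_univ_two]
  have hsurj : ∀ h : H, ∃ c, φ c = Additive.ofMul h := by
    intro h
    have hh : h ∈ Subgroup.closure {u, v} := hgen ▸ Subgroup.mem_top h
    rw [Subgroup.mem_closure_pair] at hh
    obtain ⟨m, n, rfl⟩ := hh
    exact ⟨![m, n], by rw [hφ]; simp⟩
  obtain ⟨n, S⟩ := Submodule.smithNormalForm (Pi.basisFun ℤ (Fin 2)) (LinearMap.ker φ)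
  have hS : ∀ x ∈ LinearMap.ker φ, ∀ i, S.bM.repr x i • S.bM i ∈ LinearMap.ker φ := by
    intro x hx i
    by_cases hi : i ∈ Set.range S.f
    · obtain ⟨j, rfl⟩ := hi
      have h := S.repr_apply_embedding_eq_repr_smul (m := ⟨x, hx⟩) (i := j)
      have h2 := S.snf j
      simp only [] at h
      rw [h]
      rw [map_smul, Finsupp.smul_apply, smul_eq_mul, mul_comm, mul_smul, ← h2]
      exact Submodule.smul_mem _ _ (S.bN j).2
    · have h := S.repr_eq_zero_of_notMem_range ⟨x, hx⟩ hi
      simp only [] at h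
      rw [h, zero_smul]
      exact Submodule.zero_mem _
  let s : H := (φ (S.bM 0)).toMul
  let t : H := (φ (S.bM 1)).toMul
  have hst : ∀ m n : ℤ, φ (m • S.bM 0 + n • S.bM 1) = Additive.ofMul (s ^ m * t ^ n) := by
    intro m n
    rw [map_add, map_smul, map_smul]; rfl
  refine Or.inr ⟨Subgroup.zpowers s, Subgroup.zpowers t, inferInstance, inferInstance, ⟨?_⟩⟩
  let ψ : Subgroup.zpowers s × Subgroup.zpowers t →* H :=
    (Subgroup.zpowers s).subtype.coprod (Subgroup.zpowers t).subtype
  refine (MulEquiv.ofBijective ψ ⟨?_, ?_⟩).symm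
  · rw [injective_iff_map_eq_one]
    rintro ⟨⟨_, m, rfl⟩, ⟨_, n, rfl⟩⟩ h
    have h' : s ^ m * t ^ n = 1 := h
    have hker : m • S.bM 0 + n • S.bM 1 ∈ LinearMap.ker φ := by
      rw [LinearMap.mem_ker, hst, h']; rfl
    have h0 := hS _ hker 0
    have h1 := hS _ hker 1
    have r0 : S.bM.repr (m • S.bM 0 + n • S.bM 1) 0 = m := by
      simp only [map_add, map_smul, Module.Basis.repr_self, Finsupp.add_apply,
        Finsupp.smul_apply, Finsupp.single_apply]
      simp
    have r1 : S.bM.repr (m • S.bM 0 + n • S.bM 1) 1 = n := by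
      simp only [map_add, map_smul, Module.Basis.repr_self, Finsupp.add_apply,
        Finsupp.smul_apply, Finsupp.single_apply]
      simp
    rw [r0, LinearMap.mem_ker, map_smul] at h0
    rw [r1, LinearMap.mem_ker, map_smul] at h1
    have h0' : s ^ m = 1 := h0
    have h1' : t ^ n = 1 := h1
    ext
    · exact h0'
    · exact h1'
  · intro h
    obtain ⟨c, hc⟩ := hsurj h
    refine ⟨(⟨s ^ (S.bM.repr c 0), _, rfl⟩, ⟨t ^ (S.bM.repr c 1), _, rfl⟩), ?_⟩
    have e := S.bM.sum_repr c
    rw [Fin.sum_univ_two] at e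
    have := hst (S.bM.repr c 0) (S.bM.repr c 1)
    rw [e, hc] at this
    exact (Additive.ofMul.injective this).symm

lemma exists_gen_of_bicyclic {H : Type*} [Group H] (h : IsBicyclic H) :
    ∃ x y : H, Commute x y ∧ Subgroup.closure {x, y} = ⊤ := by
  rcases h with h | ⟨B, C, hB, hC, ⟨e⟩⟩
  · obtain ⟨x, hx⟩ := h.exists_generator
    refine ⟨x, 1, Commute.one_right _, ?_⟩
    rw [eq_top_iff]
    intro g _
    have : Subgroup.zpowers x ≤ Subgroup.closure {x, 1} := by
      rw [Subgroup.zpowers_le]; exact Subgroup.subset_closure (by simp)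
    exact this (hx g)
  · obtain ⟨b, hb⟩ := hB.exists_generator
    obtain ⟨c, hc⟩ := hC.exists_generator
    refine ⟨e.symm (b, 1), e.symm (1, c), ?_, ?_⟩
    · have : Commute ((b, 1) : B × C) (1, c) := by
        ext <;> simp
      exact this.map e.symm
    · rw [eq_top_iff]
      intro g _
      obtain ⟨m, hm⟩ := hb (e g).1
      obtain ⟨n, hn⟩ := hc (e g).2
      have : g = e.symm (b, 1) ^ m * e.symm (1, c) ^ n := by
        rw [← map_zpow, ← map_zpow, ← map_mul, MulEquiv.eq_symm_apply]
        ext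
        · simp [← hm]
        · simp [← hn]
      rw [this]
      exact Subgroup.mul_mem _
        (Subgroup.zpow_mem _ (Subgroup.subset_closure (by simp)) _)
        (Subgroup.zpow_mem _ (Subgroup.subset_closure (by simp)) _)

lemma symm_of_restricts {G : Type*} [Group G] (f : G → G → QZ)
    (hf : RestrictsToCoboundaries f) (u v : G) (huv : u * v = v * u) : f u v = f v u := by
  have hcomm : ∀ x ∈ ({u, v} : Set G), ∀ y ∈ ({u, v} : Set G), x * y = y * x := by
    rintro x (rfl | rfl) y (rfl | rfl) <;> first | rfl | exact huv | exact huv.symm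
  have hu : u ∈ Subgroup.closure {u, v} := Subgroup.subset_closure (by simp)
  have hv : v ∈ Subgroup.closure {u, v} := Subgroup.subset_closure (by simp)
  have hbi : IsBicyclic (Subgroup.closure {u, v}) := by
    letI := Subgroup.closureCommGroupOfComm hcomm
    refine bicyclic_of_two_gen (⟨u, hu⟩ : Subgroup.closure {u, v}) ⟨v, hv⟩ ?_
    have := Subgroup.closure_closure_coe_preimage (k := ({u, v} : Set G))
    rw [← this]
    congr 1
    ext g
    simp [Subtype.ext_iff]
  obtain ⟨c, hc⟩ := hf _ hbi
  have h1 := hc ⟨u, hu⟩ ⟨v, hv⟩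
  have h2 := hc ⟨v, hv⟩ ⟨u, hu⟩
  have e : (⟨u, hu⟩ * ⟨v, hv⟩ : Subgroup.closure {u, v}) = ⟨v, hv⟩ * ⟨u, hu⟩ :=
    Subtype.ext huv
  simp only [] at h1 h2
  rw [h1, h2, e]
  abel

/-- The central extension attached to a cocycle. -/
@[ext] structure Ext {G : Type*} [Group G] (f : cocycles2 G) where
  /-- the image in the group -/
  fst : G
  /-- the coefficient -/
  snd : QZ

section
variable {G : Type*} [Group G] (f : cocycles2 G)

lemma coc (g h k : G) : f.1 g h + f.1 (g * h) k = f.1 h k + f.1 g (h * k) := f.2 g h k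

lemma coc_one_left (k : G) : f.1 1 k = f.1 1 1 := by
  have := coc f 1 1 k
  simp only [one_mul] at this
  exact (add_right_cancel this).symm

instance : Mul (Ext f) := ⟨fun a b => ⟨a.fst * b.fst, a.snd + b.snd + f.1 a.fst b.fst⟩⟩
instance : One (Ext f) := ⟨⟨1, - f.1 1 1⟩⟩
instance : Inv (Ext f) := ⟨fun a => ⟨a.fst⁻¹, - a.snd - f.1 a.fst⁻¹ a.fst - f.1 1 1⟩⟩

@[simp] lemma mul_fst (a b : Ext f) : (a * b).fst = a.fst * b.fst := rfl
@[simp] lemma mul_snd (a b : Ext f) : (a * b).snd = a.snd + b.snd + f.1 a.fst b.fst := rfl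
@[simp] lemma one_fst : (1 : Ext f).fst = 1 := rfl
@[simp] lemma one_snd : (1 : Ext f).snd = - f.1 1 1 := rfl
@[simp] lemma inv_fst (a : Ext f) : (a⁻¹).fst = a.fst⁻¹ := rfl
@[simp] lemma inv_snd (a : Ext f) :
    (a⁻¹).snd = - a.snd - f.1 a.fst⁻¹ a.fst - f.1 1 1 := rfl

instance : Group (Ext f) := Group.ofLeftAxioms
  (by
    intro a b c
    ext
    · simp [mul_assoc]
    · have := coc f a.fst b.fst c.fst
      simp only [mul_snd, mul_fst]
      calc _ = a.snd + b.snd + c.snd + (f.1 a.fst b.fst + f.1 (a.fst * b.fst) c.fst) := by abel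
        _ = _ := by rw [this]; abel)
  (by
    intro a
    ext
    · simp
    · simp only [mul_snd, one_fst, one_snd]
      rw [coc_one_left f a.fst]; abel)
  (by
    intro a
    ext
    · simp
    · simp only [mul_snd, inv_fst, inv_snd, one_snd]
      abel)

/-- projection -/
def proj : Ext f →* G where
  toFun := Ext.fst
  map_one' := rfl
  map_mul' _ _ := rfl

/-- inclusion -/
def incl : QZ →+ Additive (Ext f) where
  toFun z := Additive.ofMul ⟨1, z - f.1 1 1⟩
  map_zero' := by
    apply Additive.toMul.injective
    ext
    · rfl
    · simp
  map_add' z w := by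
    apply Additive.toMul.injective
    ext
    · simp
    · simp; abel

lemma ext_commute (hf : RestrictsToCoboundaries f.1) (U V : Ext f)
    (h : proj f U * proj f V = proj f V * proj f U) : U * V = V * U := by
  have h' : U.fst * V.fst = V.fst * U.fst := h
  ext
  · exact h'
  · simp only [mul_snd]
    rw [symm_of_restricts f.1 hf _ _ h', add_comm U.snd]

end

lemma main {G : Type} [Group G] (A G₀ : Subgroup G)
    (hA : A.Normal) (hAab : ∀ x ∈ A, ∀ y ∈ A, x * y = y * x)
    (hG₀ : IsBicyclic ↥G₀)
    (hprod : ∀ g : G, ∃ a ∈ A, ∃ b ∈ G₀, g = a * b) (f : cocycles2 G)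
    (hf : RestrictsToCoboundaries f.1) : IsGrpCoboundary f.1 := by
  obtain ⟨x, y, hxy, hgen⟩ := exists_gen_of_bicyclic hG₀
  let X : Ext f := ⟨x, 0⟩
  let Y : Ext f := ⟨y, 0⟩
  have hxy' : (x : G) * y = y * x := congrArg Subtype.val hxy.eq
  have hXY : X * Y = Y * X := ext_commute f hf _ _ hxy'
  let N : Subgroup (Ext f) := A.comap (proj f)
  haveI : N.Normal := hA.comap _
  have hNc : ∀ x ∈ N, ∀ y ∈ N, x * y = y * x := fun a ha b hb =>
    ext_commute f hf _ _ (hAab _ ha _ hb)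
  have hgenE : Subgroup.closure ((N : Set (Ext f)) ∪ {X, Y}) = ⊤ := by
    set W := Subgroup.closure ((N : Set (Ext f)) ∪ {X, Y}) with hW
    have hN : N ≤ W := fun n hn => Subgroup.subset_closure (Or.inl hn)
    have hXW : X ∈ W := Subgroup.subset_closure (Or.inr (by simp))
    have hYW : Y ∈ W := Subgroup.subset_closure (Or.inr (by simp))
    have h0 : G₀ ≤ W.map (proj f) := by
      have : (⊤ : Subgroup G₀) ≤ (W.map (proj f)).comap G₀.subtype := by
        rw [← hgen, Subgroup.closure_le]
        rintro _ (rfl | rfl)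
        · exact ⟨X, hXW, rfl⟩
        · exact ⟨Y, hYW, rfl⟩
      exact fun g hg => this (Subgroup.mem_top (⟨g, hg⟩ : G₀))
    rw [eq_top_iff]
    intro e _
    obtain ⟨a, ha, b, hb, hab⟩ := hprod (proj f e)
    obtain ⟨w, hw, hwb⟩ := h0 hb
    have : e * w⁻¹ ∈ N := by
      change proj f (e * w⁻¹) ∈ A
      rw [map_mul, map_inv, hab, hwb]
      simpa using ha
    have h := W.mul_mem (hN this) hw
    simpa using h
  have hK := commutator_le_K N hNc X Y hXY hgenE
  have htriv : ∀ k ∈ commutator (Ext f), proj f k = 1 → k = 1 := by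
    intro k hk h1
    obtain ⟨a, ha, b, hb, rfl⟩ := hK hk
    rw [← commute_iff N hNc hXY ha hb]
    apply ext_commute f hf
    simp only [map_mul, map_inv] at h1 ⊢
    exact (commute_iff A hAab hxy' ha hb).2 h1
  let j : QZ →+ Additive (Abelianization (Ext f)) :=
    (MonoidHom.toAdditive (Abelianization.of (G := Ext f))).comp (incl f)
  have hj : Function.Injective j := by
    rw [injective_iff_map_eq_zero]
    intro z hz
    have hz' : Abelianization.of (Additive.toMul (incl f z)) = 1 := hz
    have hmem : Additive.toMul (incl f z) ∈ commutator (Ext f) := by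
      rw [← Abelianization.ker_of]; exact hz'
    have := htriv _ hmem rfl
    have h2 := congrArg Ext.snd this
    have h3 : z - f.1 1 1 = - f.1 1 1 := h2
    simpa [sub_eq_neg_self] using h3
  obtain ⟨r, hr⟩ := CharacterModule.dual_surjective_of_injective (R := ℤ) j.toIntLinearMap hj
    (AddMonoidHom.id QZ : CharacterModule QZ)
  have hr' : ∀ z : QZ, r (j z) = z := fun z => DFunLike.congr_fun hr z
  let ρ : Ext f → QZ := fun e => r (Additive.ofMul (Abelianization.of e))
  have hρ : ∀ a b, ρ (a * b) = ρ a + ρ b := by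
    intro a b
    change r (Additive.ofMul (Abelianization.of (a * b))) = _
    rw [map_mul, ofMul_mul, map_add]
  refine ⟨fun g => ρ ⟨g, 0⟩, fun g h => ?_⟩
  have e : (⟨g, 0⟩ * ⟨h, 0⟩ : Ext f) = Additive.toMul (incl f (f.1 g h)) * ⟨g * h, 0⟩ := by
    ext
    · simp [incl]
    · simp only [mul_snd, incl]
      simp [coc_one_left f (g * h)]
  have e2 := congrArg ρ e
  rw [hρ, hρ] at e2
  have e3 : ρ (Additive.toMul (incl f (f.1 g h))) = f.1 g h := hr' _
  rw [e3] at e2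
  exact eq_sub_of_add_eq e2.symm

end BogAux

/-- Let `G` be a finite group which is the internal semidirect product of an abelian normal
subgroup `A` by a bicyclic subgroup `G₀`. Then `B₀(G) = 0`. -/
theorem B0_eq_bot_of_semidirect (G : Type) [Group G] [Finite G] (A G₀ : Subgroup G)
    (hA : A.Normal) (hAab : ∀ x ∈ A, ∀ y ∈ A, x * y = y * x)
    (hG₀ : IsBicyclic ↥G₀)
    (hint : A ⊓ G₀ = ⊥)
    (hprod : ∀ g : G, ∃ a ∈ A, ∃ b ∈ G₀, g = a * b) :
    B0 G = ⊥ := by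
  rw [eq_bot_iff]
  rintro _ ⟨f, rfl, hf⟩
  rw [AddSubgroup.mem_bot, QuotientAddGroup.eq_zero_iff]
  exact BogAux.main A G₀ hA hAab hG₀ hprod f hf
end

section
/- Let p ≥ 5 be a prime number and let ν be an integer which is a quadratic non-residue modulo p. Let G be a group of order p^5 generated by f0, f1, f2, f3, f4 with Z(G) = ⟨f3⟩ and relations [f1,f0] = f2, [f2,f0] = [f1,f4] = f3, [f4,f0] = [f2,f1] = [f4,f2] = 1, together with one of the following sets of extra relations: (1) f0^p = f3 and f1^p = f2^p = f3^p = f4^p = 1; (2) f1^p = f3 and f0^p = f2^p = f3^p = f4^p = 1; (3) f1^p = f3^ν and f0^p = f2^p = f3^p = f4^p = 1; (4) f4^p = f3 and f0^p = f1^p = f2^p = f3^p = 1; (5) f_i^p = 1 for all 0 ≤ i ≤ 4. Then B_0(G) = 0. -/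
/-- The commutator `[g,h] = g⁻¹h⁻¹gh`. -/
def cmt {G : Type*} [Group G] (g h : G) : G := g⁻¹ * h⁻¹ * g * h

/-- A commutative `p`-group generated by two elements is bicyclic (ordered version). -/
theorem bicyclic_aux {A : Type*} [CommGroup A] (p : ℕ) (hp : p.Prime) (x y : A) (m n : ℕ)
    (hx : orderOf x = p ^ m) (hy : orderOf y = p ^ n) (hnm : n ≤ m)
    (hcl : Subgroup.closure {x, y} = ⊤) : IsBicyclic A := by
  have hdvd : orderOf (QuotientGroup.mk y : A ⧸ Subgroup.zpowers x) ∣ p ^ n := by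
    apply orderOf_dvd_of_pow_eq_one
    rw [← QuotientGroup.mk_pow, ← hy, pow_orderOf_eq_one, QuotientGroup.mk_one]
  obtain ⟨k, hkn, hk⟩ := (Nat.dvd_prime_pow hp).1 hdvd
  have hmem : y ^ (p ^ k) ∈ Subgroup.zpowers x := by
    rw [← QuotientGroup.eq_one_iff, QuotientGroup.mk_pow, ← hk, pow_orderOf_eq_one]
  obtain ⟨j, hj⟩ := Subgroup.mem_zpowers_iff.1 hmem
  have h1 : x ^ (j * (p ^ (n - k) : ℕ)) = 1 := by
    rw [zpow_mul, hj, zpow_natCast, ← pow_mul, ← pow_add, Nat.add_sub_cancel' hkn, ← hy,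
      pow_orderOf_eq_one]
  have h2 : ((p ^ m : ℕ) : ℤ) ∣ j * (p ^ (n - k) : ℕ) := by
    rw [← hx]; exact orderOf_dvd_iff_zpow_eq_one.2 h1
  have h3 : ((p ^ k : ℕ) : ℤ) ∣ j := by
    have h4 : ((p ^ k : ℕ) : ℤ) * (p ^ (n - k) : ℕ) ∣ j * (p ^ (n - k) : ℕ) := by
      refine dvd_trans ?_ h2
      rw [← Nat.cast_mul, ← pow_add, Nat.add_sub_cancel' hkn]
      exact Int.natCast_dvd_natCast.2 (pow_dvd_pow p hnm)
    refine (mul_dvd_mul_iff_right ?_).1 h4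
    exact_mod_cast (pow_pos hp.pos _).ne'
  obtain ⟨l, hl⟩ := h3
  set w : A := y * x ^ (-l) with hw
  have hwp : w ^ (p ^ k) = 1 := by
    rw [hw, mul_pow, ← hj, ← zpow_natCast, ← zpow_mul, ← zpow_add, hl]
    have : ((p ^ k : ℕ) : ℤ) * l + -l * (p ^ k : ℕ) = 0 := by ring
    rw [this, zpow_zero]
  have hdisj : ∀ g, g ∈ Subgroup.zpowers x → g ∈ Subgroup.zpowers w → g = 1 := by
    intro g hgx hgw
    obtain ⟨i, rfl⟩ := Subgroup.mem_zpowers_iff.1 hgw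
    have hyi : y ^ i ∈ Subgroup.zpowers x := by
      have : y ^ i = w ^ i * x ^ (l * i) := by
        rw [hw, mul_zpow, mul_assoc, ← zpow_mul, ← zpow_add]
        simp
      rw [this]
      exact mul_mem hgx (Subgroup.zpow_mem_zpowers x _)
    have hdi : ((p ^ k : ℕ) : ℤ) ∣ i := by
      rw [← hk]
      apply orderOf_dvd_iff_zpow_eq_one.2
      rw [← QuotientGroup.mk_zpow]
      exact (QuotientGroup.eq_one_iff _).2 hyi
    obtain ⟨t, rfl⟩ := hdi
    rw [zpow_mul, zpow_natCast, hwp, one_zpow]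
  right
  refine ⟨Subgroup.zpowers x, Subgroup.zpowers w, inferInstance, inferInstance, ⟨MulEquiv.symm ?_⟩⟩
  refine MulEquiv.ofBijective
    (MonoidHom.coprod (Subgroup.zpowers x).subtype (Subgroup.zpowers w).subtype) ⟨?_, ?_⟩
  · rw [injective_iff_map_eq_one]
    rintro ⟨⟨a, ha⟩, ⟨b, hb⟩⟩ hab
    simp only [MonoidHom.coprod_apply, Subgroup.subtype_apply] at hab
    have hb1 : b = 1 := by
      apply hdisj b _ hb
      rw [eq_inv_of_mul_eq_one_right hab]
      exact inv_mem ha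
    subst hb1
    rw [mul_one] at hab
    subst hab
    rfl
  · rw [← MonoidHom.range_eq_top, eq_top_iff, ← hcl, Subgroup.closure_le]
    rintro g (rfl | rfl)
    · exact ⟨(⟨g, Subgroup.mem_zpowers g⟩, 1), by simp⟩
    · refine ⟨(⟨x ^ l, Subgroup.zpow_mem_zpowers x l⟩, ⟨w, Subgroup.mem_zpowers w⟩), ?_⟩
      simp only [MonoidHom.coprod_apply, Subgroup.subtype_apply, hw]
      rw [mul_comm, mul_assoc, ← zpow_add]
      simp

/-- A commutative `p`-group generated by two elements is bicyclic. -/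
theorem bicyclic_of_two_gen {A : Type*} [CommGroup A] (p : ℕ) (hp : p.Prime) (hA : IsPGroup p A)
    (x y : A) (hcl : Subgroup.closure {x, y} = ⊤) : IsBicyclic A := by
  haveI := Fact.mk hp
  obtain ⟨m, hm⟩ := IsPGroup.iff_orderOf.1 hA x
  obtain ⟨n, hn⟩ := IsPGroup.iff_orderOf.1 hA y
  rcases le_total n m with h | h
  · exact bicyclic_aux p hp x y m n hm hn h hcl
  · exact bicyclic_aux p hp y x n m hn hm h (by rw [Set.pair_comm]; exact hcl)

/-- Cocycles vanishing on bicyclic subgroups are symmetric on commuting pairs. -/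
theorem symm_of_restricts {G : Type*} [Group G] (p : ℕ) (hp : p.Prime) (hG : IsPGroup p G)
    (f : G → G → QZ) (hf : RestrictsToCoboundaries f) (x y : G) (hxy : x * y = y * x) :
    f x y = f y x := by
  have hcomm : ∀ a ∈ ({x, y} : Set G), ∀ b ∈ ({x, y} : Set G), a * b = b * a := by
    rintro a (rfl | rfl) b (rfl | rfl) <;> first | rfl | exact hxy | exact hxy.symm
  letI : CommGroup (Subgroup.closure ({x, y} : Set G)) :=
    { (inferInstance : Group (Subgroup.closure ({x, y} : Set G))) with
      mul_comm := (Subgroup.closureCommGroupOfComm hcomm).mul_comm }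
  have hx : x ∈ Subgroup.closure ({x, y} : Set G) := Subgroup.subset_closure (by simp)
  have hy : y ∈ Subgroup.closure ({x, y} : Set G) := Subgroup.subset_closure (by simp)
  have hb : IsBicyclic (Subgroup.closure ({x, y} : Set G)) := by
    refine bicyclic_of_two_gen p hp (hG.to_subgroup _) ⟨x, hx⟩ ⟨y, hy⟩ ?_
    rw [← Subgroup.closure_closure_coe_preimage (k := ({x, y} : Set G))]
    congr 1
    ext ⟨a, ha⟩
    simp [Subtype.ext_iff]
  obtain ⟨c, hc⟩ := hf _ hb
  have h1 := hc ⟨x, hx⟩ ⟨y, hy⟩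
  have h2 := hc ⟨y, hy⟩ ⟨x, hx⟩
  have h3 : (⟨x, hx⟩ * ⟨y, hy⟩ : Subgroup.closure ({x, y} : Set G)) = ⟨y, hy⟩ * ⟨x, hx⟩ :=
    Subtype.ext hxy
  simp only at h1 h2
  rw [h1, h2, h3, add_comm (c _) (c _)]

/-- The central extension of `G` by `ℚ/ℤ` attached to a 2-cocycle. -/
@[ext] structure CExt {G : Type*} [Group G] (f : cocycles2 G) where
  fst : QZ
  snd : G

theorem cocycle_one_left {G : Type*} [Group G] (f : cocycles2 G) (h : G) :
    f.1 1 h = f.1 1 1 := by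
  have := f.2 1 1 h
  simp only [one_mul] at this
  exact (add_right_cancel (this.trans (add_comm _ _))).symm

instance instMulCExt {G : Type*} [Group G] (f : cocycles2 G) : Mul (CExt f) :=
  ⟨fun a b => ⟨a.fst + b.fst + f.1 a.snd b.snd, a.snd * b.snd⟩⟩

instance instOneCExt {G : Type*} [Group G] (f : cocycles2 G) : One (CExt f) :=
  ⟨⟨-f.1 1 1, 1⟩⟩

instance instInvCExt {G : Type*} [Group G] (f : cocycles2 G) : Inv (CExt f) :=
  ⟨fun a => ⟨-a.fst - f.1 a.snd⁻¹ a.snd - f.1 1 1, a.snd⁻¹⟩⟩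

theorem cext_mul {G : Type*} [Group G] (f : cocycles2 G) (a b : CExt f) :
    a * b = ⟨a.fst + b.fst + f.1 a.snd b.snd, a.snd * b.snd⟩ := rfl

theorem cext_one {G : Type*} [Group G] (f : cocycles2 G) :
    (1 : CExt f) = ⟨-f.1 1 1, 1⟩ := rfl

theorem cext_inv {G : Type*} [Group G] (f : cocycles2 G) (a : CExt f) :
    a⁻¹ = ⟨-a.fst - f.1 a.snd⁻¹ a.snd - f.1 1 1, a.snd⁻¹⟩ := rfl

instance instGroupCExt {G : Type*} [Group G] (f : cocycles2 G) : Group (CExt f) :=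
  Group.ofLeftAxioms
    (by
      intro a b c
      simp only [cext_mul, CExt.mk.injEq, mul_assoc, and_true]
      have h := f.2 a.snd b.snd c.snd
      calc a.fst + b.fst + f.1 a.snd b.snd + c.fst + f.1 (a.snd * b.snd) c.snd
          = a.fst + b.fst + c.fst + (f.1 a.snd b.snd + f.1 (a.snd * b.snd) c.snd) := by abel
        _ = a.fst + b.fst + c.fst + (f.1 b.snd c.snd + f.1 a.snd (b.snd * c.snd)) := by rw [h]
        _ = _ := by abel)
    (by
      intro a
      ext
      · simp only [cext_mul, cext_one, cocycle_one_left f a.snd]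
        abel
      · simp [cext_mul, cext_one])
    (by
      intro a
      ext
      · simp only [cext_mul, cext_one, cext_inv]
        abel
      · simp [cext_mul, cext_one, cext_inv])

/-- The projection of the central extension. -/
def cextProj {G : Type*} [Group G] (f : cocycles2 G) : CExt f →* G where
  toFun := CExt.snd
  map_one' := rfl
  map_mul' _ _ := rfl

/-- The inclusion of `ℚ/ℤ` followed by abelianization. -/
def cextIncl {G : Type*} [Group G] (f : cocycles2 G) :
    QZ →+ Additive (Abelianization (CExt f)) where
  toFun a := Additive.ofMul (Abelianization.of (⟨a - f.1 1 1, 1⟩ : CExt f))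
  map_zero' := by
    rw [zero_sub, ← cext_one, map_one]; rfl
  map_add' a b := by
    rw [← ofMul_mul, ← map_mul, cext_mul]
    congr 3
    · simp only
      abel
    · simp

/-- If `ℚ/ℤ` meets the derived subgroup trivially then the cocycle is a coboundary. -/
theorem coboundary_of_inter {G : Type*} [Group G] (f : cocycles2 G)
    (h : ∀ x ∈ commutator (CExt f), cextProj f x = 1 → x = 1) : f ∈ coboundaries2 G := by
  have hinj : Function.Injective (cextIncl f) := by
    rw [injective_iff_map_eq_zero]
    intro a ha
    have h1 : (⟨a - f.1 1 1, 1⟩ : CExt f) ∈ commutator (CExt f) := by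
      rw [← Abelianization.ker_of]
      exact ha
    have h2 := congrArg CExt.fst (h _ h1 rfl)
    simpa [cext_one, sub_eq_add_neg] using h2
  haveI : DivisibleBy QZ ℤ := inferInstanceAs (DivisibleBy (AddCircle (1 : ℚ)) ℤ)
  obtain ⟨r, hr⟩ := (Module.Baer.of_divisible QZ).extension_property_addMonoidHom
    (cextIncl f) hinj (AddMonoidHom.id QZ)
  refine ⟨fun g => r (Additive.ofMul (Abelianization.of (⟨0, g⟩ : CExt f))), fun g k => ?_⟩
  have e : (⟨0, g⟩ * ⟨0, k⟩ : CExt f) = ⟨f.1 g k - f.1 1 1, 1⟩ * ⟨0, g * k⟩ := by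
    rw [cext_mul, cext_mul]
    ext
    · simp only [cocycle_one_left f (g * k)]
      abel
    · simp
  have e2 := congrArg (fun t => r (Additive.ofMul (Abelianization.of t))) e
  simp only [map_mul, ofMul_mul, map_add] at e2
  have e3 : r (Additive.ofMul (Abelianization.of (⟨f.1 g k - f.1 1 1, 1⟩ : CExt f))) = f.1 g k :=
    DFunLike.congr_fun hr (f.1 g k)
  rw [e3] at e2
  simp only
  rw [e2]
  abel

/-- The group theoretic heart of the proof. -/
theorem inter_trivial {E G : Type*} [Group E] [Group G] (π : E →* G)
    (hsurj : Function.Surjective π)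
    (hlift : ∀ x y : E, π x * π y = π y * π x → x * y = y * x)
    (p : ℕ) (hp : p.Prime) (hp5 : 5 ≤ p) (f0 f1 f2 f3 f4 : G)
    (hgen : Subgroup.closure {f0, f1, f2, f3, f4} = ⊤)
    (h3c : ∀ g : G, f3 * g = g * f3)
    (r1 : cmt f1 f0 = f2) (r2 : cmt f2 f0 = f3) (r3 : cmt f1 f4 = f3)
    (r4 : cmt f4 f0 = 1) (r5 : cmt f2 f1 = 1) (r6 : cmt f4 f2 = 1)
    (h0 : ∀ g : G, f0 ^ p * g = g * f0 ^ p) (h4 : ∀ g : G, f4 ^ p * g = g * f4 ^ p)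
    (h2p : f2 ^ p = 1) (h3p : f3 ^ p = 1) (h3 : f3 ≠ 1) :
    ∀ x ∈ commutator E, π x = 1 → x = 1 := by
  have hcm : ∀ {H : Type _} [Group H] (a b : H), a * b = b * a * cmt a b := by
    intro H _ a b; simp only [cmt]; group
  have hcm' : ∀ {H : Type _} [Group H] (a b : H), a * b = b * a * cmt a b := by
    intro H _ a b; simp only [cmt]; group
  obtain ⟨e0, rfl⟩ := hsurj f0
  obtain ⟨e1, rfl⟩ := hsurj f1
  obtain ⟨e4, rfl⟩ := hsurj f4
  have hπ : ∀ a b : E, π (cmt a b) = cmt (π a) (π b) := by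
    intro a b; simp [cmt]
  obtain ⟨e2, he2⟩ : ∃ e2, e2 = cmt e1 e0 := ⟨_, rfl⟩
  obtain ⟨e3, he3⟩ : ∃ e3, e3 = cmt e2 e0 := ⟨_, rfl⟩
  obtain ⟨w, hw⟩ : ∃ w, w = cmt e1 e4 := ⟨_, rfl⟩
  have p2 : f2 = π e2 := by rw [he2, hπ, r1]
  subst p2
  have p3 : f3 = π e3 := by rw [he3, hπ, r2]
  subst p3
  have pw : π w = π e3 := by rw [hw, hπ, r3]
  have g10 : e1 * e0 = e0 * e1 * e2 := by rw [he2]; exact hcm _ _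
  have g20 : e2 * e0 = e0 * e2 * e3 := by rw [he3]; exact hcm _ _
  have g14 : e1 * e4 = e4 * e1 * w := by rw [hw]; exact hcm _ _
  have c3 : ∀ x, e3 * x = x * e3 := fun x => hlift _ _ (h3c _)
  have cw : ∀ x, w * x = x * w := fun x => hlift _ _ (by rw [pw]; exact h3c _)
  have c40 : e4 * e0 = e0 * e4 := hlift _ _ (by rw [hcm' (π e4), r4, mul_one])
  have c21 : e2 * e1 = e1 * e2 := hlift _ _ (by rw [hcm' (π e2), r5, mul_one])
  have c42 : e4 * e2 = e2 * e4 := hlift _ _ (by rw [hcm' (π e4), r6, mul_one])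
  have key : (e0 * e1) * (e4 * e2) * e3 = (e4 * e2) * (e0 * e1) * w := by
    calc (e0 * e1) * (e4 * e2) * e3 = e0 * (e1 * e4) * e2 * e3 := by group
      _ = (e0 * e4) * e1 * (w * e2) * e3 := by rw [g14]; group
      _ = e4 * e0 * (e1 * e2) * (w * e3) := by rw [cw e2, ← c40]; group
      _ = e4 * (e0 * e2) * (e1 * e3) * w := by rw [← c21, cw e3]; group
      _ = e4 * (e0 * e2 * e3) * e1 * w := by rw [← c3 e1]; group
      _ = (e4 * e2) * (e0 * e1) * w := by rw [← g20]; group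
  have hcomm : (e0 * e1) * (e4 * e2) = (e4 * e2) * (e0 * e1) := by
    apply hlift
    have := congrArg π key
    rw [map_mul, map_mul _ _ w, pw] at this
    simpa only [map_mul] using mul_right_cancel this
  have hwe : w = e3 := by
    rw [hcomm] at key
    exact (mul_left_cancel key).symm
  rw [hwe] at g14
  have cen4 : ∀ x, e4 ^ p * x = x * e4 ^ p := fun x => hlift _ _ (by rw [map_pow]; exact h4 _)
  have cen0 : ∀ x, e0 ^ p * x = x * e0 ^ p := fun x => hlift _ _ (by rw [map_pow]; exact h0 _)
  have c3n : ∀ (n : ℕ) x, e3 ^ n * x = x * e3 ^ n := fun n x =>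
    ((show Commute e3 x from c3 x).pow_left n).eq
  have q14 : ∀ n : ℕ, e1 * e4 ^ n = e4 ^ n * e1 * e3 ^ n := by
    intro n
    induction n with
    | zero => simp
    | succ n ih =>
      calc e1 * e4 ^ (n + 1) = e1 * e4 ^ n * e4 := by rw [pow_succ, mul_assoc]
        _ = e4 ^ n * e1 * (e3 ^ n * e4) := by rw [ih]; group
        _ = e4 ^ n * (e1 * e4) * e3 ^ n := by rw [c3n]; group
        _ = e4 ^ n * e4 * e1 * (e3 * e3 ^ n) := by rw [g14]; group
        _ = _ := by rw [← pow_succ, ← pow_succ']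
  have e3p : e3 ^ p = 1 := by
    have := q14 p
    rw [← cen4 e1] at this
    exact (mul_eq_left.1 this.symm)
  have q20 : ∀ n : ℕ, e2 ^ n * e0 = e0 * e2 ^ n * e3 ^ n := by
    intro n
    induction n with
    | zero => simp
    | succ n ih =>
      calc e2 ^ (n + 1) * e0 = e2 ^ n * (e2 * e0) := by rw [pow_succ, mul_assoc]
        _ = (e2 ^ n * e0) * e2 * e3 := by rw [g20]; group
        _ = e0 * e2 ^ n * (e3 ^ n * e2) * e3 := by rw [ih]; group
        _ = e0 * (e2 ^ n * e2) * (e3 ^ n * e3) := by rw [c3n]; group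
        _ = _ := by rw [← pow_succ, ← pow_succ]
  have q10 : ∀ n : ℕ, e1 * e0 ^ n = e0 ^ n * e1 * e2 ^ n * e3 ^ (n.choose 2) := by
    intro n
    induction n with
    | zero => simp
    | succ n ih =>
      calc e1 * e0 ^ (n + 1) = e1 * e0 ^ n * e0 := by rw [pow_succ, mul_assoc]
        _ = e0 ^ n * e1 * e2 ^ n * (e3 ^ (n.choose 2) * e0) := by rw [ih]; group
        _ = e0 ^ n * e1 * (e2 ^ n * e0) * e3 ^ (n.choose 2) := by rw [c3n]; group
        _ = e0 ^ n * (e1 * e0) * e2 ^ n * (e3 ^ n * e3 ^ (n.choose 2)) := by rw [q20]; group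
        _ = e0 ^ n * e0 * e1 * (e2 * e2 ^ n) * (e3 ^ n * e3 ^ (n.choose 2)) := by rw [g10]; group
        _ = _ := by
          rw [← pow_succ, ← pow_succ', ← pow_add, Nat.choose_succ_succ' n 1, Nat.choose_one_right]
  have e2p : e2 ^ p = 1 := by
    have := q10 p
    have hd : e3 ^ (p.choose 2) = 1 := by
      obtain ⟨t, ht⟩ := hp.dvd_choose_self (k := 2) (by norm_num) (by omega)
      rw [ht, pow_mul, e3p, one_pow]
    rw [hd, mul_one, ← cen0 e1] at this
    exact (mul_eq_left.1 this.symm)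
  -- generation principle
  have gen : ∀ H : Subgroup E, e0 ∈ H → e1 ∈ H → e4 ∈ H →
      (∀ z, (∀ x, z * x = x * z) → z ∈ H) → ∀ x, x ∈ H := by
    intro H i0 i1 i4 iz x
    have i2 : e2 ∈ H := by
      rw [he2]; exact mul_mem (mul_mem (mul_mem (inv_mem i1) (inv_mem i0)) i1) i0
    have i3 : e3 ∈ H := iz _ c3
    have hm : H.map π = ⊤ := by
      rw [eq_top_iff, ← hgen, Subgroup.closure_le]
      rintro g (rfl | rfl | rfl | rfl | rfl)
      · exact ⟨_, i0, rfl⟩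
      · exact ⟨_, i1, rfl⟩
      · exact ⟨_, i2, rfl⟩
      · exact ⟨_, i3, rfl⟩
      · exact ⟨_, i4, rfl⟩
    obtain ⟨s, hs, hsx⟩ : π x ∈ H.map π := by rw [hm]; trivial
    have hk : s⁻¹ * x ∈ H := by
      apply iz
      intro y
      apply hlift
      simp [hsx]
    simpa using mul_mem hs hk
  let N : Subgroup E := Subgroup.closure {e2, e3}
  have n2 : e2 ∈ N := Subgroup.subset_closure (by simp)
  have n3 : e3 ∈ N := Subgroup.subset_closure (by simp)
  have hconj : ∀ x : E, x * e2 * x⁻¹ ∈ N := by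
    have hfin : ∀ g : E, (∀ x ∈ N, g⁻¹ * x * g ∈ N) := by
      have hgens : ∀ g : E, (g⁻¹ * e2 * g ∈ N) → ∀ x ∈ N, g⁻¹ * x * g ∈ N := by
        intro g hg x hx
        have hle : N ≤ N.comap (MulAut.conj g⁻¹).toMonoidHom := by
          refine (Subgroup.closure_le _).2 ?_
          rintro y (rfl | rfl)
          · simpa using hg
          · have : g⁻¹ * y * g = y := by rw [mul_assoc, c3]; group
            simpa [this] using n3
        simpa using hle hx
      have hS : ∀ g : E, g⁻¹ * e2 * g ∈ N ∧ g * e2 * g⁻¹ ∈ N := by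
        let H : Subgroup E :=
          { carrier := {g | g⁻¹ * e2 * g ∈ N ∧ g * e2 * g⁻¹ ∈ N}
            one_mem' := by simpa using n2
            mul_mem' := by
              rintro a b ⟨ha, ha'⟩ ⟨hb, hb'⟩
              constructor
              · have := hgens b hb _ ha
                simpa [mul_assoc] using this
              · have := hgens a⁻¹ (by simpa using ha') _ hb'
                simpa [mul_assoc] using this
            inv_mem' := by
              rintro a ⟨ha, ha'⟩
              exact ⟨by simpa using ha', by simpa using ha⟩ }
        refine gen H ?_ ?_ ?_ ?_
        · constructor
          · have : e0⁻¹ * e2 * e0 = e2 * e3 := by rw [mul_assoc, g20]; group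
            rw [this]; exact mul_mem n2 n3
          · have : e0 * e2 * e0⁻¹ = e2 * e3⁻¹ := by
              rw [mul_inv_eq_iff_eq_mul, mul_assoc e2, eq_comm,
                ((show Commute e3 e0 from c3 e0).inv_left).eq, ← mul_assoc, g20]; group
            rw [this]; exact mul_mem n2 (inv_mem n3)
        · constructor
          · have : e1⁻¹ * e2 * e1 = e2 := by rw [mul_assoc, c21]; group
            rw [this]; exact n2
          · have : e1 * e2 * e1⁻¹ = e2 := by rw [← c21]; group
            rw [this]; exact n2
        · constructor
          · have : e4⁻¹ * e2 * e4 = e2 := by rw [mul_assoc, ← c42]; group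
            rw [this]; exact n2
          · have : e4 * e2 * e4⁻¹ = e2 := by rw [c42]; group
            rw [this]; exact n2
        · intro z hz
          constructor
          · have : z⁻¹ * e2 * z = e2 := by rw [mul_assoc, ← hz]; group
            rw [this]; exact n2
          · have : z * e2 * z⁻¹ = e2 := by rw [hz]; group
            rw [this]; exact n2
      exact fun g => hgens g (hS g).1
    intro x
    simpa using hfin x⁻¹ e2 n2
  haveI hN : N.Normal := by
    constructor
    intro n hn g
    have hle : N ≤ N.comap (MulAut.conj g).toMonoidHom := by
      refine (Subgroup.closure_le _).2 ?_
      rintro y (rfl | rfl)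
      · simpa using hconj g
      · have : g * y * g⁻¹ = y := by rw [← c3]; group
        simpa [this] using n3
    simpa using hle hn
  have hcomN : commutator E ≤ N := by
    let q := QuotientGroup.mk' N
    have k2 : q e2 = 1 := (QuotientGroup.eq_one_iff _).2 n2
    have k3 : q e3 = 1 := (QuotientGroup.eq_one_iff _).2 n3
    have m10 : q e1 * q e0 = q e0 * q e1 := by
      have := congrArg q g10
      simpa [k2] using this
    have m14 : q e1 * q e4 = q e4 * q e1 := by
      have := congrArg q g14
      simpa [k3] using this
    have m40 : q e4 * q e0 = q e0 * q e4 := by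
      have := congrArg q c40
      simpa using this
    have mz : ∀ z, (∀ x, z * x = x * z) → ∀ y, q y * q z = q z * q y := by
      intro z hz y
      rw [← map_mul, ← map_mul, hz]
    have hc : ∀ a, (q a * q e0 = q e0 * q a) → (q a * q e1 = q e1 * q a) →
        (q a * q e4 = q e4 * q a) → ∀ x, q a * q x = q x * q a := by
      intro a a0 a1 a4 x
      have := gen ((Subgroup.centralizer {q a}).comap q)
        (by simpa [Subgroup.mem_centralizer_singleton_iff] using a0.symm)
        (by simpa [Subgroup.mem_centralizer_singleton_iff] using a1.symm)
        (by simpa [Subgroup.mem_centralizer_singleton_iff] using a4.symm)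
        (fun z hz => by
          simpa [Subgroup.mem_centralizer_singleton_iff] using (mz z hz a).symm) x
      exact this (q a) rfl
    have t0 := hc e0 rfl m10.symm m40.symm
    have t1 := hc e1 m10 rfl m14
    have t4 := hc e4 m40 m14.symm rfl
    have tt : ∀ a x, q a * q x = q x * q a := fun a =>
      hc a (t0 a).symm (t1 a).symm (t4 a).symm
    rw [commutator_def, Subgroup.commutator_le]
    intro a _ b _
    rw [← QuotientGroup.eq_one_iff]
    refine (map_commutatorElement q a b).trans ?_
    rw [commutatorElement_eq_one_iff_mul_comm]
    exact tt a b
  -- elements of `N`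
  have c23 : Commute e3 e2 := c3 e2
  have hform : ∀ x ∈ N, ∃ i j : ℤ, x = e2 ^ i * e3 ^ j := by
    intro x hx
    induction hx using Subgroup.closure_induction with
    | mem x hx =>
      rcases hx with rfl | rfl
      · exact ⟨1, 0, by simp⟩
      · exact ⟨0, 1, by simp⟩
    | one => exact ⟨0, 0, by simp⟩
    | mul x y _ _ hx hy =>
      obtain ⟨i, j, rfl⟩ := hx
      obtain ⟨k, l, rfl⟩ := hy
      refine ⟨i + k, j + l, ?_⟩
      have := (c23.zpow_zpow j k).eq
      calc e2 ^ i * e3 ^ j * (e2 ^ k * e3 ^ l) = e2 ^ i * (e3 ^ j * e2 ^ k) * e3 ^ l := by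
            simp only [mul_assoc]
        _ = _ := by rw [this, zpow_add, zpow_add]; simp only [mul_assoc]
    | inv x _ hx =>
      obtain ⟨i, j, rfl⟩ := hx
      refine ⟨-i, -j, ?_⟩
      rw [mul_inv_rev, ← zpow_neg, ← zpow_neg]
      exact (c23.zpow_zpow _ _).eq
  intro x hx hx1
  obtain ⟨i, j, rfl⟩ := hform x (hcomN hx)
  have ho : orderOf (π e3) = p := orderOf_eq_prime_iff (hp := ⟨hp⟩) |>.2 ⟨h3p, h3⟩
  have z20 : ∀ i : ℤ, e0⁻¹ * e2 ^ i * e0 = e2 ^ i * e3 ^ i := by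
    intro i
    have h : e0⁻¹ * e2 * e0 = e2 * e3 := by rw [mul_assoc, g20]; group
    have h' := congrArg (fun t => t ^ i) h
    simp only [c23.symm.mul_zpow] at h'
    rw [← h']
    have := conj_zpow (i := i) (a := e0⁻¹) (b := e2)
    simpa using this.symm
  have d1 : (π e3) ^ i = 1 := by
    have h := congrArg π (z20 i)
    rw [map_mul, map_zpow, map_zpow] at hx1
    have h5 : π e2 ^ i = (π e3 ^ j)⁻¹ := eq_inv_of_mul_eq_one_left hx1
    have h6 : Commute (π e3 ^ j)⁻¹ (π e0) :=
      ((show Commute (π e3) (π e0) from h3c _).zpow_left j).inv_left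
    simp only [map_mul, map_zpow, map_inv] at h
    rw [h5, mul_assoc, h6.eq, inv_mul_cancel_left] at h
    exact (mul_eq_left.1 h.symm)
  have d2 : (p : ℤ) ∣ i := by rw [← ho]; exact orderOf_dvd_iff_zpow_eq_one.2 d1
  obtain ⟨i', rfl⟩ := d2
  have hi : e2 ^ ((p : ℤ) * i') = 1 := by rw [zpow_mul, zpow_natCast, e2p, one_zpow]
  rw [hi, one_mul] at hx1 ⊢
  have d3 : (p : ℤ) ∣ j := by
    rw [← ho]; exact orderOf_dvd_iff_zpow_eq_one.2 (by rw [← map_zpow]; exact hx1)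
  obtain ⟨j', rfl⟩ := d3
  rw [zpow_mul, zpow_natCast, e3p, one_zpow]

/-- Let `p ≥ 5` be a prime, `ν` a quadratic non-residue mod `p`, and `G` one of the groups of
the isoclinism family `Φ₇` of order `p⁵`: generated by `f0,…,f4` with `Z(G) = ⟨f3⟩`,
relations `[f1,f0] = f2`, `[f2,f0] = [f1,f4] = f3`, `[f4,f0] = [f2,f1] = [f4,f2] = 1`,
together with one of the five sets of power relations. Then `B₀(G) = 0`. -/
theorem B0_phi7_eq_bot (p : ℕ) (hp : p.Prime) (hp5 : 5 ≤ p)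
    (ν : ℤ) (hν : ¬ ∃ x : ZMod p, x ^ 2 = (ν : ZMod p))
    (G : Type) [Group G] [Finite G] (hcard : Nat.card G = p ^ 5)
    (f0 f1 f2 f3 f4 : G)
    (hgen : Subgroup.closure {f0, f1, f2, f3, f4} = ⊤)
    (hcen : Subgroup.closure {f3} = Subgroup.center G)
    (r1 : cmt f1 f0 = f2) (r2 : cmt f2 f0 = f3) (r3 : cmt f1 f4 = f3)
    (r4 : cmt f4 f0 = 1) (r5 : cmt f2 f1 = 1) (r6 : cmt f4 f2 = 1)
    (hext :
      (f0 ^ p = f3 ∧ f1 ^ p = 1 ∧ f2 ^ p = 1 ∧ f3 ^ p = 1 ∧ f4 ^ p = 1) ∨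
      (f1 ^ p = f3 ∧ f0 ^ p = 1 ∧ f2 ^ p = 1 ∧ f3 ^ p = 1 ∧ f4 ^ p = 1) ∨
      (f1 ^ p = f3 ^ ν ∧ f0 ^ p = 1 ∧ f2 ^ p = 1 ∧ f3 ^ p = 1 ∧ f4 ^ p = 1) ∨
      (f4 ^ p = f3 ∧ f0 ^ p = 1 ∧ f1 ^ p = 1 ∧ f2 ^ p = 1 ∧ f3 ^ p = 1) ∨
      (f0 ^ p = 1 ∧ f1 ^ p = 1 ∧ f2 ^ p = 1 ∧ f3 ^ p = 1 ∧ f4 ^ p = 1)) :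
    B0 G = ⊥ := by
  haveI := Fact.mk hp
  have hpG : IsPGroup p G := IsPGroup.of_card hcard
  have h3mem : f3 ∈ Subgroup.center G := by
    rw [← hcen]; exact Subgroup.subset_closure rfl
  have h3c : ∀ g : G, f3 * g = g * f3 := fun g => (Subgroup.mem_center_iff.1 h3mem g).symm
  have h3 : f3 ≠ 1 := by
    rintro rfl
    haveI : Nontrivial G := by
      rw [← Finite.one_lt_card_iff_nontrivial, hcard]
      exact Nat.one_lt_pow (by norm_num) hp.one_lt
    have hnt := hpG.center_nontrivial
    rw [← hcen] at hnt
    exact (Subgroup.nontrivial_iff_ne_bot _).1 hnt Subgroup.closure_singleton_one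
  have h0 : ∀ g : G, f0 ^ p * g = g * f0 ^ p := by
    intro g
    rcases hext with h | h | h | h | h
    · rw [h.1]; exact h3c g
    · rw [h.2.1]; simp
    · rw [h.2.1]; simp
    · rw [h.2.1]; simp
    · rw [h.1]; simp
  have h4 : ∀ g : G, f4 ^ p * g = g * f4 ^ p := by
    intro g
    rcases hext with h | h | h | h | h
    · rw [h.2.2.2.2]; simp
    · rw [h.2.2.2.2]; simp
    · rw [h.2.2.2.2]; simp
    · rw [h.1]; exact h3c g
    · rw [h.2.2.2.2]; simp
  have h2p : f2 ^ p = 1 := by tauto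
  have h3p : f3 ^ p = 1 := by tauto
  rw [eq_bot_iff]
  rintro x ⟨f, rfl, hf⟩
  rw [AddSubgroup.mem_bot, QuotientAddGroup.eq_zero_iff]
  apply coboundary_of_inter
  refine inter_trivial (cextProj f) (fun g => ⟨⟨0, g⟩, rfl⟩) ?_ p hp hp5 f0 f1 f2 f3 f4 hgen h3c
    r1 r2 r3 r4 r5 r6 h0 h4 h2p h3p h3
  intro a b hab
  have hs := symm_of_restricts p hp hpG f.1 hf a.snd b.snd hab
  rw [cext_mul, cext_mul, hs, add_comm a.fst]
  congr 1
end

section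
/- Let G be a group of order 3^5 generated by f1, f2, f3, f4, f5 with Z(G) = ⟨f5⟩ and relations [f2,f1] = f4, [f3,f2] = [f4,f1] = f5, [f3,f1] = [f4,f2] = [f4,f3] = 1, together with one of the following sets of extra relations: (1) f_i^3 = 1 for 1 ≤ i ≤ 5; (2) f2^3 = f5 and f1^3 = f3^3 = f4^3 = f5^3 = 1; (3) f2^3 = f5^2 and f1^3 = f3^3 = f4^3 = f5^3 = 1; (4) f1^3 = f2^{-3} = f5 and f3^3 = f4^3 = f5^3 = 1; (5) f3^3 = f5 and f1^3 = f2^3 = f4^3 = f5^3 = 1. Then B_0(G) = 0. -/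
/-- A commutative group generated by two elements is bicyclic. -/
theorem bicyclic_of_two_gen_s12 {A : Type*} [CommGroup A] (g h : A)
    (hgen : ∀ a : A, ∃ m n : ℤ, a = g ^ m * h ^ n) :
    ∃ B C : Subgroup A, IsCyclic B ∧ IsCyclic C ∧ Nonempty (A ≃* B × C) := by
  classical
  let φ : (Fin 2 → ℤ) →ₗ[ℤ] Additive A :=
    Fintype.linearCombination ℤ ![Additive.ofMul g, Additive.ofMul h]
  have hφs : ∀ a : Additive A, ∃ v, φ v = a := by
    intro a
    obtain ⟨m, n, hmn⟩ := hgen a.toMul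
    refine ⟨![m, n], ?_⟩
    simp only [φ, Fintype.linearCombination_apply, Fin.sum_univ_two, Matrix.cons_val_zero,
      Matrix.cons_val_one]
    apply Additive.toMul.injective
    simpa using hmn.symm
  obtain ⟨k, S⟩ := (LinearMap.ker φ).smithNormalForm (Pi.basisFun ℤ (Fin 2))
  have key : ∀ m ∈ LinearMap.ker φ, ∀ i, φ (S.bM.repr m i • S.bM i) = 0 := by
    intro m hm i
    by_cases hi : i ∈ Set.range S.f
    · obtain ⟨j, rfl⟩ := hi
      have h1 := S.repr_apply_embedding_eq_repr_smul ⟨m, hm⟩ (i := j)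
      simp only at h1
      rw [map_smul, Finsupp.smul_apply] at h1
      rw [h1, smul_eq_mul, mul_comm, mul_smul, ← S.snf, map_smul]
      have : φ (S.bN j) = 0 := (S.bN j).2
      rw [this, smul_zero]
    · have h1 := S.repr_eq_zero_of_notMem_range ⟨m, hm⟩ hi
      simp only at h1
      rw [h1, zero_smul, map_zero]
  let x : A := (φ (S.bM 0)).toMul
  let y : A := (φ (S.bM 1)).toMul
  have hxy : ∀ m n : ℤ, φ (m • S.bM 0 + n • S.bM 1) = Additive.ofMul (x ^ m * y ^ n) := by
    intro m n
    rw [map_add, map_smul, map_smul]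
    rfl
  let ψ : Subgroup.zpowers x × Subgroup.zpowers y →* A :=
    (Subgroup.zpowers x).subtype.coprod (Subgroup.zpowers y).subtype
  have hψ : Function.Bijective ψ := by
    constructor
    · rw [injective_iff_map_eq_one]
      rintro ⟨⟨_, m, rfl⟩, ⟨_, n, rfl⟩⟩ h1
      have h2 : x ^ m * y ^ n = 1 := h1
      have h3 : (m • S.bM 0 + n • S.bM 1) ∈ LinearMap.ker φ := by
        rw [LinearMap.mem_ker, hxy, h2]; rfl
      have h4 := key _ h3 0
      have h5 := key _ h3 1
      simp only [map_add, map_smul, Finsupp.add_apply, Finsupp.smul_apply,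
        Module.Basis.repr_self, Finsupp.single_apply, smul_eq_mul, Fin.isValue, one_ne_zero,
        zero_ne_one, if_true, if_false, mul_one, mul_zero, add_zero, zero_add] at h4 h5
      have h6 : x ^ m = 1 := h4
      have h7 : y ^ n = 1 := h5
      simp [h6, h7]
    · intro a
      obtain ⟨v, hv⟩ := hφs (Additive.ofMul a)
      refine ⟨(⟨x ^ (S.bM.repr v 0), _, rfl⟩, ⟨y ^ (S.bM.repr v 1), _, rfl⟩), ?_⟩
      have h1 := S.bM.sum_repr v
      rw [Fin.sum_univ_two] at h1
      rw [← h1, hxy] at hv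
      exact hv
  exact ⟨Subgroup.zpowers x, Subgroup.zpowers y, inferInstance, inferInstance,
    ⟨(MulEquiv.ofBijective ψ hψ).symm⟩⟩

theorem cocycle_comm {G : Type*} [Group G] {f : G → G → QZ}
    (hr : RestrictsToCoboundaries f) {g h : G} (hc : g * h = h * g) : f g h = f h g := by
  let s : Set G := {g, h}
  have hs : ∀ x ∈ s, ∀ y ∈ s, x * y = y * x := by
    rintro x (rfl | rfl) y (rfl | rfl) <;> first | rfl | exact hc | exact hc.symm
  let A := Subgroup.closure s
  have hg : g ∈ A := Subgroup.subset_closure (by simp [s])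
  have hh : h ∈ A := Subgroup.subset_closure (by simp [s])
  have hA : IsBicyclic A := by
    right
    letI : CommGroup A := { (inferInstance : Group A) with
      mul_comm := (Subgroup.isMulCommutative_closure hs).is_comm.comm }
    refine bicyclic_of_two_gen_s12 (⟨g, hg⟩ : A) ⟨h, hh⟩ ?_
    rintro ⟨a, ha⟩
    have hcc : Commute g h := hc
    have : ∃ m n : ℤ, a = g ^ m * h ^ n := by
      induction ha using Subgroup.closure_induction with
      | mem x hx =>
        rcases hx with rfl | rfl
        · exact ⟨1, 0, by simp⟩
        · exact ⟨0, 1, by simp⟩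
      | one => exact ⟨0, 0, by simp⟩
      | mul x y _ _ hx hy =>
        obtain ⟨m, n, rfl⟩ := hx
        obtain ⟨m', n', rfl⟩ := hy
        refine ⟨m + m', n + n', ?_⟩
        rw [zpow_add, zpow_add, mul_assoc, mul_assoc, ← mul_assoc (h ^ n),
          ((hcc.zpow_zpow m' n).symm).eq, mul_assoc]
      | inv x _ hx =>
        obtain ⟨m, n, rfl⟩ := hx
        refine ⟨-m, -n, ?_⟩
        rw [mul_inv_rev, zpow_neg, zpow_neg, ((hcc.zpow_zpow m n).inv_inv).eq]
    obtain ⟨m, n, hmn⟩ := this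
    exact ⟨m, n, Subtype.ext hmn⟩
  obtain ⟨c, hc'⟩ := hr A hA
  have h1 := hc' ⟨g, hg⟩ ⟨h, hh⟩
  have h2 := hc' ⟨h, hh⟩ ⟨g, hg⟩
  have h3 : (⟨g, hg⟩ : A) * ⟨h, hh⟩ = ⟨h, hh⟩ * ⟨g, hg⟩ := Subtype.ext hc
  simp only at h1 h2
  rw [h1, h2, h3, add_comm (c ⟨g, hg⟩)]

/-- The central extension attached to a cocycle. -/
@[ext]
structure CExt_s12 {G : Type*} [Group G] (f : G → G → QZ) where
  g : G
  a : QZ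

theorem cocycle_one_left_s12 {G : Type*} [Group G] {f : G → G → QZ} (hf : IsGrpCocycle f) (k : G) :
    f 1 k = f 1 1 := by
  have := hf 1 1 k
  simp only [one_mul] at this
  exact (add_right_cancel this).symm

theorem cocycle_one_right {G : Type*} [Group G] {f : G → G → QZ} (hf : IsGrpCocycle f) (k : G) :
    f k 1 = f 1 1 := by
  have := hf k 1 1
  simp only [mul_one] at this
  exact (add_right_cancel this)

/-- The group structure on the central extension. -/
@[reducible]
def CExt_s12.group {G : Type*} [Group G] {f : G → G → QZ} (hf : IsGrpCocycle f) : Group (CExt_s12 f) :=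
  letI : Mul (CExt_s12 f) := ⟨fun x y => ⟨x.g * y.g, x.a + y.a + f x.g y.g⟩⟩
  letI : One (CExt_s12 f) := ⟨⟨1, - f 1 1⟩⟩
  letI : Inv (CExt_s12 f) := ⟨fun x => ⟨x.g⁻¹, - f 1 1 - x.a - f x.g⁻¹ x.g⟩⟩
  Group.ofLeftAxioms
    (by
      rintro ⟨g, a⟩ ⟨h, b⟩ ⟨k, c⟩
      refine CExt_s12.ext (mul_assoc _ _ _) ?_
      change (a + b + f g h) + c + f (g * h) k = a + (b + c + f h k) + f g (h * k)
      have := hf g h k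
      calc _ = a + b + c + (f g h + f (g * h) k) := by abel
        _ = _ := by rw [this]; abel)
    (by
      rintro ⟨g, a⟩
      refine CExt_s12.ext (one_mul _) ?_
      change - f 1 1 + a + f 1 g = a
      rw [cocycle_one_left_s12 hf g]; abel)
    (by
      rintro ⟨g, a⟩
      refine CExt_s12.ext (inv_mul_cancel _) ?_
      change - f 1 1 - a - f g⁻¹ g + a + f g⁻¹ g = - f 1 1
      abel)

/-- If `ℚ/ℤ` meets the commutator subgroup of the extension trivially, it splits. -/
theorem coboundary_of_inter_s12 {G : Type*} [Group G] {f : G → G → QZ} (hf : IsGrpCocycle f)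
    (H : letI := CExt_s12.group hf
      ∀ x : CExt_s12 f, x ∈ commutator (CExt_s12 f) → x.g = 1 → x = 1) : IsGrpCoboundary f := by
  letI := CExt_s12.group hf
  let ι : Multiplicative QZ →* CExt_s12 f := MonoidHom.mk' (fun a => ⟨1, a.toAdd - f 1 1⟩) (by
    intro a b
    refine CExt_s12.ext (mul_one 1).symm ?_
    change (a.toAdd + b.toAdd) - f 1 1 = (a.toAdd - f 1 1) + (b.toAdd - f 1 1) + f 1 1
    abel)
  let j : QZ →+ Additive (Abelianization (CExt_s12 f)) :=
    MonoidHom.toAdditiveRight ((Abelianization.of).comp ι)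
  have hj : Function.Injective j := by
    rw [injective_iff_map_eq_zero]
    intro a ha
    have h1 : Abelianization.of (ι (Multiplicative.ofAdd a)) = 1 := ha
    have h2 : ι (Multiplicative.ofAdd a) ∈ commutator (CExt_s12 f) := by
      rw [← Abelianization.ker_of]; exact h1
    have h3 := H _ h2 rfl
    have h4 : a - f 1 1 = - f 1 1 := congrArg CExt_s12.a h3
    simpa [sub_eq_add_neg] using h4
  haveI : DivisibleBy QZ ℤ := inferInstanceAs (DivisibleBy (AddCircle (1 : ℚ)) ℤ)
  obtain ⟨r, hr⟩ := (Module.Baer.of_divisible QZ).extension_property_addMonoidHom j hj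
    (AddMonoidHom.id QZ)
  let c : CExt_s12 f → QZ := fun x => r (Additive.ofMul (Abelianization.of x))
  have hc : ∀ x y, c (x * y) = c x + c y := by
    intro x y
    simp only [c, map_mul, ofMul_mul, map_add]
  have hcι : ∀ a : QZ, c (ι (Multiplicative.ofAdd a)) = a := fun a => DFunLike.congr_fun hr a
  refine ⟨fun g => c ⟨g, 0⟩, fun g h => ?_⟩
  have e : (⟨g, 0⟩ : CExt_s12 f) * ⟨h, 0⟩ = ⟨g * h, 0⟩ * ι (Multiplicative.ofAdd (f g h)) := by
    refine CExt_s12.ext (mul_one _).symm ?_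
    change 0 + 0 + f g h = 0 + (f g h - f 1 1) + f (g * h) 1
    rw [cocycle_one_right hf (g * h)]; abel
  have := congrArg c e
  rw [hc, hc, hcι] at this
  simp only [this]
  abel

theorem cmt_eq_iff {G : Type*} [Group G] {x y c : G} : cmt x y = c ↔ x * y = y * x * c := by
  unfold cmt
  constructor
  · rintro rfl; group
  · intro h
    rw [mul_assoc, h]; group

theorem commute_iff_aux {G : Type*} [Group G] {a b w c d : G}
    (h1 : a * w = w * (a * c)) (h2 : b * w = w * (b * d)) :
    Commute (a * b⁻¹) w ↔ c = d := by
  have e1 : a = w * (a * c) * w⁻¹ := by rw [← h1]; group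
  have e2 : b⁻¹ = w * (d⁻¹ * b⁻¹) * w⁻¹ := by
    have : b = w * (b * d) * w⁻¹ := by rw [← h2]; group
    conv_lhs => rw [this]
    group
  have e3 : a * b⁻¹ * w = w * (a * (c * d⁻¹) * b⁻¹) := by
    conv_lhs => rw [e1, e2]
    group
  unfold Commute SemiconjBy
  rw [e3, mul_right_inj, mul_left_inj, mul_eq_left, mul_inv_eq_one]

theorem cube_aux {G : Type*} [Group G] {x y c : G} (n : ℤ) (h1 : x * y = y * (x * c))
    (h2 : Commute x c) (h3 : Commute (x ^ n) y) : c ^ n = 1 := by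
  have h4 : SemiconjBy y (x * c) x := h1.symm
  have h5 := (h4.zpow_right n).eq
  rw [h2.mul_zpow, ← h3.eq.symm, mul_right_inj, mul_eq_left] at h5
  exact h5

/-- The group-theoretic core. -/
theorem core {G E : Type*} [Group G] [Group E] (π : E →* G) (hπ : Function.Surjective π)
    (hcomm : ∀ x y : E, Commute (π x) (π y) → Commute x y)
    (f1 f2 f3 f4 f5 : G)
    (hgen : Subgroup.closure {f1, f2, f3, f4, f5} = ⊤)
    (hcen : ∀ x, Commute f5 x) (h5 : f5 ≠ 1) (h53 : f5 ^ 3 = 1) (h23 : ∀ x, Commute (f2 ^ 3) x)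
    (r1 : cmt f2 f1 = f4) (r2 : cmt f3 f2 = f5) (r3 : cmt f4 f1 = f5)
    (r4 : cmt f3 f1 = 1) (r5 : cmt f4 f2 = 1) (r6 : cmt f4 f3 = 1)
    (x : E) (hx : x ∈ commutator E) (hx1 : π x = 1) : x = 1 := by
  obtain ⟨e1, he1⟩ := hπ f1
  obtain ⟨e2, he2⟩ := hπ f2
  obtain ⟨e3, he3⟩ := hπ f3
  obtain ⟨e4, s1⟩ : ∃ e4, cmt e2 e1 = e4 := ⟨_, rfl⟩
  obtain ⟨e5, s3⟩ : ∃ e5, cmt e4 e1 = e5 := ⟨_, rfl⟩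
  obtain ⟨e5', s2⟩ : ∃ e5', cmt e3 e2 = e5' := ⟨_, rfl⟩
  have he4 : π e4 = f4 := by rw [← s1, ← r1, ← he1, ← he2]; simp [cmt]
  have he5 : π e5 = f5 := by rw [← s3, ← r3, ← he1, ← he4]; simp [cmt]
  rw [cmt_eq_iff] at r1 r2 r3 r4 r5 r6 s1 s2 s3
  rw [mul_one] at r4 r5 r6
  have c5 : ∀ y, Commute e5 y := fun y => hcomm _ _ (by rw [he5]; exact hcen _)
  have c31 : Commute e3 e1 := hcomm _ _ (by rw [he3, he1]; exact r4)
  have c42 : Commute e4 e2 := hcomm _ _ (by rw [he4, he2]; exact r5)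
  have c43 : Commute e4 e3 := hcomm _ _ (by rw [he4, he3]; exact r6)
  have ck : ∀ z, π z = 1 → ∀ y, Commute z y := fun z hz y =>
    hcomm _ _ (by rw [hz]; exact Commute.one_left _)
  -- the key commuting pair
  have gen1 : ∀ {H : Type _} [Group H] (a b c u : H), a * b = b * a * u → Commute u c →
      a * c = c * a → a * (b * c) = b * c * (a * u) := by
    intro H _ a b c u h1 h2 h3
    rw [← mul_assoc, h1, mul_assoc, h2.eq, mul_assoc, ← mul_assoc a, h3]
    simp only [mul_assoc]
  have w4 : f4 * (f1 * f2) = f1 * f2 * (f4 * f5) := gen1 f4 f1 f2 f5 r3 (hcen _) r5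
  have w3 : f3 * (f1 * f2) = f1 * f2 * (f3 * f5) := by
    rw [← mul_assoc, r4, mul_assoc, r2]; simp only [mul_assoc]
  have w4' : e4 * (e1 * e2) = e1 * e2 * (e4 * e5) := by
    rw [← mul_assoc, s3, mul_assoc, (c5 e2).eq, mul_assoc, ← mul_assoc e4, c42.eq]
    simp only [mul_assoc]
  have w3' : e3 * (e1 * e2) = e1 * e2 * (e3 * e5') := by
    rw [← mul_assoc, c31.eq, mul_assoc, s2]; simp only [mul_assoc]
  have e55 : e5 = e5' := by
    rw [← commute_iff_aux w4' w3']
    apply hcomm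
    simp only [map_mul, map_inv, he1, he2, he3, he4]
    exact (commute_iff_aux w4 w3).2 rfl
  subst e55
  -- cubes
  have t4 : e4 ^ (3 : ℤ) = 1 := by
    refine cube_aux 3 (by rw [s1, mul_assoc]) c42.symm (hcomm _ _ ?_)
    rw [map_zpow, he2]
    exact_mod_cast h23 _
  have t5 : e5 ^ (3 : ℤ) = 1 := by
    refine cube_aux 3 (by rw [s3, mul_assoc]) (c5 e4).symm ?_
    rw [t4]; exact Commute.one_left _
  -- the subgroup N
  let N : Subgroup E := Subgroup.closure {e4, e5}
  have n4 : e4 ∈ N := Subgroup.subset_closure (by simp)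
  have n5 : e5 ∈ N := Subgroup.subset_closure (by simp)
  have hgenE : ∀ K : Subgroup E, e1 ∈ K → e2 ∈ K → e3 ∈ K → e4 ∈ K → e5 ∈ K →
      (∀ z, π z = 1 → z ∈ K) → ∀ y, y ∈ K := by
    intro K k1 k2 k3 k4 k5 kk y
    have : Subgroup.closure {f1, f2, f3, f4, f5} ≤ K.map π := by
      rw [Subgroup.closure_le]
      rintro _ (rfl | rfl | rfl | rfl | rfl)
      exacts [⟨e1, k1, he1⟩, ⟨e2, k2, he2⟩, ⟨e3, k3, he3⟩, ⟨e4, k4, he4⟩, ⟨e5, k5, he5⟩]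
    rw [hgen] at this
    obtain ⟨y', hy', hyy⟩ := this (Subgroup.mem_top (π y))
    have := K.mul_mem hy' (kk (y'⁻¹ * y) (by rw [map_mul, map_inv, hyy, inv_mul_cancel]))
    simpa using this
  have conjN : ∀ y, y * e4 * y⁻¹ ∈ N → y⁻¹ * e4 * y ∈ N → y ∈ Subgroup.normalizer (N : Set E) := by
    have half : ∀ y, y * e4 * y⁻¹ ∈ N → ∀ n ∈ N, y * n * y⁻¹ ∈ N := by
      intro y h1
      have : N ≤ N.comap (MulAut.conj y).toMonoidHom := by
        rw [Subgroup.closure_le]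
        rintro z hz
        rcases hz with hz | hz
        · rw [hz]; simpa using h1
        · rw [Set.mem_singleton_iff.1 hz]
          have : y * e5 * y⁻¹ = e5 := by rw [← (c5 y).eq]; group
          simpa [this] using n5
      intro n hn
      simpa using this hn
    intro y h1 h2
    rw [Subgroup.mem_normalizer_iff]
    intro n
    refine ⟨half y h1 n, fun h => ?_⟩
    have := half y⁻¹ (by simpa using h2) _ h
    simpa [mul_assoc] using this
  have conjN' : ∀ y, Commute e4 y → y ∈ Subgroup.normalizer (N : Set E) := by
    intro y hy
    apply conjN
    · rw [← hy.eq]; simpa using n4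
    · rw [mul_assoc, hy.eq]; simpa using n4
  haveI hN : N.Normal := by
    rw [← Subgroup.normalizer_eq_top_iff, eq_top_iff]
    intro y _
    refine hgenE _ ?_ (conjN' _ c42) (conjN' _ c43) (conjN' _ (Commute.refl _))
      (conjN' _ (c5 _).symm) (fun z hz => conjN' _ (ck z hz _).symm) y
    apply conjN
    · have : e1 * e4 * e1⁻¹ = e4 * e5⁻¹ := by
        have h1 : e1 * e4 = e4 * e1 * e5⁻¹ := by rw [s3]; group
        rw [h1, mul_assoc, mul_assoc, ((c5 e1⁻¹).inv_left).eq]; group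
      rw [this]; exact N.mul_mem n4 (N.inv_mem n5)
    · have : e1⁻¹ * e4 * e1 = e4 * e5 := by
        rw [mul_assoc, s3]; group
      rw [this]; exact N.mul_mem n4 n5
  -- E / N is commutative
  let q := QuotientGroup.mk' N
  have q4 : q e4 = 1 := (QuotientGroup.eq_one_iff _).2 n4
  have q5 : q e5 = 1 := (QuotientGroup.eq_one_iff _).2 n5
  have q21 : q e2 * q e1 = q e1 * q e2 := by
    rw [← map_mul, s1, map_mul, q4, mul_one, map_mul]
  have q32 : q e3 * q e2 = q e2 * q e3 := by
    rw [← map_mul, s2, map_mul, q5, mul_one, map_mul]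
  have q31 : q e3 * q e1 = q e1 * q e3 := by
    rw [← map_mul, c31.eq, map_mul]
  have qk : ∀ z, π z = 1 → ∀ y, q z * q y = q y * q z := fun z hz y => by
    rw [← map_mul, (ck z hz y).eq, map_mul]
  have step : ∀ u, q u * q e1 = q e1 * q u → q u * q e2 = q e2 * q u →
      q u * q e3 = q e3 * q u → ∀ y, q u * q y = q y * q u := by
    intro u h1 h2 h3 y
    have := hgenE ((Subgroup.centralizer {q u}).comap q)
      (by simpa [Subgroup.mem_centralizer_singleton_iff] using h1.symm)
      (by simpa [Subgroup.mem_centralizer_singleton_iff] using h2.symm)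
      (by simpa [Subgroup.mem_centralizer_singleton_iff] using h3.symm)
      (by simp [q4])
      (by simp [q5])
      (fun z hz => by
        rw [Subgroup.mem_comap, Subgroup.mem_centralizer_singleton_iff]; exact qk z hz u) y
    rw [Subgroup.mem_comap, Subgroup.mem_centralizer_singleton_iff] at this
    exact this.symm
  have a1 := step e1 rfl q21.symm q31.symm
  have a2 := step e2 q21 rfl q32.symm
  have a3 := step e3 q31 q32 rfl
  have a : ∀ u y, q u * q y = q y * q u := fun u =>
    step u (a1 u).symm (a2 u).symm (a3 u).symm
  have hcN : commutator E ≤ N := by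
    rw [commutator_def, Subgroup.commutator_le]
    intro u _ v _
    rw [← QuotientGroup.eq_one_iff]
    change q _ = 1
    rw [map_commutatorElement, commutatorElement_eq_one_iff_mul_comm]
    exact a u v
  -- final computation
  have hform : ∀ y ∈ N, ∃ m n : ℤ, y = e4 ^ m * e5 ^ n := by
    intro y hy
    induction hy using Subgroup.closure_induction with
    | mem y hy =>
      rcases hy with rfl | rfl
      · exact ⟨1, 0, by simp⟩
      · exact ⟨0, 1, by simp⟩
    | one => exact ⟨0, 0, by simp⟩
    | mul y z _ _ hy hz =>
      obtain ⟨m, n, rfl⟩ := hy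
      obtain ⟨m', n', rfl⟩ := hz
      refine ⟨m + m', n + n', ?_⟩
      rw [zpow_add, zpow_add, mul_assoc, mul_assoc, ← mul_assoc (e5 ^ n),
        ((c5 e4).zpow_zpow n m').eq, mul_assoc]
    | inv y _ hy =>
      obtain ⟨m, n, rfl⟩ := hy
      refine ⟨-m, -n, ?_⟩
      rw [mul_inv_rev, zpow_neg, zpow_neg, ((c5 e4).zpow_zpow n m).inv_inv.eq]
  obtain ⟨m, n, rfl⟩ := hform x (hcN hx)
  have ho : orderOf f5 = 3 := orderOf_eq_prime h53 h5
  have hd : ∀ k : ℤ, f5 ^ k = 1 → (3 : ℤ) ∣ k := by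
    intro k hk
    have := orderOf_dvd_iff_zpow_eq_one.2 hk
    rwa [ho] at this
  rw [map_mul, map_zpow, map_zpow, he4, he5] at hx1
  have hm : f5 ^ m = 1 := by
    refine cube_aux m (by rw [r3, mul_assoc]) (hcen f4).symm (y := f1) ?_
    rw [eq_inv_of_mul_eq_one_left hx1]
    exact ((hcen f1).zpow_left n).inv_left
  obtain ⟨m', rfl⟩ := hd m hm
  have hem : e4 ^ (3 * m') = 1 := by rw [zpow_mul, t4, one_zpow]
  have hfm : f4 ^ (3 * m') = 1 := by rw [← he4, ← map_zpow, hem, map_one]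
  rw [hfm, one_mul] at hx1
  obtain ⟨n', rfl⟩ := hd n hx1
  rw [hem, zpow_mul, t5, one_zpow, one_mul]

/-- Let `G` be one of the groups of the isoclinism family `Φ₇` of order `3⁵`: generated by
`f1,…,f5` with `Z(G) = ⟨f5⟩`, relations `[f2,f1] = f4`, `[f3,f2] = [f4,f1] = f5`,
`[f3,f1] = [f4,f2] = [f4,f3] = 1`, together with one of the five sets of power relations.
Then `B₀(G) = 0`. -/
theorem B0_phi7_order243_eq_bot
    (G : Type) [Group G] [Finite G] (hcard : Nat.card G = 3 ^ 5)
    (f1 f2 f3 f4 f5 : G)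
    (hgen : Subgroup.closure {f1, f2, f3, f4, f5} = ⊤)
    (hcen : Subgroup.closure {f5} = Subgroup.center G)
    (r1 : cmt f2 f1 = f4) (r2 : cmt f3 f2 = f5) (r3 : cmt f4 f1 = f5)
    (r4 : cmt f3 f1 = 1) (r5 : cmt f4 f2 = 1) (r6 : cmt f4 f3 = 1)
    (hext :
      (f1 ^ 3 = 1 ∧ f2 ^ 3 = 1 ∧ f3 ^ 3 = 1 ∧ f4 ^ 3 = 1 ∧ f5 ^ 3 = 1) ∨
      (f2 ^ 3 = f5 ∧ f1 ^ 3 = 1 ∧ f3 ^ 3 = 1 ∧ f4 ^ 3 = 1 ∧ f5 ^ 3 = 1) ∨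
      (f2 ^ 3 = f5 ^ 2 ∧ f1 ^ 3 = 1 ∧ f3 ^ 3 = 1 ∧ f4 ^ 3 = 1 ∧ f5 ^ 3 = 1) ∨
      (f1 ^ 3 = f5 ∧ f2 ^ (-3 : ℤ) = f5 ∧ f3 ^ 3 = 1 ∧ f4 ^ 3 = 1 ∧ f5 ^ 3 = 1) ∨
      (f3 ^ 3 = f5 ∧ f1 ^ 3 = 1 ∧ f2 ^ 3 = 1 ∧ f4 ^ 3 = 1 ∧ f5 ^ 3 = 1)) :
    B0 G = ⊥ := by
  have hmem : ∀ y ∈ Subgroup.closure {f5}, ∀ x, Commute y x := by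
    intro y hy x
    rw [hcen] at hy
    exact (Subgroup.mem_center_iff.1 hy x).symm
  have m5 : f5 ∈ Subgroup.closure {f5} := Subgroup.subset_closure rfl
  have h53 : f5 ^ 3 = 1 := by tauto
  have h23 : f2 ^ 3 ∈ Subgroup.closure {f5} := by
    rcases hext with h | h | h | h | h
    · rw [h.2.1]; exact one_mem _
    · rw [h.1]; exact m5
    · rw [h.1]; exact pow_mem m5 2
    · have h1 : (f2 ^ 3)⁻¹ ∈ Subgroup.closure {f5} := by
        have h2 : (f2 ^ 3)⁻¹ = f2 ^ (-3 : ℤ) := by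
          rw [zpow_neg]; norm_cast
        rw [h2, h.2.1]; exact m5
      simpa using inv_mem h1
    · rw [h.2.2.1]; exact one_mem _
  have h5 : f5 ≠ 1 := by
    intro h
    haveI : Fact (Nat.Prime 3) := ⟨Nat.prime_three⟩
    haveI : Nontrivial G := by
      rw [← Finite.one_lt_card_iff_nontrivial, hcard]; norm_num
    have h1 := (IsPGroup.of_card hcard).bot_lt_center
    rw [← hcen, h] at h1
    rw [Subgroup.closure_singleton_one] at h1
    exact lt_irrefl _ h1
  rw [eq_bot_iff]
  rintro _ ⟨f, rfl, hr⟩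
  rw [AddSubgroup.mem_bot, QuotientAddGroup.eq_zero_iff]
  have hf : IsGrpCocycle (f : G → G → QZ) := f.2
  refine coboundary_of_inter_s12 hf ?_
  letI := CExt_s12.group hf
  let π : CExt_s12 (f : G → G → QZ) →* G := MonoidHom.mk' CExt_s12.g (fun _ _ => rfl)
  refine core π (fun g => ⟨⟨g, 0⟩, rfl⟩) ?_ f1 f2 f3 f4 f5 hgen (hmem _ m5) h5 h53 (hmem _ h23)
    r1 r2 r3 r4 r5 r6
  rintro ⟨g, a⟩ ⟨h, b⟩ hc
  have hc' : g * h = h * g := hc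
  refine CExt_s12.ext hc' ?_
  change a + b + (f : G → G → QZ) g h = b + a + (f : G → G → QZ) h g
  rw [cocycle_comm hr hc', add_comm a b]
end

section
/- Let p be an odd prime number and let k be an algebraically closed field with characteristic different from p. Let G1 and G2 be two groups of order p^5, each generated by elements f1, f2, f0, h1, h2 with Z(G_i) = ⟨h1, h2⟩ and relations [f1,f2] = f0, [f0,f1] = h1, [f0,f2] = h2, f0^p = h1^p = h2^p = 1, f1^p ∈ ⟨h1, h2⟩, f2^p ∈ ⟨h1, h2⟩ (i.e., G1 and G2 both belong to the isoclinism family Φ_6). Then the fields k(G1) and k(G2) are isomorphic as field extensions of k. -/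
set_option synthInstance.maxHeartbeats 1000000
set_option maxHeartbeats 1000000

noncomputable section

/-- The automorphism of the rational function field `k(x_g : g ∈ G)` induced by
`h · x_g = x_{hg}`. -/
def noetherAut (k : Type*) [Field k] (G : Type*) [Group G] (g : G) :
    FractionRing (MvPolynomial G k) ≃+* FractionRing (MvPolynomial G k) :=
  IsFractionRing.ringEquivOfRingEquiv
    ((MvPolynomial.renameEquiv k (Equiv.mulLeft g)).toRingEquiv)

/-- The fixed subfield of a family of field automorphisms. -/
def fixedSubfield {L : Type*} [Field L] {G : Type*} (act : G → (L ≃+* L)) : Subfield L where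
  carrier := {x | ∀ g : G, act g x = x}
  mul_mem' := by intro a b ha hb g; rw [map_mul, ha g, hb g]
  one_mem' := by intro g; rw [map_one]
  add_mem' := by intro a b ha hb g; rw [map_add, ha g, hb g]
  zero_mem' := by intro g; rw [map_zero]
  neg_mem' := by intro a ha g; rw [map_neg, ha g]
  inv_mem' := by intro a ha g; rw [map_inv₀, ha g]

/-- The field `k(G)` of Noether's problem: the fixed field of the natural `G`-action on
the rational function field `k(x_g : g ∈ G)`. -/
def NoetherField (k : Type*) [Field k] (G : Type*) [Group G] :
    Subfield (FractionRing (MvPolynomial G k)) :=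
  fixedSubfield (noetherAut k G)

/-- The embedding of the constants `k` into the rational function field `k(x_i : i ∈ σ)`. -/
def constEmbed (k : Type*) [Field k] (σ : Type*) :
    k →+* FractionRing (MvPolynomial σ k) :=
  (algebraMap (MvPolynomial σ k) (FractionRing (MvPolynomial σ k))).comp MvPolynomial.C

/-- The variable `x_i` inside the rational function field `k(x_i : i ∈ σ)`. -/
def varEmbed (k : Type*) [Field k] (σ : Type*) (i : σ) :
    FractionRing (MvPolynomial σ k) :=
  algebraMap (MvPolynomial σ k) (FractionRing (MvPolynomial σ k)) (MvPolynomial.X i)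

/-- `k(G)` is stably rational over `k`: adjoining finitely many indeterminates to `k(G)`
yields a purely transcendental extension of `k` (the isomorphism being the identity on the
copies of `k` on both sides). -/
def IsStablyRationalOver (k : Type*) [Field k] (G : Type*) [Group G] : Prop :=
  ∃ (m n : ℕ)
    (e : FractionRing (MvPolynomial (Fin m) (NoetherField k G))
          ≃+* FractionRing (MvPolynomial (Fin n) k)),
    ∀ (a : k) (x : NoetherField k G),
      (x : FractionRing (MvPolynomial G k)) = constEmbed k G a →
      e (constEmbed (NoetherField k G) (Fin m) x) = constEmbed k (Fin n) a

end


theorem speiser_aux {k F G : Type*} [Field k] [Field F] [Algebra k F] [Group G] [Fintype G]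
    [MulSemiringAction G F] (K : IntermediateField k F)
    (hcard : (Nat.card G : F) ≠ 0) (hst : ∀ g : G, ∀ a ∈ K, g • a ∈ K) (u : F)
    (hN : ∀ g : G, (∀ a ∈ K, g • a = a) → g • u = u) :
    u ∈ Submodule.span K {w : F | ∃ a ∈ K, w = ∑ g : G, g • (a * u)} := by
  classical
  by_contra hu
  obtain ⟨φ, hφu, hφ⟩ := Submodule.exists_le_ker_of_notMem hu
  let χ : G → (K →* K) := fun g =>
    { toFun := fun a => ⟨g • (a : F), hst g a a.2⟩
      map_one' := by ext; simp
      map_mul' := by intro a b; ext; simp }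
  have hχ : ∀ g (a : K), ((χ g a : K) : F) = g • (a : F) := fun g a => rfl
  have h0 : ∀ a : K, ∑ g : G, φ (g • u) * χ g a = 0 := by
    intro a
    have h1 : φ (∑ g : G, g • ((a : F) * u)) = 0 :=
      hφ (Submodule.subset_span ⟨a, a.2, rfl⟩)
    rw [map_sum] at h1
    rw [← h1]
    refine Finset.sum_congr rfl fun g _ => ?_
    have : g • ((a : F) * u) = (χ g a) • (g • u) := by
      rw [smul_mul', IntermediateField.smul_def, hχ, smul_eq_mul]
    rw [this, φ.map_smul, smul_eq_mul, mul_comm]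
  have hli := linearIndependent_iff'.1 (linearIndependent_monoidHom K K)
    (Finset.univ.image χ) (fun c => ∑ g ∈ Finset.univ.filter (fun g => χ g = c), φ (g • u)) (by
      ext a
      simp only [Finset.sum_apply, Pi.smul_apply, smul_eq_mul, Pi.zero_apply]
      rw [← congrArg Subtype.val (h0 a)]
      congr 1
      rw [← Finset.sum_fiberwise_of_maps_to (s := Finset.univ) (t := Finset.univ.image χ) (g := χ)
        (fun g _ => Finset.mem_image_of_mem _ (Finset.mem_univ g))]
      refine Finset.sum_congr rfl fun c _ => ?_
      rw [Finset.sum_mul]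
      refine Finset.sum_congr rfl fun g hg => ?_
      rw [(Finset.mem_filter.1 hg).2])
    (χ 1) (Finset.mem_image_of_mem _ (Finset.mem_univ _))
  let N : Subgroup G :=
    { carrier := {g | ∀ a ∈ K, g • a = a}
      mul_mem' := by
        intro x y hx hy a ha
        rw [mul_smul, hy a ha, hx a ha]
      one_mem' := by intro a _; simp
      inv_mem' := by
        intro x hx a ha
        rw [inv_smul_eq_iff, hx a ha] }
  have hmem : ∀ g, χ g = χ 1 ↔ g ∈ N := by
    intro g
    constructor
    · intro h a ha
      have := congrArg Subtype.val (DFunLike.congr_fun h ⟨a, ha⟩)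
      simpa [hχ] using this
    · intro h
      ext a
      rw [hχ, hχ, h a a.2, one_smul]
  have hs : ∑ g ∈ Finset.univ.filter (fun g => χ g = χ 1), φ (g • u) =
      (Nat.card N : K) * φ u := by
    rw [Finset.sum_congr rfl (g := fun _ => φ u)]
    · rw [Finset.sum_const, nsmul_eq_mul]
      congr 2
      rw [Nat.card_eq_fintype_card, Fintype.card_subtype]
      congr 1
      ext g
      simp [hmem]
    · intro g hg
      rw [hN g ((hmem g).1 (Finset.mem_filter.1 hg).2)]
  replace hli := hs.symm.trans hli
  rcases mul_eq_zero.1 hli with h | h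
  · apply hcard
    obtain ⟨m, hm⟩ := N.card_subgroup_dvd_card
    have h' : (Nat.card N : F) = 0 := by
      have := congrArg Subtype.val h
      simpa using this
    rw [hm, Nat.cast_mul, h', zero_mul]
  · exact hφu h

/-- If `y ^ p ∈ M`, `σ` fixes `M` and multiplies `y` by a primitive root of unity, then the
`σ`-fixed elements of `M(y)` lie in `M`. -/
theorem fixed_step {k F : Type*} [Field k] [Field F] [Algebra k F] (p : ℕ) (hp : p.Prime)
    (hpk : (p : k) ≠ 0) (ζ : k) (hζ : IsPrimitiveRoot ζ p)
    (M : IntermediateField k F) (y : F) (hy : y ^ p ∈ M) (σ : F →ₐ[k] F)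
    (hσM : ∀ m ∈ M, σ m = m) (hσy : σ y = ζ • y) (x : F)
    (hx : x ∈ IntermediateField.adjoin k ((M : Set F) ∪ {y})) (hσx : σ x = x) : x ∈ M := by
  have hyint : IsIntegral M y := by
    refine ⟨Polynomial.X ^ p - Polynomial.C ⟨y ^ p, hy⟩, Polynomial.monic_X_pow_sub_C _ hp.ne_zero, ?_⟩
    simp
  have hx1 : x ∈ IntermediateField.adjoin M {y} := by
    have : IntermediateField.adjoin k ((M : Set F) ∪ {y}) ≤
        (IntermediateField.adjoin M {y}).restrictScalars k := by
      rw [IntermediateField.adjoin_le_iff]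
      rintro z (hz | hz)
      · exact (IntermediateField.adjoin M {y}).algebraMap_mem ⟨z, hz⟩
      · exact IntermediateField.subset_adjoin M {y} hz
    exact this hx
  have hx2 : x ∈ Algebra.adjoin M {y} := by
    rw [← IntermediateField.adjoin_simple_toSubalgebra_of_isAlgebraic hyint.isAlgebraic]
    exact hx1
  rw [Algebra.adjoin_singleton_eq_range_aeval] at hx2
  obtain ⟨f, rfl⟩ := hx2
  change σ (Polynomial.aeval y f) = Polynomial.aeval y f at hσx
  change Polynomial.aeval y f ∈ M
  have hiter : ∀ j : ℕ, (σ^[j]) (Polynomial.aeval y f) = Polynomial.aeval y f := by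
    intro j
    exact Function.IsFixedPt.iterate hσx j
  have hiter2 : ∀ j : ℕ, (σ^[j]) (Polynomial.aeval y f) = Polynomial.aeval ((ζ ^ j) • y) f := by
    intro j
    induction j with
    | zero => simp
    | succ j ih =>
      rw [Function.iterate_succ_apply', ih, Polynomial.aeval_eq_sum_range,
        Polynomial.aeval_eq_sum_range, map_sum]
      refine Finset.sum_congr rfl fun i _ => ?_
      rw [IntermediateField.smul_def, IntermediateField.smul_def, smul_eq_mul, smul_eq_mul,
        map_mul, hσM _ (f.coeff i).2, map_pow, map_smul, hσy, smul_smul, ← pow_succ]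
  have hsum : (p : F) * Polynomial.aeval y f =
      ∑ i ∈ Finset.range (f.natDegree + 1),
        (f.coeff i : F) * (y ^ i * algebraMap k F (∑ j ∈ Finset.range p, (ζ ^ i) ^ j)) := by
    have : (p : F) * Polynomial.aeval y f =
        ∑ j ∈ Finset.range p, Polynomial.aeval ((ζ ^ j) • y) f := by
      rw [Finset.sum_congr rfl (fun j _ => (hiter2 j).symm.trans (hiter j))]
      simp
    rw [this]
    simp_rw [Polynomial.aeval_eq_sum_range]
    rw [Finset.sum_comm]
    refine Finset.sum_congr rfl fun i _ => ?_
    rw [map_sum, Finset.mul_sum, Finset.mul_sum]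
    refine Finset.sum_congr rfl fun j _ => ?_
    rw [IntermediateField.smul_def, smul_eq_mul, Algebra.smul_def, mul_pow, ← map_pow, ← pow_mul,
      ← pow_mul, mul_comm i j]
    ring
  have hpF : (p : F) ≠ 0 := by
    rw [← map_natCast (algebraMap k F)]
    exact (map_ne_zero _).2 hpk
  have hmem : (p : F) * Polynomial.aeval y f ∈ M := by
    rw [hsum]
    refine M.sum_mem fun i _ => M.mul_mem (f.coeff i).2 ?_
    by_cases hi : p ∣ i
    · obtain ⟨m, rfl⟩ := hi
      refine M.mul_mem ?_ (M.algebraMap_mem _)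
      rw [pow_mul]
      exact pow_mem hy m
    · have h1 : ζ ^ i ≠ 1 := fun h => hi (hζ.dvd_of_pow_eq_one i h)
      have h2 : (∑ j ∈ Finset.range p, (ζ ^ i) ^ j) = 0 := by
        have := mul_geom_sum (ζ ^ i) p
        rw [← pow_mul, mul_comm i p, pow_mul, hζ.pow_eq_one, one_pow, sub_self] at this
        exact (mul_eq_zero.1 this).resolve_left (sub_ne_zero.2 h1)
      rw [h2]
      simp
  have := M.mul_mem (M.inv_mem (natCast_mem M p)) hmem
  rwa [inv_mul_cancel_left₀ hpF] at this

theorem adjoin_stable {k F : Type*} [Field k] [Field F] [Algebra k F] (S : Set F) (σ : F →ₐ[k] F)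
    (M : IntermediateField k F)
    (h : ∀ s ∈ S, σ s ∈ M) : ∀ x ∈ IntermediateField.adjoin k S, σ x ∈ M := by
  have : IntermediateField.adjoin k S ≤ M.comap σ := by
    rw [IntermediateField.adjoin_le_iff]
    exact h
  exact this

theorem adjoin_fixed {k F : Type*} [Field k] [Field F] [Algebra k F] (S : Set F) (σ : F →ₐ[k] F)
    (h : ∀ s ∈ S, σ s = s) : ∀ x ∈ IntermediateField.adjoin k S, σ x = x := by
  intro x hx
  induction hx using IntermediateField.adjoin_induction with
  | mem x hx => exact h x hx
  | algebraMap x => simp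
  | add x y _ _ hx hy => rw [map_add, hx, hy]
  | inv x _ hx => rw [map_inv₀, hx]
  | mul x y _ _ hx hy => rw [map_mul, hx, hy]

theorem adjoin_ext {k F : Type*} [Field k] [Field F] [Algebra k F] {ι : Type*}
    (φ ψ : FractionRing (MvPolynomial ι k) →ₐ[k] F)
    (h : ∀ i, φ (varEmbed k ι i) = ψ (varEmbed k ι i)) :
    φ = ψ := by
  apply AlgHom.coe_ringHom_injective
  apply IsLocalization.ringHom_ext (nonZeroDivisors (MvPolynomial ι k))
  have : (φ.comp (Algebra.algHom k (MvPolynomial ι k) (FractionRing (MvPolynomial ι k)))) =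
    (ψ.comp (Algebra.algHom k (MvPolynomial ι k) (FractionRing (MvPolynomial ι k)))) := by
    apply MvPolynomial.algHom_ext
    intro i
    exact h i
  exact congrArg (fun f : MvPolynomial ι k →ₐ[k] F => (f : MvPolynomial ι k →+* F)) this

theorem transfer {k F₁ F₂ : Type*} [Field k] [Field F₁] [Algebra k F₁] [Field F₂] [Algebra k F₂]
    {ι : Type*} (α₁ : FractionRing (MvPolynomial ι k) →ₐ[k] F₁)
    (α₂ : FractionRing (MvPolynomial ι k) →ₐ[k] F₂) (σ₁ : F₁ →ₐ[k] F₁) (σ₂ : F₂ →ₐ[k] F₂)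
    (e : ι → FractionRing (MvPolynomial ι k))
    (h₁ : ∀ i, σ₁ (α₁ (varEmbed k ι i)) = α₁ (e i))
    (h₂ : ∀ i, σ₂ (α₂ (varEmbed k ι i)) = α₂ (e i))
    (r : FractionRing (MvPolynomial ι k)) (hr : σ₁ (α₁ r) = α₁ r) : σ₂ (α₂ r) = α₂ r := by
  -- the common endomorphism
  have hinj : Function.Injective
      (MvPolynomial.aeval e : MvPolynomial ι k →ₐ[k] FractionRing (MvPolynomial ι k)) := by
    have : (α₁.comp (MvPolynomial.aeval e)) =
        (σ₁.comp α₁).comp (Algebra.algHom k (MvPolynomial ι k) (FractionRing (MvPolynomial ι k))) := by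
      apply MvPolynomial.algHom_ext
      intro i
      simp only [AlgHom.comp_apply, MvPolynomial.aeval_X]
      exact (h₁ i).symm
    have h3 : Function.Injective (α₁.comp (MvPolynomial.aeval e)) := by
      rw [this]
      exact ((σ₁.comp α₁).toRingHom.injective).comp (IsFractionRing.injective _ _)
    exact Function.Injective.of_comp h3
  let τ : FractionRing (MvPolynomial ι k) →ₐ[k] FractionRing (MvPolynomial ι k) :=
    IsFractionRing.liftAlgHom hinj
  have hτ : ∀ i, τ (varEmbed k ι i) = e i := by
    intro i
    simp [τ, varEmbed]
  have e1 : σ₁.comp α₁ = α₁.comp τ := adjoin_ext _ _ (fun i => by simp [hτ, h₁])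
  have e2 : σ₂.comp α₂ = α₂.comp τ := adjoin_ext _ _ (fun i => by simp [hτ, h₂])
  have h4 : τ r = r := by
    apply α₁.toRingHom.injective
    exact (AlgHom.congr_fun e1 r).symm.trans hr
  have := AlgHom.congr_fun e2 r
  simpa [h4] using this


theorem gen_induction {G : Type*} [Group G] [Finite G] {s : Set G} (hs : Subgroup.closure s = ⊤)
    (P : G → Prop) (h1 : P 1) (hmul : ∀ x y, P x → P y → P (x * y)) (hP : ∀ x ∈ s, P x) (g : G) :
    P g := by
  have hg : g ∈ Submonoid.closure s := by
    rw [← Subgroup.closure_toSubmonoid_of_finite, hs]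
    trivial
  induction hg using Submonoid.closure_induction with
  | mem x hx => exact hP x hx
  | one => exact h1
  | mul x y _ _ hx hy => exact hmul x y hx hy

theorem card_zpowers_sup_le {G : Type*} [Group G] [Finite G] (N : Subgroup G) [N.Normal] (f : G)
    (p : ℕ) (hp : 0 < p) (hf : f ^ p ∈ N) :
    Nat.card (Subgroup.zpowers f ⊔ N : Subgroup G) ≤ p * Nat.card N := by
  have hsurj : Function.Surjective (fun x : Fin p × N =>
      (⟨f ^ (x.1 : ℕ) * x.2, Subgroup.mul_mem_sup
        (Subgroup.npow_mem_zpowers f _) x.2.2⟩ : (Subgroup.zpowers f ⊔ N : Subgroup G))) := by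
    rintro ⟨x, hx⟩
    obtain ⟨y, hy, z, hz, rfl⟩ := Subgroup.mem_sup_of_normal_right.1 hx
    obtain ⟨m, rfl⟩ := Subgroup.mem_zpowers_iff.1 hy
    have hp' : (0 : ℤ) < p := by exact_mod_cast hp
    have h0 := Int.emod_nonneg m hp'.ne'
    have h1 := Int.emod_lt_of_pos m hp'
    refine ⟨(⟨(m % p).toNat, by omega⟩, ⟨(f ^ p) ^ (m / p) * z, N.mul_mem (N.zpow_mem hf _) hz⟩), ?_⟩
    ext
    simp only
    rw [← mul_assoc]
    congr 1
    rw [← zpow_natCast f p, ← zpow_mul, ← zpow_natCast, Int.toNat_of_nonneg h0, ← zpow_add,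
      Int.emod_add_mul_ediv]
  have := Nat.card_le_card_of_surjective _ hsurj
  simpa using this

theorem normal_zpowers_sup {G : Type*} [Group G] [Finite G] {s : Set G}
    (hs : Subgroup.closure s = ⊤) (N : Subgroup G) [hN : N.Normal] (f : G)
    (h : ∀ x ∈ s, x * f * x⁻¹ ∈ Subgroup.zpowers f ⊔ N) :
    (Subgroup.zpowers f ⊔ N).Normal := by
  refine ⟨fun n hn g => ?_⟩
  revert n
  refine gen_induction hs (fun g => ∀ n ∈ Subgroup.zpowers f ⊔ N, g * n * g⁻¹ ∈
    Subgroup.zpowers f ⊔ N) (by simp) ?_ ?_ g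
  · intro x y hx hy n hn
    have := hx _ (hy n hn)
    simpa [mul_assoc] using this
  · intro x hx
    have : Subgroup.zpowers f ⊔ N ≤ (Subgroup.zpowers f ⊔ N).comap (MulAut.conj x).toMonoidHom := by
      refine sup_le ?_ ?_
      · rw [Subgroup.zpowers_le]
        exact h x hx
      · intro n hn
        exact Subgroup.mem_sup_right (hN.conj_mem n hn x)
    exact fun n hn => this hn

/-- A convenient repackaging of the relations of a group in `Φ₆`. -/
structure Phi6Data (p : ℕ) {G : Type*} [Group G] (f1 f2 f0 h1 h2 : G) : Prop where
  card : Nat.card G = p ^ 5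
  gen : Subgroup.closure {f1, f2} = (⊤ : Subgroup G)
  c1 : h1 ∈ Subgroup.center G
  c2 : h2 ∈ Subgroup.center G
  q1 : f0 * f1 = f1 * f0 * h1
  q2 : f0 * f2 = f2 * f0 * h2
  q0 : f2 * f1 = f1 * f2 * f0⁻¹
  p0 : f0 ^ p = 1
  p1 : h1 ^ p = 1
  p2 : h2 ^ p = 1
  e1 : ∃ m n : ℤ, f1 ^ p = h1 ^ m * h2 ^ n
  e2 : ∃ m n : ℤ, f2 ^ p = h1 ^ m * h2 ^ n
  cen : ∀ z ∈ Subgroup.center G, ∃ m n : ℤ, z = h1 ^ m * h2 ^ n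
  inj : ∀ m n : ℤ, h1 ^ m * h2 ^ n = 1 → (p : ℤ) ∣ m ∧ (p : ℤ) ∣ n

theorem Phi6Data.swap {p : ℕ} {G : Type*} [Group G] {f1 f2 f0 h1 h2 : G}
    (H : Phi6Data p f1 f2 f0 h1 h2) : Phi6Data p f2 f1 f0⁻¹ h2⁻¹ h1⁻¹ := by
  have key : ∀ m n : ℤ, h1 ^ m * h2 ^ n = h2⁻¹ ^ (-n) * h1⁻¹ ^ (-m) := by
    intro m n
    have : Commute (h1 ^ m) (h2 ^ n) := by
      apply Commute.zpow_zpow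
      exact ((Subgroup.mem_center_iff.1 H.c1 h2)).symm
    simp only [inv_zpow', neg_neg]
    exact this
  refine ⟨H.card, ?_, inv_mem H.c2, inv_mem H.c1, ?_, ?_, ?_, ?_, ?_, ?_, ?_, ?_, ?_, ?_⟩
  · rw [Set.pair_comm]; exact H.gen
  · have h := H.q2
    have hc := Subgroup.mem_center_iff.1 H.c2
    rw [eq_mul_inv_iff_mul_eq, mul_assoc, inv_mul_eq_iff_eq_mul,
      ← mul_assoc, eq_mul_inv_iff_mul_eq, mul_assoc f2, ← hc, ← mul_assoc, h]
  · have h := H.q1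
    have hc := Subgroup.mem_center_iff.1 H.c1
    rw [eq_mul_inv_iff_mul_eq, mul_assoc, inv_mul_eq_iff_eq_mul,
      ← mul_assoc, eq_mul_inv_iff_mul_eq, mul_assoc f1, ← hc, ← mul_assoc, h]
  · rw [inv_inv, H.q0]; group
  · rw [inv_pow, H.p0, inv_one]
  · rw [inv_pow, H.p2, inv_one]
  · rw [inv_pow, H.p1, inv_one]
  · obtain ⟨m, n, h⟩ := H.e2
    exact ⟨-n, -m, h.trans (key m n)⟩
  · obtain ⟨m, n, h⟩ := H.e1
    exact ⟨-n, -m, h.trans (key m n)⟩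
  · intro z hz
    obtain ⟨m, n, h⟩ := H.cen z hz
    exact ⟨-n, -m, h.trans (key m n)⟩
  · intro m n h
    have := H.inj (-n) (-m) (by rw [key]; simpa using h)
    simpa using this.symm

theorem phi6Data_of (p : ℕ) (hp : p.Prime)
    (G₁ : Type) [Group G₁] [Finite G₁] (hcard₁ : Nat.card G₁ = p ^ 5)
    (f1 f2 f0 h1 h2 : G₁)
    (hgen₁ : Subgroup.closure {f1, f2, f0, h1, h2} = ⊤)
    (hcen₁ : Subgroup.closure {h1, h2} = Subgroup.center G₁)
    (r1 : cmt f1 f2 = f0) (r2 : cmt f0 f1 = h1) (r3 : cmt f0 f2 = h2)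
    (r4 : f0 ^ p = 1) (r5 : h1 ^ p = 1) (r6 : h2 ^ p = 1)
    (r7 : f1 ^ p ∈ Subgroup.closure ({h1, h2} : Set G₁))
    (r8 : f2 ^ p ∈ Subgroup.closure ({h1, h2} : Set G₁)) : Phi6Data p f1 f2 f0 h1 h2 := by
  have gen : Subgroup.closure {f1, f2} = (⊤ : Subgroup G₁) := by
    rw [eq_top_iff, ← hgen₁, Subgroup.closure_le]
    have m1 : f1 ∈ Subgroup.closure ({f1, f2} : Set G₁) := Subgroup.subset_closure (by simp)
    have m2 : f2 ∈ Subgroup.closure ({f1, f2} : Set G₁) := Subgroup.subset_closure (by simp)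
    have hc : ∀ x ∈ Subgroup.closure ({f1, f2} : Set G₁), ∀ y ∈ Subgroup.closure ({f1, f2} : Set G₁),
        cmt x y ∈ Subgroup.closure ({f1, f2} : Set G₁) := by
      intro x hx y hy
      exact mul_mem (mul_mem (mul_mem (inv_mem hx) (inv_mem hy)) hx) hy
    have m0 : f0 ∈ Subgroup.closure ({f1, f2} : Set G₁) := r1 ▸ hc _ m1 _ m2
    have n1 : h1 ∈ Subgroup.closure ({f1, f2} : Set G₁) := r2 ▸ hc _ m0 _ m1
    have n2 : h2 ∈ Subgroup.closure ({f1, f2} : Set G₁) := r3 ▸ hc _ m0 _ m2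
    rintro x (rfl | rfl | rfl | rfl | rfl) <;> assumption
  have c1 : h1 ∈ Subgroup.center G₁ := hcen₁ ▸ Subgroup.subset_closure (by simp)
  have c2 : h2 ∈ Subgroup.center G₁ := hcen₁ ▸ Subgroup.subset_closure (by simp)
  have comm12 : h1 * h2 = h2 * h1 := (Subgroup.mem_center_iff.1 c1 h2).symm
  have q1 : f0 * f1 = f1 * f0 * h1 := by rw [← r2]; simp [cmt, mul_assoc]
  have q2 : f0 * f2 = f2 * f0 * h2 := by rw [← r3]; simp [cmt, mul_assoc]
  have q0 : f2 * f1 = f1 * f2 * f0⁻¹ := by rw [← r1]; simp [cmt, mul_assoc]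
  have cen : ∀ z ∈ Subgroup.center G₁, ∃ m n : ℤ, z = h1 ^ m * h2 ^ n := by
    intro z hz
    rw [← hcen₁] at hz
    induction hz using Subgroup.closure_induction with
    | mem x hx =>
      rcases hx with rfl | rfl
      · exact ⟨1, 0, by simp⟩
      · exact ⟨0, 1, by simp⟩
    | one => exact ⟨0, 0, by simp⟩
    | mul x y _ _ hx hy =>
      obtain ⟨m, n, rfl⟩ := hx
      obtain ⟨m', n', rfl⟩ := hy
      refine ⟨m + m', n + n', ?_⟩
      have : Commute (h2 ^ n) (h1 ^ m') := Commute.zpow_zpow comm12.symm _ _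
      rw [zpow_add, zpow_add, mul_assoc, mul_assoc, ← mul_assoc (h2 ^ n), this.eq, mul_assoc]
    | inv x _ hx =>
      obtain ⟨m, n, rfl⟩ := hx
      refine ⟨-m, -n, ?_⟩
      have : Commute (h2 ^ (-n)) (h1 ^ (-m)) := Commute.zpow_zpow comm12.symm _ _
      rw [mul_inv_rev, ← zpow_neg, ← zpow_neg, this.eq]
  have hZ : p ^ 2 ≤ Nat.card (Subgroup.center G₁) := by
    have N1 : (Subgroup.zpowers f0 ⊔ Subgroup.center G₁).Normal := by
      apply normal_zpowers_sup gen
      have hf0 : f0 ∈ Subgroup.zpowers f0 ⊔ Subgroup.center G₁ :=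
        Subgroup.mem_sup_left (Subgroup.mem_zpowers f0)
      have aux : ∀ x h : G₁, h ∈ Subgroup.center G₁ → f0 * x = x * f0 * h →
          x * f0 * x⁻¹ ∈ Subgroup.zpowers f0 ⊔ Subgroup.center G₁ := by
        intro x h hh hx
        have : x * f0 * x⁻¹ = f0 * h⁻¹ := by
          have hc := Subgroup.mem_center_iff.1 (inv_mem hh) x
          have : x * f0 = f0 * x * h⁻¹ := by rw [hx]; group
          rw [this, mul_assoc f0, hc]
          group
        rw [this]
        exact mul_mem hf0 (Subgroup.mem_sup_right (inv_mem hh))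
      rintro x (rfl | rfl)
      · exact aux _ _ c1 q1
      · exact aux _ _ c2 q2
    have N2 : (Subgroup.zpowers f2 ⊔ (Subgroup.zpowers f0 ⊔ Subgroup.center G₁)).Normal := by
      apply normal_zpowers_sup gen
      have hf2 : f2 ∈ Subgroup.zpowers f2 ⊔ (Subgroup.zpowers f0 ⊔ Subgroup.center G₁) :=
        Subgroup.mem_sup_left (Subgroup.mem_zpowers f2)
      have hf0 : f0 ∈ Subgroup.zpowers f0 ⊔ Subgroup.center G₁ :=
        Subgroup.mem_sup_left (Subgroup.mem_zpowers f0)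
      rintro x (rfl | rfl)
      · have : x * f2 * x⁻¹ = f2 * (x * f0 * x⁻¹) := by
          have : x * f2 = f2 * x * f0 := by rw [q0]; group
          rw [this]; group
        rw [this]
        exact mul_mem hf2 (Subgroup.mem_sup_right (N1.conj_mem _ hf0 _))
      · simpa using hf2
    have top : (Subgroup.zpowers f1 ⊔ (Subgroup.zpowers f2 ⊔
        (Subgroup.zpowers f0 ⊔ Subgroup.center G₁))) = ⊤ := by
      rw [eq_top_iff, ← gen, Subgroup.closure_le]
      rintro x (rfl | rfl)
      · exact Subgroup.mem_sup_left (Subgroup.mem_zpowers _)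
      · exact Subgroup.mem_sup_right (Subgroup.mem_sup_left (Subgroup.mem_zpowers _))
    have b1 := card_zpowers_sup_le (Subgroup.center G₁) f0 p hp.pos (by rw [r4]; exact one_mem _)
    have b2 := card_zpowers_sup_le (Subgroup.zpowers f0 ⊔ Subgroup.center G₁) f2 p hp.pos
      (Subgroup.mem_sup_right (hcen₁ ▸ r8))
    have b3 := card_zpowers_sup_le (Subgroup.zpowers f2 ⊔ (Subgroup.zpowers f0 ⊔
      Subgroup.center G₁)) f1 p hp.pos
      (Subgroup.mem_sup_right (Subgroup.mem_sup_right (hcen₁ ▸ r7)))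
    rw [top, Subgroup.card_top, hcard₁] at b3
    have b4 : p ^ 5 ≤ p ^ 3 * Nat.card (Subgroup.center G₁) := by
      calc p ^ 5 ≤ p * (p * (p * Nat.card (Subgroup.center G₁))) :=
            b3.trans (Nat.mul_le_mul_left p (b2.trans (Nat.mul_le_mul_left p b1)))
        _ = _ := by ring
    have : p ^ 3 * p ^ 2 ≤ p ^ 3 * Nat.card (Subgroup.center G₁) := by
      rwa [← pow_add]
    exact Nat.le_of_mul_le_mul_left this (pow_pos hp.pos 3)
  have red : ∀ h : G₁, h ^ p = 1 → ∀ m : ℤ, ∃ i : Fin p, h ^ (i : ℕ) = h ^ m ∧ ((i : ℕ) : ℤ) = m % p := by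
    intro h hh m
    have hp' : (0 : ℤ) < p := by exact_mod_cast hp.pos
    have h0 := Int.emod_nonneg m hp'.ne'
    have h1 := Int.emod_lt_of_pos m hp'
    refine ⟨⟨(m % p).toNat, by omega⟩, ?_, by simp [h0]⟩
    simp only
    rw [← zpow_natCast, Int.toNat_of_nonneg h0]
    conv_rhs => rw [← Int.emod_add_mul_ediv m p]
    rw [zpow_add, zpow_mul, zpow_natCast, hh, one_zpow, mul_one]
  have inj : ∀ m n : ℤ, h1 ^ m * h2 ^ n = 1 → (p : ℤ) ∣ m ∧ (p : ℤ) ∣ n := by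
    let φ : Fin p × Fin p → Subgroup.center G₁ := fun x =>
      ⟨h1 ^ (x.1 : ℕ) * h2 ^ (x.2 : ℕ), mul_mem (pow_mem c1 _) (pow_mem c2 _)⟩
    have hφ : Function.Surjective φ := by
      rintro ⟨z, hz⟩
      obtain ⟨m, n, rfl⟩ := cen z hz
      obtain ⟨i, hi, -⟩ := red h1 r5 m
      obtain ⟨j, hj, -⟩ := red h2 r6 n
      refine ⟨(i, j), ?_⟩
      ext
      simp [φ, hi, hj]
    have hb : Function.Bijective φ := by
      apply hφ.bijective_of_nat_card_le
      simpa [sq] using hZ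
    intro m n h
    obtain ⟨i, hi, hi'⟩ := red h1 r5 m
    obtain ⟨j, hj, hj'⟩ := red h2 r6 n
    have : φ (i, j) = φ (⟨0, hp.pos⟩, ⟨0, hp.pos⟩) := by
      ext
      simp [φ, hi, hj, h]
    have := hb.1 this
    simp only [Prod.mk.injEq, Fin.ext_iff] at this
    rw [this.1] at hi'
    rw [this.2] at hj'
    exact ⟨Int.dvd_of_emod_eq_zero hi'.symm, Int.dvd_of_emod_eq_zero hj'.symm⟩
  exact ⟨hcard₁, gen, c1, c2, q1, q2, q0, r4, r5, r6, cen _ (hcen₁ ▸ r7), cen _ (hcen₁ ▸ r8),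
    cen, inj⟩


/-- the scalars by which `f2` acts -/
def ccoef {k : Type*} [Field k] (ζ : k) {p : ℕ} (i : ZMod p) : k := ζ⁻¹ ^ (i.val.choose 2)

theorem zpow_smul_eig {k F G : Type*} [Field k] [Field F] [Algebra k F] [Group G]
    [MulSemiringAction G F] [SMulCommClass G k F] (d : G) (ζ : k) (hζ : ζ ≠ 0) (v : F)
    (h : d • v = ζ • v) (m : ℤ) : d ^ m • v = ζ ^ m • v := by
  have hpow : ∀ n : ℕ, d ^ n • v = ζ ^ n • v := by
    intro n
    induction n with
    | zero => simp
    | succ n ih => rw [pow_succ, mul_smul, h, smul_comm, ih, smul_smul, ← pow_succ']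
  obtain ⟨n, rfl | rfl⟩ := m.eq_nat_or_neg
  · simpa using hpow n
  · rw [zpow_neg, zpow_neg, zpow_natCast, zpow_natCast, inv_smul_eq_iff, smul_comm, hpow,
      smul_smul, inv_mul_cancel₀ (pow_ne_zero _ hζ), one_smul]

theorem exists_V {k F G : Type*} [Field k] [IsAlgClosed k] [Field F] [Algebra k F] [Group G]
    [MulSemiringAction G F] [SMulCommClass G k F] {p : ℕ} (hp : p.Prime) (ζ : k)
    (hζ : IsPrimitiveRoot ζ p) {f1 f2 f0 h1 h2 : G} (H : Phi6Data p f1 f2 f0 h1 h2)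
    (V : Submodule k F) [FiniteDimensional k V] (hV : ∀ g : G, ∀ v ∈ V, g • v ∈ V)
    (u : F) (huV : u ∈ V) (hu0 : u ≠ 0) (hu1 : h1 • u = ζ • u) (hu2 : h2 • u = u) :
    ∃ (v : ZMod p → F) (θ η : k), θ ≠ 0 ∧ η ≠ 0 ∧ (∀ i, v i ∈ V) ∧ (∀ i, v i ≠ 0) ∧
      (∀ i, h1 • v i = ζ • v i) ∧ (∀ i, h2 • v i = v i) ∧
      (∀ i, f0 • v i = ζ ^ i.val • v i) ∧
      (∀ i, f1 • v i = θ • v (i + 1)) ∧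
      (∀ i, f2 • v i = η • ccoef ζ i • v i) := by
  have : NeZero p := ⟨hp.ne_zero⟩
  have hζ0 : ζ ≠ 0 := hζ.ne_zero hp.ne_zero
  have hsm0 : ∀ (g : G) (v : F), v ≠ 0 → g • v ≠ 0 := fun g v hv => by
    rwa [Ne, smul_eq_zero_iff_eq]
  have cc1 : ∀ g, g * h1 = h1 * g := Subgroup.mem_center_iff.1 H.c1
  have cc2 : ∀ g, g * h2 = h2 * g := Subgroup.mem_center_iff.1 H.c2
  -- general: eigenvectors inside stable subspaces
  have eig : ∀ (W : Submodule k F), W ≤ V → ∀ w ∈ W, w ≠ 0 → ∀ g : G, (∀ x ∈ W, g • x ∈ W) →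
      ∃ (μ : k) (x : F), x ∈ W ∧ x ≠ 0 ∧ g • x = μ • x := by
    intro W hWV w hw hw0 g hg
    have : FiniteDimensional k W := Submodule.finiteDimensional_of_le hWV
    have : Nontrivial W := ⟨⟨⟨w, hw⟩, 0, fun h => hw0 (congrArg Subtype.val h)⟩⟩
    obtain ⟨μ, hμ⟩ := Module.End.exists_eigenvalue
      ((DistribSMul.toLinearMap k F g).restrict (p := W) (q := W) hg)
    obtain ⟨x, hx⟩ := hμ.exists_hasEigenvector
    refine ⟨μ, x, x.2, fun h => hx.2 (Subtype.ext h), ?_⟩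
    exact congrArg Subtype.val hx.apply_eq_smul
  let E : G → k → Submodule k F := fun g μ =>
    { carrier := {x | g • x = μ • x}
      add_mem' := by intro a b ha hb; simp only [Set.mem_ofPred_eq] at *; rw [smul_add, ha, hb, smul_add]
      zero_mem' := by simp
      smul_mem' := by
        intro c x hx; simp only [Set.mem_ofPred_eq] at *; rw [smul_comm, hx, smul_comm] }
  have hE : ∀ g μ x, x ∈ E g μ ↔ g • x = μ • x := fun _ _ _ => Iff.rfl
  let W1 : Submodule k F := V ⊓ (E h1 ζ ⊓ E h2 1)
  have hW1 : ∀ x, x ∈ W1 ↔ x ∈ V ∧ h1 • x = ζ • x ∧ h2 • x = x := by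
    intro x; simp [W1, hE]
  have stW1 : ∀ g : G, ∀ x ∈ W1, g • x ∈ W1 := by
    intro g x hx
    rw [hW1] at hx ⊢
    refine ⟨hV g x hx.1, ?_, ?_⟩
    · rw [← mul_smul, ← cc1, mul_smul, hx.2.1, smul_comm]
    · rw [← mul_smul, ← cc2, mul_smul, hx.2.2]
  have hf0f1 : ∀ x ∈ W1, ∀ μ : k, f0 • x = μ • x → f0 • (f1 • x) = (ζ * μ) • (f1 • x) := by
    intro x hx μ hμ
    rw [← mul_smul, H.q1, mul_smul, mul_smul, ((hW1 x).1 hx).2.1, smul_comm f0 ζ, hμ, smul_smul,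
      smul_comm]
  obtain ⟨μ, x, hxW, hx0, hxμ⟩ := eig W1 inf_le_left u ((hW1 u).2 ⟨huV, hu1, hu2⟩) hu0 f0 (stW1 f0)
  have hμp : μ ^ p = 1 := by
    have hpow : ∀ n : ℕ, f0 ^ n • x = μ ^ n • x := by
      intro n
      induction n with
      | zero => simp
      | succ n ih => rw [pow_succ, mul_smul, hxμ, smul_comm, ih, smul_smul, ← pow_succ']
    have := hpow p
    rw [H.p0, one_smul] at this
    have h2 : (μ ^ p - 1) • x = 0 := by rw [sub_smul, one_smul, ← this, sub_self]
    exact sub_eq_zero.1 ((smul_eq_zero.1 h2).resolve_right hx0)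
  have hμ0 : μ ≠ 0 := by rintro rfl; simp [hp.ne_zero] at hμp
  obtain ⟨j, -, hj⟩ := hζ.eq_pow_of_pow_eq_one (ξ := μ⁻¹) (by rw [inv_pow, hμp, inv_one])
  have hx' : ∀ n : ℕ, f1 ^ n • x ∈ W1 ∧ f0 • (f1 ^ n • x) = (ζ ^ n * μ) • (f1 ^ n • x) := by
    intro n
    induction n with
    | zero => simp [hxW, hxμ]
    | succ n ih =>
      have := hf0f1 _ ih.1 _ ih.2
      rw [← mul_smul f1, ← pow_succ', ← mul_assoc, ← pow_succ'] at this
      exact ⟨stW1 _ _ hxW, this⟩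
  let W2 : Submodule k F := W1 ⊓ E f0 1
  have hW2 : ∀ x, x ∈ W2 ↔ x ∈ W1 ∧ f0 • x = x := by
    intro x; simp only [W2, Submodule.mem_inf, hE, one_smul]
  have hxW2 : f1 ^ j • x ∈ W2 := by
    rw [hW2]
    refine ⟨(hx' j).1, ?_⟩
    rw [(hx' j).2, hj, inv_mul_cancel₀ hμ0, one_smul]
  have stW2 : ∀ x ∈ W2, f2 • x ∈ W2 := by
    intro x hx
    rw [hW2] at hx ⊢
    refine ⟨stW1 _ _ hx.1, ?_⟩
    rw [← mul_smul, H.q2, mul_smul, mul_smul, ((hW1 x).1 hx.1).2.2, hx.2]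
  obtain ⟨η, y, hyW, hy0, hyη⟩ := eig W2 (inf_le_left.trans inf_le_left) _ hxW2
    (hsm0 _ _ hx0) f2 stW2
  obtain ⟨hyW1, hyf0⟩ := (hW2 y).1 hyW
  obtain ⟨hyV, hyh1, hyh2⟩ := (hW1 y).1 hyW1
  have hη0 : η ≠ 0 := by
    rintro rfl
    exact hsm0 f2 y hy0 (by rw [hyη, zero_smul])
  obtain ⟨m, n, hmn⟩ := H.e1
  obtain ⟨θ, hθ⟩ := IsAlgClosed.exists_pow_nat_eq (ζ ^ m) hp.pos
  have hθ0 : θ ≠ 0 := by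
    rintro rfl
    rw [zero_pow hp.ne_zero] at hθ
    exact zpow_ne_zero m hζ0 hθ.symm
  have hper : f1 ^ p • y = θ ^ p • y := by
    rw [hmn, mul_smul, zpow_smul_eig h2 (1 : k) one_ne_zero y (by rw [one_smul, hyh2]), one_zpow,
      one_smul, zpow_smul_eig h1 ζ hζ0 y hyh1, hθ]
  let w : ℕ → F := fun n => θ⁻¹ ^ n • (f1 ^ n • y)
  have hwper : Function.Periodic w p := by
    intro n
    simp only [w]
    rw [pow_add f1, mul_smul, hper, smul_comm (f1 ^ n), smul_smul, pow_add, mul_assoc, ← mul_pow,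
      inv_mul_cancel₀ hθ0, one_pow, mul_one]
  have hwW : ∀ n, w n ∈ W1 := fun n => W1.smul_mem _ (stW1 _ _ hyW1)
  have hws : ∀ n, f1 • w n = θ • w (n + 1) := by
    intro n
    simp only [w]
    rw [smul_comm f1, ← mul_smul, ← pow_succ', smul_smul]
    congr 1
    rw [pow_succ']
    field_simp
  have hws' : ∀ n, w (n + 1) = θ⁻¹ • f1 • w n := by
    intro n
    rw [hws, smul_smul, inv_mul_cancel₀ hθ0, one_smul]
  have hw0 : ∀ n, f0 • w n = ζ ^ n • w n := by
    intro n
    induction n with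
    | zero => simp [w, hyf0]
    | succ n ih =>
      rw [hws', smul_comm f0, hf0f1 _ (hwW n) _ ih, ← pow_succ', smul_comm]
  have hw0' : ∀ n, f0⁻¹ • w n = ζ⁻¹ ^ n • w n := by
    intro n
    rw [inv_smul_eq_iff, smul_comm, hw0, smul_smul, ← mul_pow, inv_mul_cancel₀ hζ0, one_pow,
      one_smul]
  have hw2 : ∀ n, f2 • w n = η • ζ⁻¹ ^ (n.choose 2) • w n := by
    intro n
    induction n with
    | zero => simp [w, hyη]
    | succ n ih =>
      rw [hws', smul_comm f2, ← mul_smul, H.q0, mul_smul, mul_smul, hw0', smul_comm f2, ih,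
        Nat.choose_succ_succ' n 1, Nat.choose_one_right, pow_add]
      simp only [smul_comm f1, smul_smul]
      congr 1
      ring
  have hwv : ∀ n : ℕ, w ((n : ZMod p)).val = w n := by
    intro n
    rw [ZMod.val_natCast, hwper.map_mod_nat]
  refine ⟨fun i => w i.val, θ, η, hθ0, hη0, fun i => ((hW1 _).1 (hwW _)).1, ?_,
    fun i => ((hW1 _).1 (hwW _)).2.1, fun i => ((hW1 _).1 (hwW _)).2.2, fun i => hw0 _, ?_,
    fun i => hw2 _⟩
  · intro i
    exact smul_ne_zero (pow_ne_zero _ (inv_ne_zero hθ0)) (hsm0 _ _ hy0)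
  · intro i
    simp only
    rw [hws, ← hwv (i.val + 1)]
    congr 3
    simp


theorem exists_u {k F G : Type*} [Field k] [Field F] [Algebra k F] [Group G]
    [MulSemiringAction G F] [SMulCommClass G k F] {p : ℕ} (hp : p.Prime) (ζ : k)
    (hζ : IsPrimitiveRoot ζ p) {f1 f2 f0 h1 h2 : G} (H : Phi6Data p f1 f2 f0 h1 h2)
    (x : G → F) (hli : LinearIndependent k x) (hact : ∀ h g : G, h • x g = x (h * g)) :
    ∃ u ∈ Submodule.span k (Set.range x), u ≠ 0 ∧ h1 • u = ζ • u ∧ h2 • u = u := by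
  have hζ0 : ζ ≠ 0 := hζ.ne_zero hp.ne_zero
  have hcyc : ∀ f : ℕ → F, f p = f 0 →
      ∑ j ∈ Finset.range p, f (j + 1) = ∑ j ∈ Finset.range p, f j := by
    intro f hf
    have h1 := Finset.sum_range_succ' f p
    rw [Finset.sum_range_succ, hf] at h1
    exact (add_right_cancel h1).symm
  let φ : Fin p × Fin p → G := fun a => h1 ^ (a.1 : ℕ) * h2 ^ (a.2 : ℕ)
  have comm12 : Commute h1 h2 := (Subgroup.mem_center_iff.1 H.c1 h2).symm
  have hφ : Function.Injective φ := by
    rintro ⟨i, j⟩ ⟨i', j'⟩ h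
    simp only [φ] at h
    have h3 : h1 ^ ((i : ℤ) - (i' : ℤ)) * h2 ^ ((j : ℤ) - (j' : ℤ)) = 1 := by
      rw [zpow_sub, zpow_sub, zpow_natCast, zpow_natCast, zpow_natCast, zpow_natCast]
      have hc : Commute ((h1 ^ (i' : ℕ))⁻¹) (h2 ^ (j : ℕ)) := (comm12.pow_pow _ _).inv_left
      rw [mul_assoc, ← mul_assoc _ (h2 ^ (j : ℕ)), hc.eq, ← mul_assoc, ← mul_assoc, h]
      have hc : Commute ((h1 ^ (i' : ℕ))⁻¹) (h2 ^ (j' : ℕ)) := (comm12.pow_pow _ _).inv_left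
      rw [mul_assoc (h1 ^ (i' : ℕ)), ← hc.eq]
      simp
    obtain ⟨⟨a, ha⟩, ⟨b, hb⟩⟩ := H.inj _ _ h3
    have := i.2; have := i'.2; have := j.2; have := j'.2
    have hlt : ∀ (r r' : ℕ) (c : ℤ), r < p → r' < p → (r : ℤ) - r' = p * c → r = r' := by
      intro r r' c hr hr' h
      have : (r : ℤ) ≡ r' [ZMOD p] := (Int.modEq_iff_dvd.2 ⟨c, h⟩).symm
      have := (Int.natCast_modEq_iff).1 this
      exact Nat.ModEq.eq_of_lt_of_lt this hr hr'
    ext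
    · exact hlt _ _ a i.2 i'.2 ha
    · exact hlt _ _ b j.2 j'.2 hb
  let u : F := ∑ a : Fin p × Fin p, ζ⁻¹ ^ (a.1 : ℕ) • x (φ a)
  have hu : u = ∑ i ∈ Finset.range p, ∑ j ∈ Finset.range p, ζ⁻¹ ^ i • x (h1 ^ i * h2 ^ j) := by
    simp only [u, φ]
    rw [Fintype.sum_prod_type, ← Fin.sum_univ_eq_sum_range
      (fun i => ∑ j ∈ Finset.range p, ζ⁻¹ ^ i • x (h1 ^ i * h2 ^ j))]
    refine Finset.sum_congr rfl fun i _ => ?_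
    rw [← Fin.sum_univ_eq_sum_range (fun j => ζ⁻¹ ^ (i : ℕ) • x (h1 ^ (i : ℕ) * h2 ^ j))]
  refine ⟨u, ?_, ?_, ?_, ?_⟩
  · exact Submodule.sum_mem _ fun a _ => Submodule.smul_mem _ _ (Submodule.subset_span ⟨_, rfl⟩)
  · intro h0
    have := Fintype.linearIndependent_iff.1 (hli.comp φ hφ) (fun a => ζ⁻¹ ^ (a.1 : ℕ)) h0
      (⟨0, hp.pos⟩, ⟨0, hp.pos⟩)
    simp at this
  · rw [hu, Finset.smul_sum, ← hcyc (fun i => ∑ j ∈ Finset.range p, ζ⁻¹ ^ i • x (h1 ^ i * h2 ^ j)),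
      Finset.smul_sum]
    · refine Finset.sum_congr rfl fun i _ => ?_
      rw [Finset.smul_sum, Finset.smul_sum]
      refine Finset.sum_congr rfl fun j _ => ?_
      rw [smul_comm, hact, smul_smul, pow_succ', mul_inv_cancel_left₀ hζ0, ← mul_assoc, ← pow_succ']
    · simp [H.p1, hζ.pow_eq_one]
  · rw [hu, Finset.smul_sum]
    refine Finset.sum_congr rfl fun i _ => ?_
    rw [Finset.smul_sum]
    refine Eq.trans ?_ (hcyc (fun j => ζ⁻¹ ^ i • x (h1 ^ i * h2 ^ j)) ?_)
    · refine Finset.sum_congr rfl fun j _ => ?_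
      rw [smul_comm, hact, ← mul_assoc, ← (comm12.pow_left i).eq, mul_assoc, ← pow_succ']
    · simp [H.p2]

theorem linInd_V {k F G : Type*} [Field k] [Field F] [Algebra k F] [Group G]
    [MulSemiringAction G F] [SMulCommClass G k F] {p : ℕ} (hp : p.Prime) (ζ : k)
    (hζ : IsPrimitiveRoot ζ p) (f0 : G) (v : ZMod p → F) (hv : ∀ i, v i ≠ 0)
    (h : ∀ i, f0 • v i = ζ ^ i.val • v i) : LinearIndependent k v := by
  have : NeZero p := ⟨hp.ne_zero⟩
  refine Module.End.eigenvectors_linearIndependent' (DistribSMul.toLinearMap k F f0)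
    (fun i : ZMod p => ζ ^ i.val) ?_ v ?_
  · intro i j hij
    exact ZMod.val_injective p (hζ.pow_inj (ZMod.val_lt i) (ZMod.val_lt j) hij)
  · intro i
    rw [Module.End.hasEigenvector_iff, Module.End.mem_eigenspace_iff]
    exact ⟨h i, hv i⟩

theorem exists_s {k F G : Type} [Field k] [Field F] [Algebra k F] [Group G] [Fintype G]
    [MulSemiringAction G F] [SMulCommClass G k F] (x : G → F) (hli : LinearIndependent k x)
    (hact : ∀ h g : G, h • x g = x (h * g)) (hcard : (Nat.card G : F) ≠ 0)
    (L : IntermediateField k F) (hst : ∀ g : G, ∀ a ∈ L, g • a ∈ L)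
    (hfaith : ∀ g : G, (∀ a ∈ L, g • a = a) → g = 1)
    (W : Submodule k F) (hWV : W ≤ Submodule.span k (Set.range x)) (hWL : ∀ w ∈ W, w ∈ L)
    (w₀ : F) (hw₀ : w₀ ∈ W) (hw₀0 : w₀ ≠ 0) (n : ℕ) (hn : Module.finrank k W + n = Nat.card G) :
    ∃ s : Fin n → F, (∀ i, ∀ g : G, g • s i = s i) ∧
      ∀ g, x g ∈ IntermediateField.adjoin k ((L : Set F) ∪ Set.range s) := by
  classical
  let V := Submodule.span k (Set.range x)
  have hVfd : FiniteDimensional k V := FiniteDimensional.span_of_finite k (Set.finite_range x)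
  have hVr : Module.finrank k V = Nat.card G := by
    rw [finrank_span_eq_card hli, Nat.card_eq_fintype_card]
  obtain ⟨C, hC⟩ := Submodule.exists_isCompl (W.comap V.subtype)
  have hCr : Module.finrank k C = n := by
    have h1 := Submodule.finrank_add_eq_of_isCompl hC
    have h2 : Module.finrank k (W.comap V.subtype) = Module.finrank k W :=
      LinearEquiv.finrank_eq (Submodule.comapSubtypeEquivOfLe hWV)
    omega
  have hfree : Module.Free k C := Module.Free.of_divisionRing k C
  have hfin : Module.Finite k C := FiniteDimensional.finiteDimensional_submodule C
  let b := Module.finBasisOfFinrankEq k C hCr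
  let bF : Fin n → F := fun i => ((b i : V) : F)
  let S : Set F := insert 1 (Set.range bF)
  have hkL : ∀ (T : Set F) (y : F), y ∈ Submodule.span k T → y ∈ Submodule.span L T := by
    intro T y hy
    exact Submodule.span_le_restrictScalars k L T hy
  have hxS : ∀ g, x g ∈ Submodule.span L S := by
    intro g
    have hxV : x g ∈ V := Submodule.subset_span ⟨g, rfl⟩
    obtain ⟨w, c, hw, hc, hwc⟩ := Submodule.codisjoint_iff_exists_add_eq.1 hC.codisjoint ⟨x g, hxV⟩
    have : x g = (w : F) + (c : F) := (congrArg Subtype.val hwc).symm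
    rw [this]
    refine Submodule.add_mem _ ?_ ?_
    · have hwL : (w : F) ∈ L := hWL _ hw
      have : (w : F) = (⟨w, hwL⟩ : L) • (1 : F) := by
        rw [IntermediateField.smul_def]; simp
      rw [this]
      exact Submodule.smul_mem _ _ (Submodule.subset_span (Set.mem_insert _ _))
    · apply hkL
      have hs : ((⟨c, hc⟩ : C) : V) = ∑ i, (b.repr ⟨c, hc⟩ i) • (b i : V) := by
        have := congrArg Subtype.val (b.sum_repr ⟨c, hc⟩).symm
        rw [Submodule.coe_sum] at this
        exact this
      have hs' : (c : F) = ∑ i, (b.repr ⟨c, hc⟩ i) • bF i := by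
        have := congrArg Subtype.val hs
        simpa [bF] using this
      rw [hs']
      exact Submodule.sum_mem _ fun i _ => Submodule.smul_mem _ _
        (Submodule.subset_span (Set.mem_insert_of_mem _ ⟨i, rfl⟩))
  let U : Submodule L F := Submodule.span L (Set.range x)
  have hUS : U ≤ Submodule.span L S := by
    rw [Submodule.span_le]
    rintro _ ⟨g, rfl⟩
    exact hxS g
  let D : Set F := {y | y ∈ U ∧ ∀ g : G, g • y = y}
  have h1D : (1 : F) ∈ D := by
    refine ⟨?_, fun g => smul_one g⟩
    have h1 : w₀ ∈ U := hkL _ _ (hWV hw₀)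
    have : (1 : F) = (⟨w₀, hWL _ hw₀⟩ : L)⁻¹ • w₀ := by
      rw [IntermediateField.smul_def]; simp [hw₀0]
    rw [this]
    exact Submodule.smul_mem _ _ h1
  have hxD : ∀ g, x g ∈ Submodule.span L D := by
    intro g
    refine Submodule.span_mono ?_ (speiser_aux L hcard hst (x g) (fun g' hg' => by
      rw [hfaith g' hg', one_smul]))
    rintro _ ⟨a, ha, rfl⟩
    refine ⟨Submodule.sum_mem _ fun h _ => ?_, fun h => ?_⟩
    · rw [smul_mul', hact]
      have : (h • a) * x (h * g) = (⟨h • a, hst h a ha⟩ : L) • x (h * g) := by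
        rw [IntermediateField.smul_def]; simp
      rw [this]
      exact Submodule.smul_mem _ _ (Submodule.subset_span ⟨_, rfl⟩)
    · rw [Finset.smul_sum]
      simp_rw [← mul_smul]
      exact Fintype.sum_equiv (Equiv.mulLeft h) _ _ (fun _ => rfl)
  obtain ⟨B, hBD, h1B, hDB, hBli⟩ := exists_linearIndepOn_extension (K := L) (v := (id : F → F))
    (s := {1}) (t := D) (LinearIndepOn.singleton one_ne_zero) (by simpa using h1D)
  simp only [Set.image_id] at hDB
  have hSfin : S.Finite := (Set.finite_range bF).insert 1
  have : Fintype S := hSfin.fintype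
  have hBc : Cardinal.mk B ≤ Fintype.card S := by
    refine linearIndependent_le_span' (fun b : B => (id b : F)) hBli S ?_
    rintro _ ⟨y, rfl⟩
    exact hUS (hBD y.2).1
  have hSc : Fintype.card S ≤ n + 1 := by
    rw [← Nat.card_eq_fintype_card]
    have h1 : S.ncard ≤ (Set.range bF).ncard + 1 := Set.ncard_insert_le _ _
    have h2 : (Set.range bF).ncard ≤ n := by
      have := Finite.card_range_le bF
      rw [Nat.card_fin] at this
      exact this
    exact h1.trans (by omega)
  have hBfin : B.Finite := by
    rw [← Cardinal.lt_aleph0_iff_set_finite]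
    exact lt_of_le_of_lt hBc (Cardinal.natCast_lt_aleph0)
  let B' : Finset F := hBfin.toFinset.erase 1
  have hB' : B'.card ≤ n := by
    rw [Finset.card_erase_of_mem (by simpa using h1B)]
    have : hBfin.toFinset.card ≤ n + 1 := by
      have h3 : Nat.card B ≤ Fintype.card S := by
        have := Cardinal.toNat_le_toNat hBc Cardinal.natCast_lt_aleph0
        rw [Cardinal.toNat_natCast] at this
        exact this
      rw [← Set.ncard_eq_toFinset_card B hBfin]
      exact h3.trans hSc
    omega
  let s : Fin n → F := fun i =>
    if h : (i : ℕ) < B'.card then ((B'.equivFin.symm ⟨i, h⟩ : B') : F) else 1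
  have hB's : ∀ y ∈ B', ∃ i, s i = y := by
    intro y hy
    refine ⟨⟨B'.equivFin ⟨y, hy⟩, lt_of_lt_of_le (B'.equivFin ⟨y, hy⟩).2 hB'⟩, ?_⟩
    simp [s]
  refine ⟨s, ?_, ?_⟩
  · intro i g
    by_cases h : (i : ℕ) < B'.card
    · simp only [s, h, dif_pos]
      have := (B'.equivFin.symm ⟨i, h⟩ : B').2
      have h2 : ((B'.equivFin.symm ⟨i, h⟩ : B') : F) ∈ B := by
        simpa using (Finset.mem_erase.1 this).2
      exact (hBD h2).2 g
    · simp [s, h]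
  · intro g
    have h1 : x g ∈ Submodule.span L B := by
      have : Submodule.span L D ≤ Submodule.span L B := Submodule.span_le.2 hDB
      exact this (hxD g)
    refine Submodule.span_induction (p := fun y _ => y ∈
      IntermediateField.adjoin k ((L : Set F) ∪ Set.range s)) ?_ (zero_mem _) ?_ ?_ h1
    · intro y hy
      by_cases hy1 : y = 1
      · rw [hy1]; exact one_mem _
      · obtain ⟨i, hi⟩ := hB's y (Finset.mem_erase.2 ⟨hy1, by simpa using hy⟩)
        exact IntermediateField.subset_adjoin _ _ (Or.inr ⟨i, hi⟩)
    · intro y z _ _ hy hz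
      exact add_mem hy hz
    · intro a y _ hy
      rw [IntermediateField.smul_def, smul_eq_mul]
      exact mul_mem (IntermediateField.subset_adjoin _ _ (Or.inl a.2)) hy

theorem exists_z {k F G : Type*} [Field k] [Field F] [Algebra k F] [Group G] [Fintype G]
    [MulSemiringAction G F] (K : IntermediateField k F)
    (hcard : (Nat.card G : F) ≠ 0) (hst : ∀ g : G, ∀ a ∈ K, g • a ∈ K) (Y : F) (hY : Y ≠ 0)
    (hcoc : ∀ g : G, (g • Y) / Y ∈ K)
    (hN : ∀ g : G, (∀ a ∈ K, g • a = a) → g • Y = Y) :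
    ∃ z : F, z ≠ 0 ∧ (∀ g : G, g • z = z) ∧ z / Y ∈ K := by
  classical
  have h := speiser_aux K hcard hst Y hN
  by_contra hne
  push Not at hne
  have : Submodule.span K {w : F | ∃ a ∈ K, w = ∑ g : G, g • (a * Y)} ≤ ⊥ := by
    rw [Submodule.span_le]
    rintro w ⟨a, ha, hw⟩
    by_contra hw0
    refine hne w hw0 ?_ ?_
    · intro h
      rw [hw, Finset.smul_sum]
      simp_rw [← mul_smul]
      exact Fintype.sum_equiv (Equiv.mulLeft h) _ _ (fun _ => rfl)
    · rw [hw, Finset.sum_div]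
      refine sum_mem fun g _ => ?_
      rw [smul_mul', mul_div_assoc]
      exact mul_mem (hst g a ha) (hcoc g)
  exact hY (by simpa using this h)

theorem scalar_of_fix {k F G : Type*} [Field k] [IsAlgClosed k] [Field F] [Algebra k F] [Group G]
    [Finite G] [MulSemiringAction G F] (g : G) (y : F) (hy : y ≠ 0)
    (hc : g • ((g • y) / y) = (g • y) / y) : ∃ c : k, g • y = c • y := by
  set c := (g • y) / y with hcdef
  have hgy : g • y = c * y := by rw [hcdef]; field_simp
  have hpow : ∀ n : ℕ, g ^ n • y = c ^ n * y := by
    intro n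
    induction n with
    | zero => simp
    | succ n ih =>
      rw [pow_succ', mul_smul, ih, smul_mul', smul_pow', hc, hgy]; ring
  have h1 := hpow (Nat.card G)
  rw [pow_card_eq_one', one_smul] at h1
  have h2 : c ^ Nat.card G = 1 := by
    have : (c ^ Nat.card G - 1) * y = 0 := by rw [sub_mul, ← h1]; ring
    exact sub_eq_zero.1 ((mul_eq_zero.1 this).resolve_right hy)
  have hintg : IsIntegral k c := by
    refine ⟨Polynomial.X ^ Nat.card G - Polynomial.C 1,
      Polynomial.monic_X_pow_sub_C _ Nat.card_pos.ne', ?_⟩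
    simp [h2]
  obtain ⟨c0, hc0⟩ := hintg.mem_range_algebraMap_of_minpoly_splits (K := k) (IsAlgClosed.splits _)
  refine ⟨c0, ?_⟩
  rw [hgy, Algebra.smul_def, hc0]

theorem normal_inf_center {G : Type*} [Group G] [Finite G] {p n : ℕ} (hp : p.Prime)
    (hG : Nat.card G = p ^ n) (N : Subgroup G) [hN : N.Normal]
    (h : ∀ z ∈ N, z ∈ Subgroup.center G → z = 1) : N = ⊥ := by
  have : Fact p.Prime := ⟨hp⟩
  by_contra hne
  have hpG : IsPGroup p (ConjAct G) := IsPGroup.of_card (n := n) hG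
  have hdvd : p ∣ Nat.card N := by
    obtain ⟨m, hm, hm'⟩ := (Nat.dvd_prime_pow hp).1 (hG ▸ N.card_subgroup_dvd_card)
    rw [hm']
    refine dvd_pow_self p ?_
    rintro rfl
    exact hne (Subgroup.card_eq_one.1 (by simpa using hm'))
  obtain ⟨b, hb, hb1⟩ := hpG.exists_fixed_point_of_prime_dvd_card_of_fixed_point N hdvd (a := 1)
    (by intro g; ext; simp [ConjAct.Subgroup.val_conj_smul, ConjAct.smul_def])
  apply hb1
  ext
  rw [h b b.2]
  · rfl
  · rw [Subgroup.mem_center_iff]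
    intro g
    have := congrArg Subtype.val (hb (ConjAct.toConjAct g))
    rw [ConjAct.Subgroup.val_conj_smul, ConjAct.toConjAct_smul, mul_inv_eq_iff_eq_mul] at this
    exact this


/-- a basis adapted to an irreducible `p`-dimensional summand -/
structure IsV {k F G : Type*} [Field k] [Field F] [Algebra k F] [Group G]
    [MulSemiringAction G F] (p : ℕ) (ζ : k) (f1 f2 f0 h1 h2 : G) (V : Submodule k F)
    (v : ZMod p → F) (θ η : k) : Prop where
  hθ : θ ≠ 0
  hη : η ≠ 0
  mem : ∀ i, v i ∈ V
  ne : ∀ i, v i ≠ 0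
  a1 : ∀ i, h1 • v i = ζ • v i
  a2 : ∀ i, h2 • v i = v i
  b0 : ∀ i, f0 • v i = ζ ^ i.val • v i
  b1 : ∀ i, f1 • v i = θ • v (i + 1)
  b2 : ∀ i, f2 • v i = η • ccoef ζ i • v i

theorem exists_isV {k F G : Type*} [Field k] [IsAlgClosed k] [Field F] [Algebra k F] [Group G]
    [Finite G] [MulSemiringAction G F] [SMulCommClass G k F] {p : ℕ} (hp : p.Prime) (ζ : k)
    (hζ : IsPrimitiveRoot ζ p) {f1 f2 f0 h1 h2 : G} (H : Phi6Data p f1 f2 f0 h1 h2)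
    (x : G → F) (hli : LinearIndependent k x) (hact : ∀ h g : G, h • x g = x (h * g)) :
    ∃ (v : ZMod p → F) (θ η : k),
      IsV p ζ f1 f2 f0 h1 h2 (Submodule.span k (Set.range x)) v θ η := by
  obtain ⟨u, huV, hu0, hu1, hu2⟩ := exists_u hp ζ hζ H x hli hact
  have : FiniteDimensional k (Submodule.span k (Set.range x)) :=
    FiniteDimensional.span_of_finite k (Set.finite_range x)
  have hV : ∀ g : G, ∀ v ∈ Submodule.span k (Set.range x),
      g • v ∈ Submodule.span k (Set.range x) := by
    intro g v hv
    induction hv using Submodule.span_induction with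
    | mem y hy =>
      obtain ⟨h, rfl⟩ := hy
      rw [hact]
      exact Submodule.subset_span ⟨_, rfl⟩
    | zero => rw [smul_zero]; exact zero_mem _
    | add y z _ _ hy hz => rw [smul_add]; exact add_mem hy hz
    | smul a y _ hy => rw [smul_comm]; exact Submodule.smul_mem _ _ hy
  obtain ⟨v, θ, η, a, b, c, d, e, f, g, h, i⟩ := exists_V hp ζ hζ H _ hV u huV hu0 hu1 hu2
  exact ⟨v, θ, η, a, b, c, d, e, f, g, h, i⟩

section

variable {k F G : Type*} [Field k] [Field F] [Algebra k F] [Group G]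
    [MulSemiringAction G F] [SMulCommClass G k F] {p : ℕ} {ζ : k} {f1 f2 f0 h1 h2 : G}
    {V : Submodule k F} {v : ZMod p → F} {θ η : k}

theorem smul_div_act (g : G) (a b : F) : g • (a / b) = (g • a) / (g • b) := by
  rw [div_eq_mul_inv, smul_mul', smul_inv'', ← div_eq_mul_inv]

theorem smul_div_smul_k (c : k) (hc : c ≠ 0) (a b : F) : (c • a) / (c • b) = a / b := by
  rw [Algebra.smul_def, Algebra.smul_def, mul_div_mul_left]
  rwa [Ne, map_eq_zero]

theorem ccoef_zero [NeZero p] : ccoef ζ (0 : ZMod p) = 1 := by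
  simp [ccoef]

theorem IsV.t1 (hv : IsV p ζ f1 f2 f0 h1 h2 V v θ η) (i : ZMod p) :
    f1 • (v i / v 0) = (v (i + 1) / v 0) / (v 1 / v 0) := by
  have h0 := hv.ne 0
  have h1 := hv.ne 1
  rw [smul_div_act, hv.b1, hv.b1, smul_div_smul_k _ hv.hθ, zero_add]
  field_simp

theorem IsV.t2 [NeZero p] (hv : IsV p ζ f1 f2 f0 h1 h2 V v θ η) (i : ZMod p) :
    f2 • (v i / v 0) = ccoef ζ i • (v i / v 0) := by
  rw [smul_div_act, hv.b2, hv.b2, smul_div_smul_k _ hv.hη, ccoef_zero, one_smul, smul_div_assoc]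

/-- the action by algebra maps -/
def actHom (k F : Type*) {G : Type*} [Field k] [Field F] [Algebra k F] [Group G]
    [MulSemiringAction G F] [SMulCommClass G k F] (g : G) : F →ₐ[k] F :=
  MulSemiringAction.toAlgHom k F g

theorem actHom_apply (g : G) (x : F) : actHom k F g x = g • x := rfl

theorem stable_of_gen [Finite G] {s : Set G} (hs : Subgroup.closure s = ⊤) (S : Set F)
    (h : ∀ g ∈ s, ∀ a ∈ S, g • a ∈ IntermediateField.adjoin k S) (g : G) :
    ∀ a ∈ IntermediateField.adjoin k S, g • a ∈ IntermediateField.adjoin k S := by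
  refine gen_induction hs
    (fun g => ∀ a ∈ IntermediateField.adjoin k S, g • a ∈ IntermediateField.adjoin k S) ?_ ?_ ?_ g
  · intro a ha; rwa [one_smul]
  · intro x y hx hy a ha
    rw [mul_smul]
    exact hx _ (hy _ ha)
  · intro g hg
    exact adjoin_stable S (actHom k F g) _ (h g hg)

theorem coc_of_gen [Finite G] {s : Set G} (hs : Subgroup.closure s = ⊤) (K : IntermediateField k F)
    (hK : ∀ g : G, ∀ a ∈ K, g • a ∈ K) (y : F) (hy : y ≠ 0)
    (h : ∀ g ∈ s, (g • y) / y ∈ K) (g : G) : (g • y) / y ∈ K := by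
  refine gen_induction hs (fun g => (g • y) / y ∈ K) ?_ ?_ h g
  · rw [one_smul, div_self hy]; exact one_mem _
  · intro a b ha hb
    have h1 := mul_mem (hK a _ hb) ha
    rw [smul_div_act] at h1
    have : a • y ≠ 0 := by rwa [Ne, smul_eq_zero_iff_eq]
    rw [mul_smul]
    convert h1 using 1
    field_simp

end

section core

variable {k F G : Type*} [Field k] [IsAlgClosed k] [Field F] [Algebra k F] [Group G] [Finite G]
    [MulSemiringAction G F] [SMulCommClass G k F] {p : ℕ} {ζ : k} {f1 f2 f0 h1 h2 : G}
    {V : Submodule k F} {v v' : ZMod p → F} {θ η θb ηb : k}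

/-- the field generated by ratios -/
def KK (k : Type*) {F : Type*} [Field k] [Field F] [Algebra k F] {p : ℕ} (v v' : ZMod p → F) :
    IntermediateField k F :=
  IntermediateField.adjoin k (Set.range (fun i => v i / v 0) ∪ Set.range (fun i => v' i / v' 0))

/-- the field generated by the two summands -/
def LL (k : Type*) {F : Type*} [Field k] [Field F] [Algebra k F] {p : ℕ} (v v' : ZMod p → F) :
    IntermediateField k F :=
  IntermediateField.adjoin k (Set.range v ∪ Set.range v')

theorem mem_KK1 (i : ZMod p) : v i / v 0 ∈ KK k v v' :=
  IntermediateField.subset_adjoin _ _ (Or.inl ⟨i, rfl⟩)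
theorem mem_KK2 (i : ZMod p) : v' i / v' 0 ∈ KK k v v' :=
  IntermediateField.subset_adjoin _ _ (Or.inr ⟨i, rfl⟩)
theorem mem_LL1 (i : ZMod p) : v i ∈ LL k v v' :=
  IntermediateField.subset_adjoin _ _ (Or.inl ⟨i, rfl⟩)
theorem mem_LL2 (i : ZMod p) : v' i ∈ LL k v v' :=
  IntermediateField.subset_adjoin _ _ (Or.inr ⟨i, rfl⟩)

theorem smulk_mem (K : IntermediateField k F) (c : k) (x : F) (hx : x ∈ K) : c • x ∈ K := by
  rw [Algebra.smul_def]
  exact mul_mem (K.algebraMap_mem c) hx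

theorem KK_stable [NeZero p] (H : Phi6Data p f1 f2 f0 h1 h2) (hv : IsV p ζ f1 f2 f0 h1 h2 V v θ η)
    (hv' : IsV p ζ f2 f1 f0⁻¹ h2⁻¹ h1⁻¹ V v' θb ηb) (g : G) :
    ∀ a ∈ KK k v v', g • a ∈ KK k v v' := by
  refine stable_of_gen H.gen _ ?_ g
  rintro g (rfl | rfl) a (⟨i, rfl⟩ | ⟨i, rfl⟩)
  · simp only [hv.t1]
    exact div_mem (mem_KK1 _) (mem_KK1 _)
  · simp only [hv'.t2]
    exact smulk_mem _ _ _ (mem_KK2 _)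
  · simp only [hv.t2]
    exact smulk_mem _ _ _ (mem_KK1 _)
  · simp only [hv'.t1]
    exact div_mem (mem_KK2 _) (mem_KK2 _)

theorem LL_stable (H : Phi6Data p f1 f2 f0 h1 h2) (hv : IsV p ζ f1 f2 f0 h1 h2 V v θ η)
    (hv' : IsV p ζ f2 f1 f0⁻¹ h2⁻¹ h1⁻¹ V v' θb ηb) (g : G) :
    ∀ a ∈ LL k v v', g • a ∈ LL k v v' := by
  refine stable_of_gen H.gen _ ?_ g
  rintro g (rfl | rfl) a (⟨i, rfl⟩ | ⟨i, rfl⟩)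
  · rw [hv.b1]
    exact smulk_mem _ _ _ (mem_LL1 _)
  · rw [hv'.b2]
    exact smulk_mem _ _ _ (smulk_mem _ _ _ (mem_LL2 _))
  · rw [hv.b2]
    exact smulk_mem _ _ _ (smulk_mem _ _ _ (mem_LL1 _))
  · rw [hv'.b1]
    exact smulk_mem _ _ _ (mem_LL2 _)

theorem coc1 [NeZero p] (H : Phi6Data p f1 f2 f0 h1 h2) (hv : IsV p ζ f1 f2 f0 h1 h2 V v θ η)
    (hv' : IsV p ζ f2 f1 f0⁻¹ h2⁻¹ h1⁻¹ V v' θb ηb) (g : G) :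
    (g • v 0) / v 0 ∈ KK k v v' := by
  refine coc_of_gen H.gen _ (KK_stable H hv hv') _ (hv.ne 0) ?_ g
  rintro g (rfl | rfl)
  · rw [hv.b1, smul_div_assoc]
    exact smulk_mem _ _ _ (mem_KK1 _)
  · rw [hv.b2, smul_div_assoc, smul_div_assoc]
    exact smulk_mem _ _ _ (smulk_mem _ _ _ (mem_KK1 _))

theorem coc2 [NeZero p] (H : Phi6Data p f1 f2 f0 h1 h2) (hv : IsV p ζ f1 f2 f0 h1 h2 V v θ η)
    (hv' : IsV p ζ f2 f1 f0⁻¹ h2⁻¹ h1⁻¹ V v' θb ηb) (g : G) :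
    (g • v' 0) / v' 0 ∈ KK k v v' := by
  refine coc_of_gen H.gen _ (KK_stable H hv hv') _ (hv'.ne 0) ?_ g
  rintro g (rfl | rfl)
  · rw [hv'.b2, smul_div_assoc, smul_div_assoc]
    exact smulk_mem _ _ _ (smulk_mem _ _ _ (mem_KK2 _))
  · rw [hv'.b1, smul_div_assoc]
    exact smulk_mem _ _ _ (mem_KK2 _)

theorem cen_act1 (hζ0 : ζ ≠ 0) (hv : IsV p ζ f1 f2 f0 h1 h2 V v θ η) (m n : ℤ) (i : ZMod p) :
    (h1 ^ m * h2 ^ n) • v i = ζ ^ m • v i := by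
  rw [mul_smul, zpow_smul_eig h2 (1 : k) one_ne_zero (v i) (by rw [hv.a2, one_smul]), one_zpow,
    one_smul, zpow_smul_eig h1 ζ hζ0 _ (hv.a1 i)]

theorem cen_act2 (hζ0 : ζ ≠ 0) (hv' : IsV p ζ f2 f1 f0⁻¹ h2⁻¹ h1⁻¹ V v' θb ηb) (m n : ℤ)
    (i : ZMod p) :
    (h1 ^ m * h2 ^ n) • v' i = ζ ^ (-n) • v' i := by
  have e1 : h2 ^ n = h2⁻¹ ^ (-n) := by simp
  have e2 : h1 ^ m = h1⁻¹ ^ (-m) := by simp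
  rw [e1, e2, mul_smul, zpow_smul_eig h2⁻¹ ζ hζ0 _ (hv'.a1 i), smul_comm,
    zpow_smul_eig h1⁻¹ (1 : k) one_ne_zero (v' i) (by rw [hv'.a2, one_smul]), one_zpow,
    one_smul]

theorem LL_faithful (hp : p.Prime) (hζ : IsPrimitiveRoot ζ p) (H : Phi6Data p f1 f2 f0 h1 h2)
    (hv : IsV p ζ f1 f2 f0 h1 h2 V v θ η)
    (hv' : IsV p ζ f2 f1 f0⁻¹ h2⁻¹ h1⁻¹ V v' θb ηb) (g : G)
    (hg : ∀ a ∈ LL k v v', g • a = a) : g = 1 := by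
  have hζ0 : ζ ≠ 0 := hζ.ne_zero hp.ne_zero
  let N : Subgroup G :=
    { carrier := {g | ∀ a ∈ LL k v v', g • a = a}
      mul_mem' := by
        intro x y hx hy a ha
        rw [mul_smul, hy a ha, hx a ha]
      one_mem' := fun a _ => one_smul _ a
      inv_mem' := by
        intro x hx a ha
        rw [inv_smul_eq_iff, hx a ha] }
  have hN : N.Normal := by
    constructor
    intro n hn g a ha
    rw [mul_smul, mul_smul, hn _ (LL_stable H hv hv' _ _ ha), smul_inv_smul]
  have hbot : N = ⊥ := by
    refine normal_inf_center hp H.card N ?_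
    intro z hz hzc
    obtain ⟨m, n, rfl⟩ := H.cen z hzc
    have hs : ∀ (c : k) (y : F), y ≠ 0 → c • y = y → c = 1 := by
      intro c y hy h
      have : (c - 1) • y = 0 := by rw [sub_smul, h, one_smul, sub_self]
      exact sub_eq_zero.1 ((smul_eq_zero.1 this).resolve_right hy)
    have e1 := hz (v 0) (mem_LL1 0)
    have e2 := hz (v' 0) (mem_LL2 0)
    rw [cen_act1 hζ0 hv] at e1
    rw [cen_act2 hζ0 hv'] at e2
    have d1 := (hζ.zpow_eq_one_iff_dvd m).1 (hs _ _ (hv.ne 0) e1)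
    have d2 := (hζ.zpow_eq_one_iff_dvd (-n)).1 (hs _ _ (hv'.ne 0) e2)
    obtain ⟨a, rfl⟩ := d1
    obtain ⟨b, hb⟩ := (dvd_neg.1 d2)
    rw [hb, zpow_mul, zpow_mul, zpow_natCast, zpow_natCast, H.p1, H.p2]
    simp
  have : g ∈ N := hg
  rw [hbot] at this
  simpa using this

theorem KK_central (hp : p.Prime) (hζ : IsPrimitiveRoot ζ p) (H : Phi6Data p f1 f2 f0 h1 h2)
    (hv : IsV p ζ f1 f2 f0 h1 h2 V v θ η)
    (hv' : IsV p ζ f2 f1 f0⁻¹ h2⁻¹ h1⁻¹ V v' θb ηb) (g : G)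
    (hg : ∀ a ∈ KK k v v', g • a = a) : g ∈ Subgroup.center G := by
  have : NeZero p := ⟨hp.ne_zero⟩
  have key : ∀ w : ZMod p → F, (∀ i, w i ≠ 0) → (∀ i, g • (w i / w 0) = w i / w 0) →
      (g • (g • w 0 / w 0) = g • w 0 / w 0) → ∃ c : k, ∀ i, g • w i = c • w i := by
    intro w hw h1 h2
    obtain ⟨c, hc⟩ := scalar_of_fix (k := k) g (w 0) (hw 0) h2
    refine ⟨c, fun i => ?_⟩
    have : w i = (w i / w 0) * w 0 := by rw [div_mul_cancel₀ _ (hw 0)]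
    rw [this, smul_mul', h1, hc, mul_smul_comm]
  obtain ⟨c, hc⟩ := key v hv.ne (fun i => hg _ (mem_KK1 i)) (hg _ (coc1 H hv hv' g))
  obtain ⟨c', hc'⟩ := key v' hv'.ne (fun i => hg _ (mem_KK2 i)) (hg _ (coc2 H hv hv' g))
  have hcomm : ∀ f : G, f = f1 ∨ f = f2 → g * f = f * g := by
    intro f hf
    have h1 : g⁻¹ * f⁻¹ * g * f = 1 := by
      refine LL_faithful hp hζ H hv hv' _ ?_
      refine adjoin_fixed _ (actHom k F (g⁻¹ * f⁻¹ * g * f)) ?_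
      have hfin : ∀ s : F, g • f • s = f • g • s → actHom k F (g⁻¹ * f⁻¹ * g * f) s = s := by
        intro s hs
        rw [actHom_apply, mul_smul, mul_smul, mul_smul, hs, inv_smul_smul, inv_smul_smul]
      rintro _ (⟨i, rfl⟩ | ⟨i, rfl⟩)
      · apply hfin
        rcases hf with rfl | rfl
        · rw [hc, smul_comm f c, hv.b1, smul_comm g θ, hc, smul_comm c]
        · rw [hc, smul_comm f c, hv.b2, smul_comm g η, smul_comm g (ccoef ζ i), hc,
            smul_comm c η, smul_comm c (ccoef ζ i)]
      · apply hfin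
        rcases hf with rfl | rfl
        · rw [hc', smul_comm f c', hv'.b2, smul_comm g ηb, smul_comm g (ccoef ζ i), hc',
            smul_comm c' ηb, smul_comm c' (ccoef ζ i)]
        · rw [hc', smul_comm f c', hv'.b1, smul_comm g θb, hc', smul_comm c']
    have h2 : f * g * (g⁻¹ * f⁻¹ * g * f) = g * f := by group
    rw [← h2, h1, mul_one]
  rw [Subgroup.mem_center_iff]
  intro x
  refine gen_induction H.gen (fun x => x * g = g * x) (by simp) ?_ ?_ x
  · intro a b ha hb
    rw [mul_assoc, hb, ← mul_assoc, ha, mul_assoc]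
  · rintro f hf
    exact (hcomm f hf).symm

theorem cen_pow1 (hp : p.Prime) (hζ : IsPrimitiveRoot ζ p) (H : Phi6Data p f1 f2 f0 h1 h2)
    (hv : IsV p ζ f1 f2 f0 h1 h2 V v θ η) (g : G) (hg : g ∈ Subgroup.center G) :
    g • (v 0 ^ p) = v 0 ^ p := by
  obtain ⟨m, n, rfl⟩ := H.cen g hg
  rw [smul_pow', cen_act1 (hζ.ne_zero hp.ne_zero) hv, smul_pow, ← zpow_natCast, ← zpow_mul,
    mul_comm, zpow_mul, zpow_natCast, hζ.pow_eq_one, one_zpow, one_smul]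

theorem cen_pow2 (hp : p.Prime) (hζ : IsPrimitiveRoot ζ p) (H : Phi6Data p f1 f2 f0 h1 h2)
    (hv' : IsV p ζ f2 f1 f0⁻¹ h2⁻¹ h1⁻¹ V v' θb ηb) (g : G) (hg : g ∈ Subgroup.center G) :
    g • (v' 0 ^ p) = v' 0 ^ p := by
  obtain ⟨m, n, rfl⟩ := H.cen g hg
  rw [smul_pow', cen_act2 (hζ.ne_zero hp.ne_zero) hv', smul_pow, ← zpow_natCast, ← zpow_mul,
    mul_comm, zpow_mul, zpow_natCast, hζ.pow_eq_one, one_zpow, one_smul]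

theorem span_smul_eq (g : G) (c : k) (S : Set F) (h : ∀ y ∈ S, g • y = c • y) (y : F)
    (hy : y ∈ Submodule.span k S) : g • y = c • y := by
  induction hy using Submodule.span_induction with
  | mem y hy => exact h y hy
  | zero => simp
  | add y z _ _ hy hz => rw [smul_add, hy, hz, smul_add]
  | smul a y _ hy => rw [smul_comm, hy, smul_comm]

theorem linInd_sum (hp : p.Prime) (hζ : IsPrimitiveRoot ζ p)
    (hv : IsV p ζ f1 f2 f0 h1 h2 V v θ η)
    (hv' : IsV p ζ f2 f1 f0⁻¹ h2⁻¹ h1⁻¹ V v' θb ηb) : LinearIndependent k (Sum.elim v v') := by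
  refine LinearIndependent.sum_type (linInd_V hp ζ hζ f0 v hv.ne hv.b0)
    (linInd_V hp ζ hζ f0⁻¹ v' hv'.ne hv'.b0) ?_
  rw [Submodule.disjoint_def]
  intro y hy hy'
  have e1 : h1 • y = ζ • y := span_smul_eq h1 ζ _ (by rintro _ ⟨i, rfl⟩; exact hv.a1 i) y hy
  have e2 : h1⁻¹ • y = (1 : k) • y :=
    span_smul_eq h1⁻¹ 1 _ (by rintro _ ⟨i, rfl⟩; rw [one_smul]; exact hv'.a2 i) y hy'
  rw [one_smul, inv_smul_eq_iff, e1] at e2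
  have : (ζ - 1) • y = 0 := by rw [sub_smul, ← e2, one_smul, sub_self]
  refine (smul_eq_zero.1 this).resolve_left ?_
  rw [sub_eq_zero]
  exact hζ.ne_one hp.one_lt

end core


theorem alpha_of_algInd {k F ι : Type*} [Field k] [Field F] [Algebra k F] (T : ι → F)
    (hT : AlgebraicIndependent k T) :
    ∃ α : FractionRing (MvPolynomial ι k) →ₐ[k] F, (∀ i, α (varEmbed k ι i) = T i) ∧
      ∀ y ∈ IntermediateField.adjoin k (Set.range T), ∃ r, α r = y := by
  have hinj : Function.Injective (MvPolynomial.aeval T : MvPolynomial ι k →ₐ[k] F) := hT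
  let α : FractionRing (MvPolynomial ι k) →ₐ[k] F := IsFractionRing.liftAlgHom hinj
  have hα : ∀ i, α (varEmbed k ι i) = T i := by
    intro i
    simp only [α, varEmbed, IsFractionRing.liftAlgHom_apply]
    rw [IsFractionRing.lift_algebraMap]
    simp
  refine ⟨α, hα, ?_⟩
  have : IntermediateField.adjoin k (Set.range T) ≤ α.fieldRange := by
    rw [IntermediateField.adjoin_le_iff]
    rintro _ ⟨i, rfl⟩
    exact ⟨_, hα i⟩
  intro y hy
  exact this hy

open scoped IntermediateField.algebraAdjoinAdjoin in
theorem algInd_of_gen {k F ι G : Type} [Field k] [Field F] [Algebra k F] [Finite ι] [Finite G]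
    (T : ι → F)
    (x : G → F) (hx : AlgebraicIndependent k x) (hc : Nat.card ι ≤ Nat.card G)
    (S : Set F)
    (hS : ∀ s ∈ S, IsIntegral (IntermediateField.adjoin k (Set.range T)) s)
    (htop : ∀ y : F, y ∈ IntermediateField.adjoin k
      ((IntermediateField.adjoin k (Set.range T) : Set F) ∪ S)) :
    AlgebraicIndependent k T := by
  have halg : Algebra.IsAlgebraic (IntermediateField.adjoin k (Set.range T)) F := by
    have h1 : IntermediateField.adjoin k
        ((IntermediateField.adjoin k (Set.range T) : Set F) ∪ S) ≤
        (algebraicClosure (IntermediateField.adjoin k (Set.range T)) F).restrictScalars k := by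
      rw [IntermediateField.adjoin_le_iff]
      rintro y (hy | hy)
      · exact (algebraicClosure (IntermediateField.adjoin k (Set.range T)) F).algebraMap_mem ⟨y, hy⟩
      · exact mem_algebraicClosure_iff'.2 (hS y hy)
    exact ⟨fun y => mem_algebraicClosure_iff.1 (h1 (htop y))⟩
  have halg2 : Algebra.IsAlgebraic (Algebra.adjoin k (Set.range T)) F :=
    (IsFractionRing.comap_isAlgebraic_iff (K := IntermediateField.adjoin k (Set.range T))).2 halg
  refine (Algebra.IsAlgebraic.isTranscendenceBasis_of_le_trdeg_of_finite k T ?_).1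
  refine le_trans ?_ hx.cardinalMk_le_trdeg
  rw [← Nat.cast_card, ← Nat.cast_card]
  exact_mod_cast hc

/-- index type of the transcendence basis -/
abbrev Idx (p : ℕ) : Type :=
  {i : ZMod p // i ≠ 0} ⊕ {i : ZMod p // i ≠ 0} ⊕ Fin (p ^ 5 - 2 * p + 2)

open Classical in
/-- first family of variables -/
noncomputable def tt1 (k : Type) [Field k] {p : ℕ} (i : ZMod p) :
    FractionRing (MvPolynomial (Idx p) k) :=
  if h : i = 0 then 1 else varEmbed k (Idx p) (Sum.inl ⟨i, h⟩)

open Classical in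
/-- second family of variables -/
noncomputable def tt2 (k : Type) [Field k] {p : ℕ} (i : ZMod p) :
    FractionRing (MvPolynomial (Idx p) k) :=
  if h : i = 0 then 1 else varEmbed k (Idx p) (Sum.inr (Sum.inl ⟨i, h⟩))

/-- the action of `f1` on the variables -/
noncomputable def form1 {k : Type} [Field k] {p : ℕ} (ζ : k) :
    Idx p → FractionRing (MvPolynomial (Idx p) k)
  | Sum.inl i => tt1 k (i.1 + 1) / tt1 k 1
  | Sum.inr (Sum.inl i) => ccoef ζ i.1 • tt2 k i.1
  | Sum.inr (Sum.inr j) => varEmbed k (Idx p) (Sum.inr (Sum.inr j))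

/-- the action of `f2` on the variables -/
noncomputable def form2 {k : Type} [Field k] {p : ℕ} (ζ : k) :
    Idx p → FractionRing (MvPolynomial (Idx p) k)
  | Sum.inl i => ccoef ζ i.1 • tt1 k i.1
  | Sum.inr (Sum.inl i) => tt2 k (i.1 + 1) / tt2 k 1
  | Sum.inr (Sum.inr j) => varEmbed k (Idx p) (Sum.inr (Sum.inr j))

theorem card_Idx {p : ℕ} (hp : p.Prime) : Nat.card (Idx p) = p ^ 5 := by
  have : NeZero p := ⟨hp.ne_zero⟩
  have h1 : Nat.card {i : ZMod p // i ≠ 0} = p - 1 := by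
    rw [Nat.card_eq_fintype_card, Fintype.card_subtype_compl, ZMod.card]
    simp
  rw [Nat.card_sum, Nat.card_sum, h1, Nat.card_fin]
  have h2 := hp.two_le
  have h3 : 2 * p ≤ p ^ 5 := by
    calc 2 * p ≤ p * p := Nat.mul_le_mul_right _ h2
      _ = p ^ 2 := by ring
      _ ≤ p ^ 5 := Nat.pow_le_pow_right hp.pos (by norm_num)
  omega

theorem main1 {k F G : Type} [Field k] [IsAlgClosed k] [Field F] [Algebra k F] [Group G] [Finite G]
    [MulSemiringAction G F] [SMulCommClass G k F] {p : ℕ} (hp : p.Prime) (hpk : (p : k) ≠ 0) (ζ : k)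
    (hζ : IsPrimitiveRoot ζ p) {f1 f2 f0 h1 h2 : G} (H : Phi6Data p f1 f2 f0 h1 h2)
    (x : G → F) (hx : AlgebraicIndependent k x)
    (hxtop : IntermediateField.adjoin k (Set.range x) = ⊤)
    (hact : ∀ h g : G, h • x g = x (h * g)) :
    ∃ α : FractionRing (MvPolynomial (Idx p) k) →ₐ[k] F,
      (∀ y : F, (∀ g : G, g • y = y) → ∃ r, α r = y) ∧
      (∀ i, f1 • α (varEmbed k (Idx p) i) = α (form1 ζ i)) ∧
      (∀ i, f2 • α (varEmbed k (Idx p) i) = α (form2 ζ i)) := by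
  classical
  have : Fintype G := Fintype.ofFinite G
  have : NeZero p := ⟨hp.ne_zero⟩
  have hli := hx.linearIndependent
  obtain ⟨v, θ, η, hv⟩ := exists_isV hp ζ hζ H x hli hact
  obtain ⟨v', θb, ηb, hv'⟩ := exists_isV hp ζ hζ H.swap x hli hact
  have hcardF : (Nat.card G : F) ≠ 0 := by
    rw [H.card]
    push_cast
    have : (p : F) = algebraMap k F p := by simp
    rw [this]
    exact pow_ne_zero _ (by rwa [Ne, map_eq_zero])
  have hKst := KK_stable H hv hv'
  obtain ⟨z1, hz10, hz1, hz1K⟩ := exists_z (KK k v v') hcardF hKst (v 0 ^ p)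
    (pow_ne_zero _ (hv.ne 0)) (fun g => by
      rw [smul_pow', ← div_pow]; exact pow_mem (coc1 H hv hv' g) _)
    (fun g hg => cen_pow1 hp hζ H hv g (KK_central hp hζ H hv hv' g hg))
  obtain ⟨z2, hz20, hz2, hz2K⟩ := exists_z (KK k v v') hcardF hKst (v' 0 ^ p)
    (pow_ne_zero _ (hv'.ne 0)) (fun g => by
      rw [smul_pow', ← div_pow]; exact pow_mem (coc2 H hv hv' g) _)
    (fun g hg => cen_pow2 hp hζ H hv' g (KK_central hp hζ H hv hv' g hg))
  have hW := linInd_sum hp hζ hv hv'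
  obtain ⟨s, hs, hsx⟩ := exists_s x hli hact hcardF (LL k v v') (LL_stable H hv hv')
    (LL_faithful hp hζ H hv hv') (Submodule.span k (Set.range (Sum.elim v v')))
    (by
      rw [Submodule.span_le]
      rintro _ ⟨i | i, rfl⟩
      · exact hv.mem i
      · exact hv'.mem i)
    (by
      intro w hw
      induction hw using Submodule.span_induction with
      | mem y hy =>
        obtain ⟨i | i, rfl⟩ := hy
        · exact mem_LL1 i
        · exact mem_LL2 i
      | zero => exact zero_mem _
      | add y z _ _ hy hz => exact add_mem hy hz
      | smul a y _ hy => exact smulk_mem _ _ _ hy)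
    (v 0) (Submodule.subset_span ⟨Sum.inl 0, rfl⟩) (hv.ne 0) (p ^ 5 - 2 * p)
    (by
      rw [finrank_span_eq_card hW, H.card, Fintype.card_sum, ZMod.card]
      have h2 := hp.two_le
      have h3 : 2 * p ≤ p ^ 5 := by
        calc 2 * p ≤ p * p := Nat.mul_le_mul_right _ h2
          _ = p ^ 2 := by ring
          _ ≤ p ^ 5 := Nat.pow_le_pow_right hp.pos (by norm_num)
      omega)
  let q : Fin (p ^ 5 - 2 * p + 2) → F := Fin.append s ![z1, z2]
  have hq : ∀ j, ∀ g : G, g • q j = q j := by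
    intro j g
    refine Fin.addCases (fun i => ?_) (fun i => ?_) j
    · simp only [q, Fin.append_left]; exact hs i g
    · simp only [q, Fin.append_right]
      fin_cases i
      · exact hz1 g
      · exact hz2 g
  let T : Idx p → F := Sum.elim (fun i => v i.1 / v 0) (Sum.elim (fun i => v' i.1 / v' 0) q)
  let M := IntermediateField.adjoin k (Set.range T)
  have hTM : ∀ i, T i ∈ M := fun i => IntermediateField.subset_adjoin _ _ ⟨i, rfl⟩
  have htM : ∀ i, v i / v 0 ∈ M := by
    intro i
    by_cases h : i = 0
    · rw [h, div_self (hv.ne 0)]; exact one_mem _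
    · exact hTM (Sum.inl ⟨i, h⟩)
  have htM' : ∀ i, v' i / v' 0 ∈ M := by
    intro i
    by_cases h : i = 0
    · rw [h, div_self (hv'.ne 0)]; exact one_mem _
    · exact hTM (Sum.inr (Sum.inl ⟨i, h⟩))
  have hqM : ∀ j, q j ∈ M := fun j => hTM (Sum.inr (Sum.inr j))
  have hsM : ∀ j, s j ∈ M := fun j => by
    have := hqM (Fin.castAdd 2 j)
    simpa only [q, Fin.append_left] using this
  have hz1M : z1 ∈ M := by
    have := hqM (Fin.natAdd (p ^ 5 - 2 * p) 0)
    simp only [q, Fin.append_right] at this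
    exact this
  have hz2M : z2 ∈ M := by
    have := hqM (Fin.natAdd (p ^ 5 - 2 * p) 1)
    simp only [q, Fin.append_right] at this
    exact this
  have hKM : KK k v v' ≤ M := by
    unfold KK
    rw [IntermediateField.adjoin_le_iff]
    rintro _ (⟨i, rfl⟩ | ⟨i, rfl⟩)
    · exact htM i
    · exact htM' i
  have hv0M : v 0 ^ p ∈ M := by
    have h := div_mem hz1M (hKM hz1K)
    have e : z1 / (z1 / v 0 ^ p) = v 0 ^ p := by
      have := hv.ne 0
      field_simp
    rwa [e] at h
  have hv0M' : v' 0 ^ p ∈ M := by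
    have h := div_mem hz2M (hKM hz2K)
    have e : z2 / (z2 / v' 0 ^ p) = v' 0 ^ p := by
      have := hv'.ne 0
      field_simp
    rwa [e] at h
  have htop : ∀ (N : IntermediateField k F), M ≤ N → v 0 ∈ N → v' 0 ∈ N → ∀ y, y ∈ N := by
    intro N hMN h0 h0' y
    have hLN : LL k v v' ≤ N := by
      unfold LL
      rw [IntermediateField.adjoin_le_iff]
      rintro _ (⟨i, rfl⟩ | ⟨i, rfl⟩)
      · have := mul_mem (hMN (htM i)) h0
        rwa [div_mul_cancel₀ _ (hv.ne 0)] at this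
      · have := mul_mem (hMN (htM' i)) h0'
        rwa [div_mul_cancel₀ _ (hv'.ne 0)] at this
    have h1 : IntermediateField.adjoin k ((LL k v v' : Set F) ∪ Set.range s) ≤ N := by
      rw [IntermediateField.adjoin_le_iff]
      rintro _ (ha | ⟨i, rfl⟩)
      · exact hLN ha
      · exact hMN (hsM i)
    have h2 : IntermediateField.adjoin k (Set.range x) ≤ N := by
      rw [IntermediateField.adjoin_le_iff]
      rintro _ ⟨g, rfl⟩
      exact h1 (hsx g)
    rw [hxtop] at h2
    exact h2 trivial
  have hintg : ∀ y : F, y ^ p ∈ M → IsIntegral M y := by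
    intro y hy
    refine ⟨Polynomial.X ^ p - Polynomial.C ⟨y ^ p, hy⟩,
      Polynomial.monic_X_pow_sub_C _ hp.ne_zero, ?_⟩
    simp
  have hT : AlgebraicIndependent k T := by
    refine algInd_of_gen T x hx (by rw [card_Idx hp, H.card]) {v 0, v' 0} ?_ ?_
    · rintro y (rfl | rfl)
      · exact hintg _ hv0M
      · exact hintg _ hv0M'
    · refine htop _ ?_ ?_ ?_
      · intro a ha
        exact IntermediateField.subset_adjoin _ _ (Or.inl ha)
      · exact IntermediateField.subset_adjoin _ _ (Or.inr (Or.inl rfl))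
      · exact IntermediateField.subset_adjoin _ _ (Or.inr (Or.inr rfl))
  obtain ⟨α, hα, hαr⟩ := alpha_of_algInd T hT
  have ha1 : ∀ i, α (tt1 k i) = v i / v 0 := by
    intro i
    unfold tt1
    split_ifs with h
    · rw [map_one, h, div_self (hv.ne 0)]
    · exact hα _
  have ha2 : ∀ i, α (tt2 k i) = v' i / v' 0 := by
    intro i
    unfold tt2
    split_ifs with h
    · rw [map_one, h, div_self (hv'.ne 0)]
    · exact hα _
  refine ⟨α, ?_, ?_, ?_⟩
  · intro y hy
    apply hαr
    have hcM : ∀ g : G, (∀ i, g • (v i / v 0) = v i / v 0) →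
        (∀ i, g • (v' i / v' 0) = v' i / v' 0) → ∀ m ∈ M, actHom k F g m = m := by
      intro g hg hg'
      refine adjoin_fixed _ _ ?_
      rintro _ ⟨i | i | j, rfl⟩
      · exact hg i.1
      · exact hg' i.1
      · exact hq j g
    have hζ0 : ζ ≠ 0 := hζ.ne_zero hp.ne_zero
    have hM1 : ∀ m ∈ M, actHom k F h1 m = m := by
      have e : ∀ i, h1 • v' i = v' i := fun i => by
        have := hv'.a2 i
        rw [inv_smul_eq_iff] at this
        exact this.symm
      refine hcM h1 (fun i => ?_) (fun i => ?_)
      · rw [smul_div_act, hv.a1, hv.a1, smul_div_smul_k _ hζ0]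
      · rw [smul_div_act, e, e]
    have e2 : ∀ i, h2⁻¹ • v i = v i := fun i => by
      rw [inv_smul_eq_iff, hv.a2 i]
    have hM2 : ∀ m ∈ IntermediateField.adjoin k ((M : Set F) ∪ {v 0}),
        actHom k F h2⁻¹ m = m := by
      refine adjoin_fixed _ _ ?_
      rintro m (hm | rfl)
      · refine hcM h2⁻¹ (fun i => ?_) (fun i => ?_) m hm
        · rw [smul_div_act, e2, e2]
        · rw [smul_div_act, hv'.a1, hv'.a1, smul_div_smul_k _ hζ0]
      · exact e2 0
    have hMM : M ≤ IntermediateField.adjoin k ((M : Set F) ∪ {v 0}) := fun a ha =>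
      IntermediateField.subset_adjoin _ _ (Or.inl ha)
    refine fixed_step p hp hpk ζ hζ M (v 0) hv0M (actHom k F h1) hM1 (hv.a1 0) y ?_ (hy h1)
    refine fixed_step p hp hpk ζ hζ _ (v' 0) (hMM hv0M') (actHom k F h2⁻¹) hM2 (hv'.a1 0) y ?_
      (hy h2⁻¹)
    refine htop _ (fun a ha => ?_) ?_ ?_ y
    · exact IntermediateField.subset_adjoin _ _ (Or.inl (hMM ha))
    · exact IntermediateField.subset_adjoin _ _
        (Or.inl (IntermediateField.subset_adjoin _ _ (Or.inr rfl)))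
    · exact IntermediateField.subset_adjoin _ _ (Or.inr rfl)
  · rintro (i | i | j)
    · rw [hα]
      simp only [form1, map_div₀, ha1]
      exact hv.t1 i.1
    · rw [hα]
      simp only [form1, map_smul, ha2]
      exact hv'.t2 i.1
    · simp only [form1, hα]
      exact hq j f1
  · rintro (i | i | j)
    · rw [hα]
      simp only [form2, map_smul, ha1]
      exact hv.t2 i.1
    · rw [hα]
      simp only [form2, map_div₀, ha2]
      exact hv'.t1 i.1
    · simp only [form2, hα]
      exact hq j f2


theorem constEmbed_eq (k : Type*) [Field k] (σ : Type*) (a : k) :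
    constEmbed k σ a = algebraMap k (FractionRing (MvPolynomial σ k)) a := by
  rw [IsScalarTower.algebraMap_apply k (MvPolynomial σ k)]
  rfl

theorem noetherAut_algebraMap (k : Type*) [Field k] (G : Type*) [Group G] (g : G)
    (q : MvPolynomial G k) :
    noetherAut k G g (algebraMap _ _ q) = algebraMap _ _ (MvPolynomial.rename (g * ·) q) := by
  unfold noetherAut
  rw [IsFractionRing.ringEquivOfRingEquiv_algebraMap]
  rfl

theorem noetherAut_var (k : Type*) [Field k] (G : Type*) [Group G] (g h : G) :
    noetherAut k G g (varEmbed k G h) = varEmbed k G (g * h) := by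
  unfold varEmbed
  rw [noetherAut_algebraMap, MvPolynomial.rename_X]

theorem noetherAut_const (k : Type*) [Field k] (G : Type*) [Group G] (g : G) (a : k) :
    noetherAut k G g (algebraMap k _ a) = algebraMap k _ a := by
  rw [IsScalarTower.algebraMap_apply k (MvPolynomial G k), noetherAut_algebraMap]
  simp [MvPolynomial.algebraMap_eq]

theorem noetherAut_mul (k : Type*) [Field k] (G : Type*) [Group G] (g h : G)
    (x : FractionRing (MvPolynomial G k)) :
    noetherAut k G (g * h) x = noetherAut k G g (noetherAut k G h x) := by
  obtain ⟨a, b, -, rfl⟩ := IsFractionRing.div_surjective (A := MvPolynomial G k) x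
  simp only [map_div₀, noetherAut_algebraMap, MvPolynomial.rename_rename]
  have : ((g * ·) : G → G) ∘ (h * ·) = (g * h * ·) := by
    funext y; simp [mul_assoc]
  rw [this]

theorem noetherAut_one (k : Type*) [Field k] (G : Type*) [Group G]
    (x : FractionRing (MvPolynomial G k)) : noetherAut k G 1 x = x := by
  obtain ⟨a, b, -, rfl⟩ := IsFractionRing.div_surjective (A := MvPolynomial G k) x
  have : ((1 * ·) : G → G) = id := by
    funext y; simp
  simp only [map_div₀, noetherAut_algebraMap, this, MvPolynomial.rename_id, AlgHom.id_apply]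

/-- the Noether action -/
@[reducible] noncomputable def noetherAct (k : Type*) [Field k] (G : Type*) [Group G] :
    MulSemiringAction G (FractionRing (MvPolynomial G k)) where
  smul g x := noetherAut k G g x
  one_smul := noetherAut_one k G
  mul_smul := noetherAut_mul k G
  smul_zero g := map_zero _
  smul_add g := map_add _
  smul_one g := map_one _
  smul_mul g := map_mul _

/-- the Noether automorphism as an algebra map -/
noncomputable def noetherHom (k : Type*) [Field k] (G : Type*) [Group G] (g : G) :
    FractionRing (MvPolynomial G k) →ₐ[k] FractionRing (MvPolynomial G k) :=
  { (noetherAut k G g).toRingHom with commutes' := noetherAut_const k G g }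

theorem noetherHom_apply (k : Type*) [Field k] (G : Type*) [Group G] (g : G)
    (x : FractionRing (MvPolynomial G k)) : noetherHom k G g x = noetherAut k G g x := rfl

theorem main2 {k G : Type} [Field k] [IsAlgClosed k] [Group G] [Finite G]
    {p : ℕ} (hp : p.Prime) (hpk : (p : k) ≠ 0) (ζ : k)
    (hζ : IsPrimitiveRoot ζ p) {f1 f2 f0 h1 h2 : G} (H : Phi6Data p f1 f2 f0 h1 h2) :
    ∃ α : FractionRing (MvPolynomial (Idx p) k) →ₐ[k] FractionRing (MvPolynomial G k),
      (∀ y ∈ NoetherField k G, ∃ r, α r = y) ∧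
      (∀ i, noetherHom k G f1 (α (varEmbed k (Idx p) i)) = α (form1 ζ i)) ∧
      (∀ i, noetherHom k G f2 (α (varEmbed k (Idx p) i)) = α (form2 ζ i)) := by
  letI := noetherAct k G
  have hsc : SMulCommClass G k (FractionRing (MvPolynomial G k)) := by
    constructor
    intro g a x
    rw [Algebra.smul_def, Algebra.smul_def, smul_mul']
    congr 1
    exact noetherAut_const k G g a
  refine main1 hp hpk ζ hζ H (fun g => varEmbed k G g) ?_ ?_ (noetherAut_var k G)
  · have h1 := MvPolynomial.algebraicIndependent_X G k
    exact h1.map' (f := Algebra.algHom k (MvPolynomial G k) (FractionRing (MvPolynomial G k)))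
      (IsFractionRing.injective (MvPolynomial G k) (FractionRing (MvPolynomial G k)))
  · rw [eq_top_iff]
    rintro x -
    have key : ∀ q : MvPolynomial G k, algebraMap _ (FractionRing (MvPolynomial G k)) q ∈
        IntermediateField.adjoin k (Set.range (fun g => varEmbed k G g)) := by
      intro q
      induction q using MvPolynomial.induction_on with
      | C a =>
        have : algebraMap (MvPolynomial G k) (FractionRing (MvPolynomial G k)) (MvPolynomial.C a) =
          algebraMap k _ a := constEmbed_eq k G a
        rw [this]
        exact IntermediateField.algebraMap_mem _ _
      | add a b ha hb => rw [map_add]; exact add_mem ha hb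
      | mul_X a i ha =>
        rw [map_mul]
        exact mul_mem ha (IntermediateField.subset_adjoin _ _ ⟨i, rfl⟩)
    obtain ⟨a, b, -, rfl⟩ := IsFractionRing.div_surjective (A := MvPolynomial G k) x
    exact div_mem (key a) (key b)

theorem mem_noether_iff {k G : Type} [Field k] [Group G] [Finite G] {s : Set G}
    (hs : Subgroup.closure s = ⊤) (y : FractionRing (MvPolynomial G k))
    (h : ∀ g ∈ s, noetherAut k G g y = y) : y ∈ NoetherField k G := by
  intro g
  refine gen_induction hs (fun g => noetherAut k G g y = y) (noetherAut_one k G y) ?_ h g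
  intro a b ha hb
  rw [noetherAut_mul, hb, ha]

theorem assemble {k G₁ G₂ R : Type} [Field k] [Group G₁] [Group G₂] [Field R] [Algebra k R]
    (α₁ : R →ₐ[k] FractionRing (MvPolynomial G₁ k)) (α₂ : R →ₐ[k] FractionRing (MvPolynomial G₂ k))
    (s₁ : ∀ y ∈ NoetherField k G₁, ∃ r, α₁ r = y) (s₂ : ∀ y ∈ NoetherField k G₂, ∃ r, α₂ r = y)
    (h : ∀ r, α₁ r ∈ NoetherField k G₁ ↔ α₂ r ∈ NoetherField k G₂) :
    ∃ e : NoetherField k G₁ ≃+* NoetherField k G₂,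
      ∀ (a : k) (x : NoetherField k G₁),
        (x : FractionRing (MvPolynomial G₁ k)) = constEmbed k G₁ a →
        ((e x : NoetherField k G₂) : FractionRing (MvPolynomial G₂ k)) = constEmbed k G₂ a := by
  let P₁ : Subfield R := (NoetherField k G₁).comap α₁.toRingHom
  let β₁ : P₁ →+* NoetherField k G₁ :=
    (α₁.toRingHom.comp P₁.subtype).codRestrict (NoetherField k G₁) (fun r => r.2)
  let β₂ : P₁ →+* NoetherField k G₂ :=
    (α₂.toRingHom.comp P₁.subtype).codRestrict (NoetherField k G₂) (fun r => (h r.1).1 r.2)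
  have b₁ : Function.Bijective β₁ := by
    refine ⟨β₁.injective, fun y => ?_⟩
    obtain ⟨r, hr⟩ := s₁ y y.2
    refine ⟨⟨r, ?_⟩, Subtype.ext hr⟩
    change α₁ r ∈ NoetherField k G₁
    rw [hr]; exact y.2
  have b₂ : Function.Bijective β₂ := by
    refine ⟨β₂.injective, fun y => ?_⟩
    obtain ⟨r, hr⟩ := s₂ y y.2
    refine ⟨⟨r, ?_⟩, Subtype.ext hr⟩
    change α₁ r ∈ NoetherField k G₁
    rw [h, hr]; exact y.2
  let e₁ := RingEquiv.ofBijective β₁ b₁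
  let e₂ := RingEquiv.ofBijective β₂ b₂
  refine ⟨e₁.symm.trans e₂, ?_⟩
  intro a x hx
  have ha : algebraMap k R a ∈ P₁ := by
    change α₁ (algebraMap k R a) ∈ NoetherField k G₁
    rw [α₁.commutes, ← constEmbed_eq, ← hx]
    exact x.2
  have h1 : e₁ ⟨algebraMap k R a, ha⟩ = x := by
    apply Subtype.ext
    rw [hx, constEmbed_eq]
    exact α₁.commutes a
  rw [← h1, RingEquiv.trans_apply, RingEquiv.symm_apply_apply, constEmbed_eq]
  exact α₂.commutes a

/-- Let `p` be an odd prime, `k` an algebraically closed field with `char k ≠ p`, and let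
`G₁`, `G₂` be two groups of order `p⁵` belonging to the isoclinism family `Φ₆` (both generated
by `f1, f2, f0, h1, h2` with `Z(G) = ⟨h1,h2⟩`, `[f1,f2] = f0`, `[f0,f1] = h1`, `[f0,f2] = h2`,
`f0^p = h1^p = h2^p = 1`, `f1^p, f2^p ∈ ⟨h1,h2⟩`). Then `k(G₁) ≅ k(G₂)` as field extensions
of `k`. -/
theorem noetherField_iso_of_phi6 (p : ℕ) (hp : p.Prime) (hodd : Odd p)
    (k : Type) [Field k] [IsAlgClosed k] (hchar : ringChar k ≠ p)
    (G₁ : Type) [Group G₁] [Finite G₁] (hcard₁ : Nat.card G₁ = p ^ 5)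
    (f1 f2 f0 h1 h2 : G₁)
    (hgen₁ : Subgroup.closure {f1, f2, f0, h1, h2} = ⊤)
    (hcen₁ : Subgroup.closure {h1, h2} = Subgroup.center G₁)
    (r1 : cmt f1 f2 = f0) (r2 : cmt f0 f1 = h1) (r3 : cmt f0 f2 = h2)
    (r4 : f0 ^ p = 1) (r5 : h1 ^ p = 1) (r6 : h2 ^ p = 1)
    (r7 : f1 ^ p ∈ Subgroup.closure ({h1, h2} : Set G₁))
    (r8 : f2 ^ p ∈ Subgroup.closure ({h1, h2} : Set G₁))
    (G₂ : Type) [Group G₂] [Finite G₂] (hcard₂ : Nat.card G₂ = p ^ 5)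
    (g1 g2 g0 j1 j2 : G₂)
    (hgen₂ : Subgroup.closure {g1, g2, g0, j1, j2} = ⊤)
    (hcen₂ : Subgroup.closure {j1, j2} = Subgroup.center G₂)
    (s1 : cmt g1 g2 = g0) (s2 : cmt g0 g1 = j1) (s3 : cmt g0 g2 = j2)
    (s4 : g0 ^ p = 1) (s5 : j1 ^ p = 1) (s6 : j2 ^ p = 1)
    (s7 : g1 ^ p ∈ Subgroup.closure ({j1, j2} : Set G₂))
    (s8 : g2 ^ p ∈ Subgroup.closure ({j1, j2} : Set G₂)) :
    ∃ e : NoetherField k G₁ ≃+* NoetherField k G₂,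
      ∀ (a : k) (x : NoetherField k G₁),
        (x : FractionRing (MvPolynomial G₁ k)) = constEmbed k G₁ a →
        ((e x : NoetherField k G₂) : FractionRing (MvPolynomial G₂ k)) = constEmbed k G₂ a := by
  have hpk : (p : k) ≠ 0 := by
    intro h0
    have h1 := (ringChar.spec k p).1 h0
    rcases (Nat.dvd_prime hp).1 h1 with h2 | h2
    · exact CharP.ringChar_ne_one h2
    · exact hchar h2
  have : NeZero (p : k) := ⟨hpk⟩
  obtain ⟨ζ, hζ⟩ := HasEnoughRootsOfUnity.exists_primitiveRoot k p
  have H₁ := phi6Data_of p hp G₁ hcard₁ f1 f2 f0 h1 h2 hgen₁ hcen₁ r1 r2 r3 r4 r5 r6 r7 r8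
  have H₂ := phi6Data_of p hp G₂ hcard₂ g1 g2 g0 j1 j2 hgen₂ hcen₂ s1 s2 s3 s4 s5 s6 s7 s8
  obtain ⟨α₁, hs₁, ha₁, hb₁⟩ := main2 hp hpk ζ hζ H₁
  obtain ⟨α₂, hs₂, ha₂, hb₂⟩ := main2 hp hpk ζ hζ H₂
  refine assemble α₁ α₂ hs₁ hs₂ (fun r => ⟨fun hr => ?_, fun hr => ?_⟩)
  · refine mem_noether_iff H₂.gen _ ?_
    rintro g (rfl | rfl)
    · exact transfer α₁ α₂ (noetherHom k G₁ f1) (noetherHom k G₂ _) _ ha₁ ha₂ r (hr f1)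
    · exact transfer α₁ α₂ (noetherHom k G₁ f2) (noetherHom k G₂ _) _ hb₁ hb₂ r (hr f2)
  · refine mem_noether_iff H₁.gen _ ?_
    rintro g (rfl | rfl)
    · exact transfer α₂ α₁ (noetherHom k G₂ g1) (noetherHom k G₁ _) _ ha₂ ha₁ r (hr g1)
    · exact transfer α₂ α₁ (noetherHom k G₂ g2) (noetherHom k G₁ _) _ hb₂ hb₁ r (hr g2)
end
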